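/- For each j = 1,…,m and every 0 < ε < 1/2, the local mass σ_{j,k} = ∫_{B_R(x_{j,k})} λ_k V e^{v_k} satisfies σ_{j,k} = 8π + o(λ_k^{1/2−ε}) as k → ∞, assuming only V ∈ C¹(Ω̄). -/

import Mathlib

open MeasureTheory Real Filter Topology Metric Bornology
open scoped RealInnerProductSpace

noncomputable section

/-- The plane `ℝ²`. -/
abbrev E2 : Type := EuclideanSpace ℝ (Fin 2)

/-- The Laplacian of a function on the plane, as the sum of the second partial
derivatives in the coordinate directions. -/
def lap (f : E2 → ℝ) (x : E2) : ℝ :=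
  ∑ i : Fin 2,
    fderiv ℝ (fun y => fderiv ℝ f y (EuclideanSpace.single i 1)) x (EuclideanSpace.single i 1)

/-- `G` is the Dirichlet Green function of `-Δ` on `Ω`, with regular part `K`
(so that `x ↦ K x x` is the Robin function). -/
structure IsGreen (Ω : Set E2) (G K : E2 → E2 → ℝ) : Prop where
  symm : ∀ x y, G x y = G y x
  decomp : ∀ x ∈ Ω, ∀ y ∈ Ω, x ≠ y →
    G x y = -(1 / (2 * π)) * Real.log (dist x y) + K x y
  harmK : ∀ y ∈ Ω, ∀ x ∈ Ω, lap (fun z => K z y) x = 0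
  harmG : ∀ y ∈ Ω, ∀ x ∈ Ω, x ≠ y → lap (fun z => G z y) x = 0
  bdry : ∀ y ∈ Ω, ∀ x ∈ frontier Ω, G x y = 0
  contK : ContinuousOn (fun p : E2 × E2 => K p.1 p.2) (closure Ω ×ˢ Ω ∪ Ω ×ˢ closure Ω)

/-- The Hamiltonian `H^m_V` of the system of `m`-point vortices:
`H^m_V(x₁,…,x_m) = ½ Σᵢ R(xᵢ) + Σ_{i<j} G(xᵢ,xⱼ) + (1/8π) Σᵢ log V(xᵢ)`. -/
def Ham (m : ℕ) (G K : E2 → E2 → ℝ) (V : E2 → ℝ) (x : Fin m → E2) : ℝ :=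
  (1 / 2) * ∑ i, K (x i) (x i)
    + ∑ i, ∑ j, (if i < j then G (x i) (x j) else 0)
    + (1 / (8 * π)) * ∑ i, Real.log (V (x i))

/-- The standard bubble `U(x) = log (1/(1+|x|²/8)²)`. -/
def U (x : E2) : ℝ := Real.log (1 / (1 + ‖x‖ ^ 2 / 8) ^ 2)

/-- `Λ` lists the eigenvalues (with multiplicity, in nondecreasing order) of the real
symmetric matrix `M`, as witnessed by an orthonormal eigenbasis. -/
def IsEigList {N : ℕ} (M : Matrix (Fin N) (Fin N) ℝ) (Λ : Fin N → ℝ) : Prop :=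
  Monotone Λ ∧ ∃ b : Fin N → (Fin N → ℝ),
    (∀ i i', (∑ t, b i t * b i' t) = if i = i' then 1 else 0) ∧
    ∀ i, M.mulVec (b i) = Λ i • b i

/-- The standing setting: a family `v_k` of solutions of the Liouville–Gel'fand problem
`-Δv = λ_k V e^v` in `Ω`, `v = 0` on `∂Ω`, blowing up at the `m` interior points
`x*₁, …, x*_m`, with local maximum points `x_{j,k} → x*_j`. -/
structure Setting (m : ℕ) where
  /-- the bounded planar domain -/
  Ω : Set E2
  /-- the positive coefficient `V ∈ C¹(Ω̄)` -/
  V : E2 → ℝ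
  /-- the parameters `λ_k ↓ 0` -/
  lam : ℕ → ℝ
  /-- the blow-up solutions -/
  v : ℕ → E2 → ℝ
  /-- the Dirichlet Green function of `-Δ` on `Ω` -/
  G : E2 → E2 → ℝ
  /-- its regular part; `x ↦ K x x` is the Robin function -/
  K : E2 → E2 → ℝ
  /-- the blow-up points -/
  xstar : Fin m → E2
  /-- the local maximum points `x_{j,k}` -/
  xpt : Fin m → ℕ → E2
  /-- the fixed small radius -/
  R : ℝ
  hm : 0 < m
  hopen : IsOpen Ω
  hbd : IsBounded Ω
  hconn : IsConnected Ω
  hVpos : ∀ x ∈ closure Ω, 0 < V x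
  hVreg : ContDiffOn ℝ 1 V (closure Ω)
  hgreen : IsGreen Ω G K
  hlam_pos : ∀ k, 0 < lam k
  hlam_anti : StrictAnti lam
  hlam0 : Tendsto lam atTop (𝓝 0)
  hv_reg : ∀ k, ContDiffOn ℝ 2 (v k) Ω
  hv_cont : ∀ k, ContinuousOn (v k) (closure Ω)
  hPDE : ∀ k, ∀ x ∈ Ω, -lap (v k) x = lam k * V x * Real.exp (v k x)
  hBC : ∀ k, ∀ x ∈ frontier Ω, v k x = 0
  hblow : Tendsto (fun k => ⨆ x ∈ closure Ω, |v k x|) atTop atTop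
  hmass : Tendsto (fun k => ∫ x in Ω, lam k * V x * Real.exp (v k x)) atTop (𝓝 (8 * π * m))
  hx_mem : ∀ j, xstar j ∈ Ω
  hx_inj : Function.Injective xstar
  hS : {x ∈ closure Ω | ∃ z : ℕ → E2, (∀ k, z k ∈ Ω) ∧ Tendsto z atTop (𝓝 x) ∧
      Tendsto (fun k => v k (z k)) atTop atTop} = Set.range xstar
  hR : 0 < R
  hR2 : ∀ j, closedBall (xstar j) (2 * R) ⊆ Ω
  hRdisj : ∀ i j, i ≠ j → Disjoint (ball (xstar i) R) (ball (xstar j) R)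
  hxpt_lim : ∀ j, Tendsto (fun k => xpt j k) atTop (𝓝 (xstar j))
  hxpt_mem : ∀ j k, xpt j k ∈ ball (xstar j) R
  hxpt_max : ∀ j k, ∀ x ∈ ball (xpt j k) R, v k x ≤ v k (xpt j k)
  hxpt_blow : ∀ j, Tendsto (fun k => v k (xpt j k)) atTop atTop

namespace Setting

variable {m : ℕ}

/-- The scaling parameter `δ_{j,k} > 0`, defined by
`λ_k V(x_{j,k}) e^{v_k(x_{j,k})} δ_{j,k}² = 1`. -/
def delta (S : Setting m) (j : Fin m) (k : ℕ) : ℝ :=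
  (Real.sqrt (S.lam k * S.V (S.xpt j k) * Real.exp (S.v k (S.xpt j k))))⁻¹

/-- The local mass `σ_{j,k} = ∫_{B_R(x_{j,k})} λ_k V e^{v_k}`. -/
def sigmaLoc (S : Setting m) (j : Fin m) (k : ℕ) : ℝ :=
  ∫ x in ball (S.xpt j k) S.R, S.lam k * S.V x * Real.exp (S.v k x)

/-- The entries of the matrix `(h_{ij})`:
`h_{ii} = R(x*_i) + 2 Σ_{h ≠ i} G(x*_h, x*_i) + (1/4π) log V(x*_i)`,
`h_{ij} = -G(x*_i, x*_j)` for `i ≠ j`. -/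
def hEnt (S : Setting m) (i j : Fin m) : ℝ :=
  if i = j then
    S.K (S.xstar i) (S.xstar i)
      + 2 * ∑ h, (if h = i then 0 else S.G (S.xstar h) (S.xstar i))
      + 1 / (4 * π) * Real.log (S.V (S.xstar i))
  else -S.G (S.xstar i) (S.xstar j)

/-- The matrix `(h_{ij})`. -/
def hmat (S : Setting m) : Matrix (Fin m) (Fin m) ℝ := Matrix.of S.hEnt

end Setting

/-- The eigenpairs `(μⁿ_k, wⁿ_k)` of the linearized problem
`-Δw = μ λ_k V e^{v_k} w` in `Ω`, `w = 0` on `∂Ω`, indexed by `n = 1, 2, …`,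
normalized by `‖wⁿ_k‖_∞ = max wⁿ_k = 1`, ordered, and orthogonal in `H¹₀`. -/
structure EigenData {m : ℕ} (S : Setting m) where
  /-- the `n`-th eigenvalue `μⁿ_k` (`n ≥ 1`) -/
  mu : ℕ → ℕ → ℝ
  /-- the `n`-th eigenfunction `wⁿ_k` -/
  w : ℕ → ℕ → E2 → ℝ
  hw_reg : ∀ n k, ContDiffOn ℝ 2 (w n k) S.Ω
  hw_cont : ∀ n k, ContinuousOn (w n k) (closure S.Ω)
  hPDE : ∀ n k, ∀ x ∈ S.Ω,
    -lap (w n k) x = mu n k * S.lam k * S.V x * Real.exp (S.v k x) * w n k x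
  hBC : ∀ n k, ∀ x ∈ frontier S.Ω, w n k x = 0
  hbound : ∀ n k, ∀ x ∈ closure S.Ω, |w n k x| ≤ 1
  hmax : ∀ n k, ∃ x ∈ closure S.Ω, w n k x = 1
  hpos : ∀ k, 0 < mu 1 k
  hlt : ∀ k, mu 1 k < mu 2 k
  hmono : ∀ k n, 2 ≤ n → mu n k ≤ mu (n + 1) k
  hdiv : ∀ k, Tendsto (fun n => mu n k) atTop atTop
  horth : ∀ k n n', 1 ≤ n → 1 ≤ n' → n ≠ n' →
    (∫ x in S.Ω, ⟪gradient (w n k) x, gradient (w n' k) x⟫) = 0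

/-- `c = (c₁,…,c_m) ≠ 0` is the limit vector of the rescaled `n`-th eigenfunctions
`w̃ⁿ_{j,k}(x) = wⁿ_k(δ_{j,k} x + x_{j,k}) → c_j` locally uniformly in `ℝ²`,
along the subsequence `φ`. -/
def IsLimitVec {m : ℕ} (S : Setting m) (W : EigenData S) (φ : ℕ → ℕ) (n : ℕ)
    (c : Fin m → ℝ) : Prop :=
  c ≠ 0 ∧ ∀ j : Fin m,
    TendstoLocallyUniformly
      (fun k (x : E2) => W.w n (φ k) (S.delta j (φ k) • x + S.xpt j (φ k)))
      (fun _ => c j) atTop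

/-- A sequence of (eigen)functions `w_k` concentrates at `κ`: there are `C > 0`
and `κ_k → κ` in `Ω` with `|w_k(κ_k)| ≥ C` for `k ≫ 1`. -/
def ConcentratesAt {m : ℕ} (S : Setting m) (wk : ℕ → E2 → ℝ) (κ : E2) : Prop :=
  ∃ C > 0, ∃ z : ℕ → E2, (∀ k, z k ∈ S.Ω) ∧ Tendsto z atTop (𝓝 κ) ∧
    ∀ᶠ k in atTop, C ≤ |wk k (z k)|

/-- The index `j` of the coordinate pair to which the `i`-th coordinate of
`ℝ^{2m} ≃ (ℝ²)^m` belongs. -/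
def coordIdx {m : ℕ} (i : Fin (2 * m)) : Fin m := ⟨i.1 / 2, by have h := i.isLt; omega⟩

/-- The `i`-th coordinate direction of `(ℝ²)^m ≃ ℝ^{2m}`. -/
def coordBasis (m : ℕ) (i : Fin (2 * m)) : Fin m → E2 :=
  Pi.single (coordIdx i) (EuclideanSpace.single ⟨i.1 % 2, by omega⟩ 1)

/-- The Hessian of the Hamiltonian `H^m_V` at `x0`, as a `2m × 2m` array of second
directional derivatives. -/
def hessHam (m : ℕ) (G K : E2 → E2 → ℝ) (V : E2 → ℝ) (x0 : Fin m → E2)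
    (i j : Fin (2 * m)) : ℝ :=
  fderiv ℝ (fun x => fderiv ℝ (Ham m G K V) x (coordBasis m j)) x0 (coordBasis m i)

namespace LG

/-! ### Part 1: kernels and the logarithmic potential -/

/-- truncated power kernel -/
def pk (p D : ℝ) (z : ℂ) : ℝ := (Set.Iio D).indicator (fun t => t ^ (p - 2)) ‖z‖

lemma pk_nonneg (p D : ℝ) (z : ℂ) : 0 ≤ pk p D z := by
  unfold pk
  exact Set.indicator_apply_nonneg (fun _ => Real.rpow_nonneg (norm_nonneg _) _)

lemma pk_integrable {p : ℝ} (hp : 0 < p) (D : ℝ) : Integrable (pk p D) := by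
  unfold pk
  rw [integrable_fun_norm_addHaar (volume : Measure ℂ)
    (f := (Set.Iio D).indicator (fun t => t ^ (p - 2)))]
  simp only [Complex.finrank_real_complex, Nat.add_one_sub_one, pow_one, smul_eq_mul]
  rcases le_or_gt D 0 with hD | hD
  · refine (integrableOn_zero (μ := volume) (s := Set.Ioi (0:ℝ)) (ε' := ℝ)).congr_fun ?_ measurableSet_Ioi
    intro y hy
    have : ¬ (y < D) := by simp at hy; linarith
    simp [Set.indicator, this]
  · have h1 : IntegrableOn (fun y : ℝ => y ^ (p - 1)) (Set.Ioo 0 D) :=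
      (intervalIntegral.integrableOn_Ioo_rpow_iff hD).2 (by linarith)
    have h2 : IntegrableOn ((Set.Ioo 0 D).indicator (fun y : ℝ => y ^ (p - 1))) (Set.Ioi 0) :=
      ((integrable_indicator_iff measurableSet_Ioo).2 h1).integrableOn
    refine h2.congr_fun ?_ measurableSet_Ioi
    intro y hy
    simp only [Set.mem_Ioi] at hy
    by_cases h : y < D
    · simp only [Set.indicator, Set.mem_Ioo, hy, h, and_self, if_true, Set.mem_Iio]
      rw [show p - 1 = (p - 2) + 1 by ring, Real.rpow_add_one hy.ne']
      ring
    · simp [Set.indicator, h]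

def kerC (p D : ℝ) : ℝ := ∫ z, pk p D z

lemma kerC_nonneg (p D : ℝ) : 0 ≤ kerC p D := integral_nonneg (pk_nonneg p D)

lemma pk_sub_integrable {p : ℝ} (hp : 0 < p) (D : ℝ) (x : ℂ) :
    Integrable (fun y => pk p D (x - y)) := (pk_integrable hp D).comp_sub_left x

lemma pk_sub_integrable' {p : ℝ} (hp : 0 < p) (D : ℝ) (x : ℂ) :
    Integrable (fun y => pk p D (y - x)) := (pk_integrable hp D).comp_sub_right x

lemma pk_sub_integral (p D : ℝ) (x : ℂ) : ∫ y, pk p D (x - y) = kerC p D :=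
  integral_sub_left_eq_self _ _ _

lemma pk_sub_integral' (p D : ℝ) (x : ℂ) : ∫ y, pk p D (y - x) = kerC p D :=
  integral_sub_right_eq_self _ _

lemma pk_eq {p D : ℝ} {z : ℂ} (h : ‖z‖ < D) : pk p D z = ‖z‖ ^ (p - 2) := by
  simp [pk, Set.indicator, h]

lemma pk_one {D : ℝ} {z : ℂ} (h : ‖z‖ < D) : pk 1 D z = ‖z‖⁻¹ := by
  rw [pk_eq h, show (1:ℝ) - 2 = -1 by norm_num, Real.rpow_neg_one]

/-- A single solution, transported to `ℂ`. -/
structure Sol where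
  Ω : Set ℂ
  V : ℂ → ℝ
  v : ℂ → ℝ
  lam : ℝ
  D : ℝ
  hopen : IsOpen Ω
  hbd : IsBounded Ω
  hD1 : 1 ≤ D
  hD : ∀ x ∈ closure Ω, ∀ y ∈ closure Ω, ‖x - y‖ < D
  hVpos : ∀ x ∈ closure Ω, 0 < V x
  hVc : ContinuousOn V (closure Ω)
  hV1 : ContDiffOn ℝ 1 V Ω
  hlam : 0 < lam
  hv2 : ContDiffOn ℝ 2 v Ω
  hvc : ContinuousOn v (closure Ω)
  hPDE : ∀ x ∈ Ω, fderiv ℝ (fderiv ℝ v) x 1 1 + fderiv ℝ (fderiv ℝ v) x Complex.I Complex.I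
    = -(lam * V x * Real.exp (v x))
  hBC : ∀ x ∈ frontier Ω, v x = 0

namespace Sol
variable (S : Sol)

lemma hD0 : 0 < S.D := lt_of_lt_of_le one_pos S.hD1

def f (x : ℂ) : ℝ := S.lam * S.V x * Real.exp (S.v x)

/-- mass density -/
def F : ℂ → ℝ := S.Ω.indicator S.f

lemma f_cont : ContinuousOn S.f (closure S.Ω) :=
  (continuousOn_const.mul S.hVc).mul (Real.continuous_exp.comp_continuousOn S.hvc)

lemma f_pos {x : ℂ} (hx : x ∈ closure S.Ω) : 0 < S.f x :=
  mul_pos (mul_pos S.hlam (S.hVpos x hx)) (Real.exp_pos _)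

lemma F_eq {x : ℂ} (hx : x ∈ S.Ω) : S.F x = S.f x := Set.indicator_of_mem hx _

lemma F_zero {x : ℂ} (hx : x ∉ S.Ω) : S.F x = 0 := Set.indicator_of_notMem hx _

lemma F_nonneg (x : ℂ) : 0 ≤ S.F x :=
  Set.indicator_apply_nonneg (fun h => (S.f_pos (subset_closure h)).le)

lemma isCompact : IsCompact (closure S.Ω) := S.hbd.isCompact_closure

lemma F_bdd : ∃ B, 0 < B ∧ ∀ x, S.F x ≤ B := by
  obtain ⟨C, hC⟩ := S.isCompact.exists_bound_of_continuousOn S.f_cont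
  refine ⟨max C 1, by positivity, fun x => ?_⟩
  by_cases hx : x ∈ S.Ω
  · rw [S.F_eq hx]
    exact (le_abs_self _).trans ((hC x (subset_closure hx)).trans (le_max_left _ _))
  · rw [S.F_zero hx]; positivity

lemma F_meas : Measurable S.F := by
  have : Measurable (S.Ω.indicator S.f) := by
    refine (measurable_of_restrict_of_restrict_compl S.hopen.measurableSet ?_ ?_)
    · have h := (S.f_cont.mono subset_closure).domRestrict.measurable
      convert h using 1
      ext x
      simp
    · have : S.Ωᶜ.domRestrict (S.Ω.indicator S.f) = fun _ => 0 := by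
        ext x
        have := x.2
        simp only [Set.domRestrict_apply]
        exact Set.indicator_of_notMem this _
      rw [this]; exact measurable_const
  exact this

lemma F_int : Integrable S.F := by
  have h : IntegrableOn S.f S.Ω :=
    (S.f_cont.integrableOn_compact S.isCompact).mono_set subset_closure
  exact (integrable_indicator_iff S.hopen.measurableSet).2 h

def M : ℝ := ∫ y, S.F y

lemma M_nonneg : 0 ≤ S.M := integral_nonneg S.F_nonneg

/-- log kernel -/
def ell (z : ℂ) : ℝ := Real.log (S.D / ‖z‖)

lemma ell_meas : Measurable S.ell := by
  unfold ell; fun_prop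

lemma ell_nonneg {z : ℂ} (h : ‖z‖ < S.D) : 0 ≤ S.ell z := by
  unfold ell
  rcases eq_or_ne z 0 with rfl | hz
  · simp
  · apply Real.log_nonneg
    rw [one_le_div (norm_pos_iff.2 hz)]; exact h.le

lemma ell_le {z : ℂ} (h : ‖z‖ < S.D) : S.ell z ≤ S.D * pk 1 S.D z := by
  rw [pk_one h]
  unfold ell
  rw [← div_eq_mul_inv]
  exact Real.log_le_self (div_nonneg S.hD0.le (norm_nonneg _))

/-- The log potential. -/
def N (x : ℂ) : ℝ := (2 * π)⁻¹ * ∫ y, S.ell (x - y) * S.F y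

lemma dist_lt {x y : ℂ} (hx : x ∈ closure S.Ω) (hy : y ∈ S.Ω) : ‖x - y‖ < S.D :=
  S.hD x hx y (subset_closure hy)

lemma ellF_nonneg {x : ℂ} (hx : x ∈ closure S.Ω) (y : ℂ) : 0 ≤ S.ell (x - y) * S.F y := by
  by_cases hy : y ∈ S.Ω
  · exact mul_nonneg (S.ell_nonneg (S.dist_lt hx hy)) (S.F_nonneg y)
  · simp [S.F_zero hy]

lemma ellF_int {x : ℂ} (hx : x ∈ closure S.Ω) : Integrable (fun y => S.ell (x - y) * S.F y) := by
  obtain ⟨B, hB, hFB⟩ := S.F_bdd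
  refine ((pk_sub_integrable one_pos S.D x).const_mul (S.D * B)).mono' ?_ ?_
  · exact ((S.ell_meas.comp (measurable_const.sub measurable_id)).mul S.F_meas).aestronglyMeasurable
  · refine Eventually.of_forall fun y => ?_
    rw [Real.norm_of_nonneg (S.ellF_nonneg hx y)]
    by_cases hy : y ∈ S.Ω
    · have h1 := S.ell_le (S.dist_lt hx hy)
      have h2 := S.ell_nonneg (S.dist_lt hx hy)
      calc S.ell (x - y) * S.F y ≤ (S.D * pk 1 S.D (x - y)) * B :=
            mul_le_mul h1 (hFB y) (S.F_nonneg y) (h2.trans h1)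
        _ = _ := by ring
    · rw [S.F_zero hy, mul_zero]
      exact mul_nonneg (mul_nonneg S.hD0.le hB.le) (pk_nonneg _ _ _)

lemma N_nonneg {x : ℂ} (hx : x ∈ closure S.Ω) : 0 ≤ S.N x :=
  mul_nonneg (by positivity) (integral_nonneg (S.ellF_nonneg hx))

/-- regularized kernel -/
def elle (ε : ℝ) (z : ℂ) : ℝ := 1 / 2 * Real.log (S.D ^ 2 / (‖z‖ ^ 2 + ε ^ 2))

lemma elle_cont {ε : ℝ} (hε : 0 < ε) : Continuous (S.elle ε) := by
  unfold elle
  refine continuous_const.mul (Continuous.log ?_ ?_)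
  · exact continuous_const.div (by fun_prop) (fun z => by positivity)
  · intro z
    have := S.hD0
    positivity

lemma elle_near {ε : ℝ} (hε : 0 < ε) {z : ℂ} (hz : z ≠ 0) :
    |S.ell z - S.elle ε z| ≤ ε * ‖z‖⁻¹ := by
  have hD := S.hD0
  have hz' : 0 < ‖z‖ := norm_pos_iff.2 hz
  have h1 : S.ell z - S.elle ε z = 1 / 2 * Real.log (1 + (ε / ‖z‖) ^ 2) := by
    unfold ell elle
    have : S.D ^ 2 / (‖z‖ ^ 2 + ε ^ 2) = (S.D / ‖z‖) ^ 2 / (1 + (ε / ‖z‖) ^ 2) := by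
      field_simp
    rw [this, Real.log_div (x := (S.D / ‖z‖) ^ 2) (by positivity) (by positivity), Real.log_pow]
    push_cast; ring
  have h0 : 0 ≤ ε / ‖z‖ := by positivity
  have h2 : Real.log (1 + (ε / ‖z‖) ^ 2) ≤ 2 * (ε / ‖z‖) := by
    have : Real.log (1 + (ε / ‖z‖) ^ 2) ≤ Real.log ((1 + ε / ‖z‖) ^ 2) := by
      apply Real.log_le_log (by positivity)
      nlinarith
    rw [Real.log_pow] at this
    have h3 := Real.log_le_sub_one_of_pos (show 0 < 1 + ε / ‖z‖ by positivity)
    push_cast at this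
    linarith
  have h3 : 0 ≤ Real.log (1 + (ε / ‖z‖) ^ 2) := Real.log_nonneg (by nlinarith [sq_nonneg (ε / ‖z‖)])
  rw [h1, abs_of_nonneg (by positivity), ← div_eq_mul_inv]
  linarith

def Ne (ε : ℝ) (x : ℂ) : ℝ := (2 * π)⁻¹ * ∫ y, S.elle ε (x - y) * S.F y

lemma elleF_int {ε : ℝ} (hε : 0 < ε) (x : ℂ) : Integrable (fun y => S.elle ε (x - y) * S.F y) := by
  obtain ⟨r, hr⟩ := S.hbd.subset_closedBall x
  obtain ⟨C, hC⟩ := (isCompact_closedBall (0:ℂ) r).exists_bound_of_continuousOn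
    (S.elle_cont hε).continuousOn
  refine (S.F_int.const_mul C).mono' ?_ ?_
  · exact (((S.elle_cont hε).measurable.comp (measurable_const.sub measurable_id)).mul
      S.F_meas).aestronglyMeasurable
  · refine Eventually.of_forall fun y => ?_
    by_cases hy : y ∈ S.Ω
    · rw [norm_mul, Real.norm_of_nonneg (S.F_nonneg y)]
      refine mul_le_mul_of_nonneg_right (hC _ ?_) (S.F_nonneg y)
      have := hr hy
      rw [mem_closedBall, dist_eq_norm] at this
      simpa [norm_sub_rev] using this
    · simp [S.F_zero hy]

lemma Ne_near : ∃ C, 0 ≤ C ∧ ∀ ε, 0 < ε → ∀ x ∈ closure S.Ω, |S.N x - S.Ne ε x| ≤ C * ε := by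
  obtain ⟨B, hB, hFB⟩ := S.F_bdd
  refine ⟨(2 * π)⁻¹ * (B * kerC 1 S.D), mul_nonneg (by positivity)
    (mul_nonneg hB.le (kerC_nonneg _ _)), fun ε hε x hx => ?_⟩
  unfold N Ne
  rw [← mul_sub, ← integral_sub (S.ellF_int hx) (S.elleF_int hε x), abs_mul,
    abs_of_pos (by positivity : (0:ℝ) < (2 * π)⁻¹), mul_assoc]
  refine mul_le_mul_of_nonneg_left ?_ (by positivity)
  rw [show B * kerC 1 S.D * ε = ∫ y, (ε * B) * pk 1 S.D (x - y) by
    rw [integral_const_mul, pk_sub_integral]; ring]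
  rw [← Real.norm_eq_abs]
  refine norm_integral_le_of_norm_le ((pk_sub_integrable one_pos S.D x).const_mul _) ?_
  have hne : ∀ᵐ y : ℂ, y ≠ x := by
    simp [ae_iff]
  filter_upwards [hne] with y hyx
  by_cases hy : y ∈ S.Ω
  · rw [← sub_mul, norm_mul, Real.norm_of_nonneg (S.F_nonneg y), pk_one (S.dist_lt hx hy)]
    have := S.elle_near hε (sub_ne_zero.2 hyx.symm)
    calc _ ≤ (ε * ‖x - y‖⁻¹) * B := mul_le_mul this (hFB y) (S.F_nonneg y) (by positivity)
      _ = _ := by ring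
  · simp only [S.F_zero hy, mul_zero, sub_zero, norm_zero]
    exact mul_nonneg (mul_nonneg hε.le hB.le) (pk_nonneg _ _ _)

lemma Ne_cont {ε : ℝ} (hε : 0 < ε) : ContinuousOn (S.Ne ε) (closure S.Ω) := by
  obtain ⟨C, hC⟩ := (isCompact_closedBall (0:ℂ) S.D).exists_bound_of_continuousOn
    (S.elle_cont hε).continuousOn
  unfold Ne
  refine continuousOn_const.mul ?_
  refine continuousOn_of_dominated (bound := fun y => C * S.F y) ?_ ?_ (S.F_int.const_mul C) ?_
  · intro x hx; exact (S.elleF_int hε x).aestronglyMeasurable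
  · intro x hx
    refine Eventually.of_forall fun y => ?_
    by_cases hy : y ∈ S.Ω
    · rw [norm_mul, Real.norm_of_nonneg (S.F_nonneg y)]
      refine mul_le_mul_of_nonneg_right (hC _ ?_) (S.F_nonneg y)
      simpa using (S.dist_lt hx hy).le
    · simp [S.F_zero hy]
  · refine Eventually.of_forall fun y => Continuous.continuousOn ?_
    exact ((S.elle_cont hε).comp (continuous_id.sub continuous_const)).mul continuous_const

lemma N_cont : ContinuousOn S.N (closure S.Ω) := by
  obtain ⟨C, hC0, hC⟩ := S.Ne_near
  have hlim : Tendsto (fun n : ℕ => C * (1 / ((n:ℝ) + 1))) atTop (𝓝 0) := by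
    simpa using (tendsto_one_div_add_atTop_nhds_zero_nat (𝕜 := ℝ)).const_mul C
  have : TendstoUniformlyOn (fun (n : ℕ) x => S.Ne (1 / ((n:ℝ) + 1)) x) S.N atTop (closure S.Ω) := by
    rw [Metric.tendstoUniformlyOn_iff]
    intro e he
    filter_upwards [hlim.eventually_lt_const he] with n hn x hx
    rw [Real.dist_eq]
    exact (hC _ (by positivity) x hx).trans_lt hn
  exact this.continuousOn (Frequently.of_forall fun n => S.Ne_cont (by positivity))

end Sol
end LG

namespace LG

/-! ### Part 2: polar coordinates and the mean value formula -/

lemma polar_symm_eq (c : ℂ) (p : ℝ × ℝ) :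
    c + Complex.polarCoord.symm p = circleMap c p.1 p.2 := by
  rw [Complex.polarCoord_symm_apply, circleMap, Complex.exp_mul_I]
  push_cast
  ring

lemma polar_integrable {g : ℂ → ℝ} (hm : Measurable g) (hg : Integrable g) (c : ℂ) :
    IntegrableOn (fun p : ℝ × ℝ => p.1 * g (circleMap c p.1 p.2))
      (Set.Ioi (0 : ℝ) ×ˢ Set.Ioo (-π) π) := by
  have hmeas : Measurable (fun p : ℝ × ℝ => p.1 * g (circleMap c p.1 p.2)) := by
    refine measurable_fst.mul (hm.comp ?_)
    unfold circleMap
    fun_prop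
  refine ⟨hmeas.aestronglyMeasurable, ?_⟩
  have hg' : Integrable (fun z => g (c + z)) := hg.comp_add_left c
  have h1 := hg'.2
  unfold HasFiniteIntegral at h1 ⊢
  rw [← Complex.lintegral_comp_polarCoord_symm] at h1
  refine lt_of_le_of_lt (le_of_eq ?_) h1
  refine setLIntegral_congr_fun (measurableSet_Ioi.prod measurableSet_Ioo) fun p hp => ?_
  simp only
  rw [polar_symm_eq, enorm_mul, smul_eq_mul]
  congr 1
  rw [Real.enorm_eq_ofReal_abs, abs_of_pos hp.1]

lemma circle_shift (g : ℂ → ℝ) (c : ℂ) (t : ℝ) :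
    ∫ θ in Set.Ioo (-π) π, g (circleMap c t θ) = 2 * π * circleAverage g c t := by
  rw [circleAverage_eq_integral_add (-π), smul_eq_mul,
    intervalIntegral.integral_comp_add_right (fun θ => g (circleMap c t θ)),
    ← mul_assoc, mul_inv_cancel₀ (by positivity), one_mul,
    show (0:ℝ) + -π = -π by ring, show 2 * π + -π = π by ring,
    intervalIntegral.integral_of_le (by linarith [Real.pi_pos]), integral_Ioc_eq_integral_Ioo]

lemma polar_integral {g : ℂ → ℝ} (hm : Measurable g) (hg : Integrable g) (c : ℂ) :
    ∫ y, g y = ∫ t in Set.Ioi (0:ℝ), t * (2 * π * circleAverage g c t) := by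
  have h0 : ∫ y, g y = ∫ y, g (c + y) := (integral_add_left_eq_self g c).symm
  rw [h0, ← Complex.integral_comp_polarCoord_symm]
  have h1 : ∫ p in polarCoord.target, p.1 • g (c + Complex.polarCoord.symm p)
      = ∫ p in Set.Ioi (0 : ℝ) ×ˢ Set.Ioo (-π) π, p.1 * g (circleMap c p.1 p.2) := by
    refine setIntegral_congr_fun (measurableSet_Ioi.prod measurableSet_Ioo) fun p hp => ?_
    rw [polar_symm_eq, smul_eq_mul]
  rw [h1]
  have h2 := setIntegral_prod (μ := (volume : Measure ℝ)) (ν := (volume : Measure ℝ)) _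
    (polar_integrable hm hg c)
  rw [← Measure.volume_eq_prod] at h2
  rw [h2]
  refine setIntegral_congr_fun measurableSet_Ioi fun t ht => ?_
  simp only
  rw [integral_const_mul, circle_shift]

/-- radial mean-value integrals -/
lemma polar_ball {g : ℂ → ℝ} (c : ℂ) {r : ℝ} (hr : 0 < r) (w : ℝ → ℝ)
    (hm : Measurable ((ball c r).indicator (fun y => w ‖y - c‖ * g y)))
    (hi : Integrable ((ball c r).indicator (fun y => w ‖y - c‖ * g y))) :
    ∫ y in ball c r, w ‖y - c‖ * g y = ∫ t in (0:ℝ)..r, t * (2 * π * (w t * circleAverage g c t)) := by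
  rw [← integral_indicator measurableSet_ball, polar_integral hm hi c]
  rw [intervalIntegral.integral_of_le hr.le, integral_Ioc_eq_integral_Ioo]
  have : ∀ t ∈ Set.Ioi (0:ℝ), t * (2 * π * circleAverage ((ball c r).indicator
      (fun y => w ‖y - c‖ * g y)) c t)
      = (Set.Ioo 0 r).indicator (fun t => t * (2 * π * (w t * circleAverage g c t))) t := by
    intro t ht
    have ht' : 0 < t := ht
    by_cases htr : t < r
    · rw [Set.indicator_of_mem (show t ∈ Set.Ioo 0 r from ⟨ht, htr⟩)]
      congr 2
      rw [← smul_eq_mul (w t), ← circleAverage_fun_smul]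
      apply circleAverage_congr_sphere
      intro z hz
      rw [abs_of_pos ht', mem_sphere, dist_eq_norm] at hz
      have : z ∈ ball c r := by rw [mem_ball, dist_eq_norm, hz]; exact htr
      simp only
      rw [Set.indicator_of_mem this, hz, smul_eq_mul]
    · rw [Set.indicator_of_notMem (fun h => htr h.2)]
      have : circleAverage ((ball c r).indicator (fun y => w ‖y - c‖ * g y)) c t
          = circleAverage (fun _ => (0:ℝ)) c t := by
        apply circleAverage_congr_sphere
        intro z hz
        rw [abs_of_pos ht', mem_sphere, dist_eq_norm] at hz
        have : z ∉ ball c r := by rw [mem_ball, dist_eq_norm, hz]; exact htr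
        exact Set.indicator_of_notMem this _
      rw [this, circleAverage_const]; ring
  rw [setIntegral_congr_fun measurableSet_Ioi this, setIntegral_indicator measurableSet_Ioo]
  congr 2
  ext t; simp

lemma log_div_int {r : ℝ} (hr : 0 < r) : IntervalIntegrable (fun t => Real.log (r / t)) volume 0 r := by
  have h : IntervalIntegrable (fun t => Real.log r - Real.log t) volume 0 r :=
    intervalIntegrable_const.sub intervalIntegral.intervalIntegrable_log'
  refine h.congr fun t ht => ?_
  rw [Set.uIoc_of_le hr.le] at ht
  exact (Real.log_div hr.ne' ht.1.ne').symm

lemma mul_log_cont {r : ℝ} (hr : 0 < r) : ContinuousOn (fun t => Real.log (r / t) * t) (Set.Icc 0 r) := by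
  have h : Continuous (fun t => Real.log r * t - t * Real.log t) :=
    (continuous_const.mul continuous_id).sub Real.continuous_mul_log
  refine h.continuousOn.congr fun t ht => ?_
  rcases eq_or_lt_of_le ht.1 with h0 | h0
  · simp [← h0]
  · simp only
    rw [Real.log_div hr.ne' h0.ne']; ring

lemma trace_rot (B : ℂ →L[ℝ] ℂ →L[ℝ] ℝ) (θ : ℝ) :
    B (circleMap 0 1 θ) (circleMap 0 1 θ) + B (circleMap 0 1 θ * Complex.I) (circleMap 0 1 θ * Complex.I)
      = B 1 1 + B Complex.I Complex.I := by
  have h1 : circleMap 0 1 θ = Real.cos θ • (1:ℂ) + Real.sin θ • Complex.I := by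
    simp [circleMap, Complex.exp_mul_I]
  have h2 : circleMap 0 1 θ * Complex.I = (-Real.sin θ) • (1:ℂ) + Real.cos θ • Complex.I := by
    rw [h1]
    simp only [Complex.real_smul, mul_one, add_mul, mul_assoc, Complex.I_mul_I]
    push_cast; ring
  rw [h2, h1]
  simp only [map_add, map_smul, add_apply, smul_apply,
    smul_eq_mul]
  linear_combination (B 1 1 + B Complex.I Complex.I) * (Real.sin_sq_add_cos_sq θ)

section mv
variable {Ω : Set ℂ} {v : ℂ → ℝ}

lemma v_diff (hΩ : IsOpen Ω) (hv : ContDiffOn ℝ 2 v Ω) {x : ℂ} (hx : x ∈ Ω) : HasFDerivAt v (fderiv ℝ v x) x :=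
  ((hv.contDiffAt (hΩ.mem_nhds hx)).differentiableAt (by norm_num)).hasFDerivAt

lemma v_diff2 (hΩ : IsOpen Ω) (hv : ContDiffOn ℝ 2 v Ω) {x : ℂ} (hx : x ∈ Ω) : HasFDerivAt (fderiv ℝ v) (fderiv ℝ (fderiv ℝ v) x) x :=
  (((hv.contDiffAt (hΩ.mem_nhds hx)).fderiv_right (m := 1) (by norm_num)).differentiableAt
    (by norm_num)).hasFDerivAt

lemma dv_cont (hΩ : IsOpen Ω) (hv : ContDiffOn ℝ 2 v Ω) : ContinuousOn (fderiv ℝ v) Ω := hv.continuousOn_fderiv_of_isOpen hΩ (by norm_num)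

lemma ddv_cont (hΩ : IsOpen Ω) (hv : ContDiffOn ℝ 2 v Ω) : ContinuousOn (fderiv ℝ (fderiv ℝ v)) Ω :=
  (hv.fderiv_of_isOpen hΩ (m := 1) (by norm_num)).continuousOn_fderiv_of_isOpen hΩ (by norm_num)

lemma circ_mem {c : ℂ} {r : ℝ} (hb : closedBall c r ⊆ Ω) {t θ : ℝ} (ht : t ∈ Set.Icc 0 r) :
    circleMap c t θ ∈ Ω := by
  apply hb
  rw [mem_closedBall, dist_eq_norm, circleMap_sub_center, norm_circleMap_zero, abs_of_nonneg ht.1]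
  exact ht.2

lemma radial_ftc (hΩ : IsOpen Ω) (hv : ContDiffOn ℝ 2 v Ω) {c : ℂ} {r : ℝ} (hr : 0 < r) (hb : closedBall c r ⊆ Ω) (θ : ℝ) :
    v (circleMap c r θ) - v c = ∫ t in (0:ℝ)..r, Real.log (r / t) *
      (fderiv ℝ v (circleMap c t θ) (circleMap 0 1 θ)
        + t * fderiv ℝ (fderiv ℝ v) (circleMap c t θ) (circleMap 0 1 θ) (circleMap 0 1 θ)) := by
  set e := circleMap 0 1 θ with he
  have hcm : ∀ t : ℝ, circleMap c t θ = c + t • e := by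
    intro t; rw [he]; simp [circleMap]
  have hline : ∀ t : ℝ, HasDerivAt (fun t : ℝ => circleMap c t θ) e t := by
    intro t
    have : HasDerivAt (fun t : ℝ => c + t • e) ((1:ℝ) • e) t :=
      ((hasDerivAt_id t).smul_const e).const_add c
    simpa only [hcm, one_smul] using this
  have hlc : Continuous (fun t : ℝ => circleMap c t θ) :=
    continuous_iff_continuousAt.2 fun t => (hline t).continuousAt
  have hmaps : Set.MapsTo (fun t : ℝ => circleMap c t θ) (Set.Icc 0 r) Ω := fun t ht =>
    circ_mem hb ht
  have hu : ∀ t ∈ Set.Icc 0 r, HasDerivAt (fun t : ℝ => v (circleMap c t θ))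
      (fderiv ℝ v (circleMap c t θ) e) t := fun t ht =>
    (v_diff hΩ hv (hmaps ht)).comp_hasDerivAt t (hline t)
  have hu2 : ∀ t ∈ Set.Icc 0 r, HasDerivAt (fun t : ℝ => fderiv ℝ v (circleMap c t θ) e)
      (fderiv ℝ (fderiv ℝ v) (circleMap c t θ) e e) t := fun t ht => by
    have h1 := (v_diff2 hΩ hv (hmaps ht)).comp_hasDerivAt t (hline t)
    have h2 := h1.clm_apply (hasDerivAt_const t e)
    simpa using h2
  have hc1 : ContinuousOn (fun t : ℝ => fderiv ℝ v (circleMap c t θ) e) (Set.Icc 0 r) :=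
    ((dv_cont hΩ hv).comp hlc.continuousOn hmaps).clm_apply continuousOn_const
  have hc2 : ContinuousOn (fun t : ℝ => fderiv ℝ (fderiv ℝ v) (circleMap c t θ) e e) (Set.Icc 0 r) :=
    (((ddv_cont hΩ hv).comp hlc.continuousOn hmaps).clm_apply continuousOn_const).clm_apply
      continuousOn_const
  have key := intervalIntegral.integral_eq_sub_of_hasDerivAt_of_le
    (f := fun t => Real.log (r / t) * t * fderiv ℝ v (circleMap c t θ) e + v (circleMap c t θ))
    (f' := fun t => Real.log (r / t) *
      (fderiv ℝ v (circleMap c t θ) e + t * fderiv ℝ (fderiv ℝ v) (circleMap c t θ) e e))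
    hr.le ?_ ?_ ?_
  · rw [key]
    simp [circleMap_zero_radius, hr.ne']
  · exact ((mul_log_cont hr).mul hc1).add
      (hv.continuousOn.comp hlc.continuousOn hmaps)
  · intro t ht
    have ht' := Set.Ioo_subset_Icc_self ht
    have hl : HasDerivAt (fun t => Real.log (r / t) * t) (Real.log (r / t) - 1) t := by
      have h1 : HasDerivAt (fun t => (Real.log r - Real.log t) * t) (-t⁻¹ * t + (Real.log r - Real.log t) * 1) t :=
        ((Real.hasDerivAt_log ht.1.ne').const_sub (Real.log r)).mul (hasDerivAt_id t)
      have h2 : (fun t => (Real.log r - Real.log t) * t) =ᶠ[𝓝 t] (fun t => Real.log (r / t) * t) := by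
        filter_upwards [lt_mem_nhds ht.1] with s hs
        rw [Real.log_div hr.ne' (ne_of_gt hs)]
      refine (h1.congr_of_eventuallyEq h2.symm).congr_deriv ?_
      rw [Real.log_div hr.ne' ht.1.ne', neg_mul, inv_mul_cancel₀ ht.1.ne']; ring
    have := (hl.mul (hu2 t ht')).add (hu t ht')
    refine this.congr_deriv ?_
    ring
  · refine (log_div_int hr).mul_continuousOn ?_
    rw [Set.uIcc_of_le hr.le]
    exact hc1.add (continuousOn_id.mul hc2)

lemma ang_int (hΩ : IsOpen Ω) (hv : ContDiffOn ℝ 2 v Ω) {c : ℂ} {r : ℝ} (hb : closedBall c r ⊆ Ω) {t : ℝ} (ht : t ∈ Set.Icc 0 r) :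
    ∫ θ in (0:ℝ)..2 * π, (fderiv ℝ v (circleMap c t θ) (circleMap 0 1 θ)
        + t * fderiv ℝ (fderiv ℝ v) (circleMap c t θ) (circleMap 0 1 θ) (circleMap 0 1 θ))
      = ∫ θ in (0:ℝ)..2 * π, t * (fderiv ℝ (fderiv ℝ v) (circleMap c t θ) 1 1
        + fderiv ℝ (fderiv ℝ v) (circleMap c t θ) Complex.I Complex.I) := by
  have hmem : ∀ θ, circleMap c t θ ∈ Ω := fun θ => circ_mem hb ht
  have hcm : Continuous (fun θ => circleMap c t θ) := continuous_circleMap c t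
  have he : Continuous (fun θ => circleMap 0 1 θ) := continuous_circleMap 0 1
  have hc1 : Continuous (fun θ => fderiv ℝ v (circleMap c t θ)) :=
    (dv_cont hΩ hv).comp_continuous hcm hmem
  have hc2 : Continuous (fun θ => fderiv ℝ (fderiv ℝ v) (circleMap c t θ)) :=
    (ddv_cont hΩ hv).comp_continuous hcm hmem
  have hder : ∀ θ, HasDerivAt (fun θ => fderiv ℝ v (circleMap c t θ) (circleMap 0 1 θ * Complex.I))
      (t * fderiv ℝ (fderiv ℝ v) (circleMap c t θ) (circleMap 0 1 θ * Complex.I)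
        (circleMap 0 1 θ * Complex.I) - fderiv ℝ v (circleMap c t θ) (circleMap 0 1 θ)) θ := by
    intro θ
    have h1 := (v_diff2 hΩ hv (hmem θ)).comp_hasDerivAt θ (hasDerivAt_circleMap c t θ)
    have h2 := (hasDerivAt_circleMap 0 1 θ).mul_const Complex.I
    have h3 := h1.clm_apply h2
    refine h3.congr_deriv ?_
    have e1 : circleMap 0 t θ * Complex.I = t • (circleMap 0 1 θ * Complex.I) := by
      simp [circleMap]; ring
    have e2 : circleMap 0 1 θ * Complex.I * Complex.I = -circleMap 0 1 θ := by
      rw [mul_assoc, Complex.I_mul_I]; ring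
    rw [e1, e2, map_smul, map_neg, smul_apply, smul_eq_mul]
    simp only [Function.comp_apply]
    ring
  have hintg := intervalIntegral.integral_eq_sub_of_hasDerivAt (a := 0) (b := 2 * π)
    (fun θ _ => hder θ) (Continuous.intervalIntegrable (by fun_prop) _ _)
  have hper : circleMap c t (2 * π) = circleMap c t 0 := by simpa using periodic_circleMap c t 0
  have hper2 : circleMap 0 1 (2 * π) = circleMap 0 1 0 := by simpa using periodic_circleMap 0 1 0
  rw [hper, hper2, sub_self] at hintg
  have hsum := intervalIntegral.integral_add (μ := volume) (a := 0) (b := 2 * π)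
    (f := fun θ => fderiv ℝ v (circleMap c t θ) (circleMap 0 1 θ)
        + t * fderiv ℝ (fderiv ℝ v) (circleMap c t θ) (circleMap 0 1 θ) (circleMap 0 1 θ))
    (g := fun θ => t * fderiv ℝ (fderiv ℝ v) (circleMap c t θ) (circleMap 0 1 θ * Complex.I)
        (circleMap 0 1 θ * Complex.I) - fderiv ℝ v (circleMap c t θ) (circleMap 0 1 θ))
    (Continuous.intervalIntegrable (by fun_prop) _ _)
    (Continuous.intervalIntegrable (by fun_prop) _ _)
  rw [hintg, add_zero] at hsum
  rw [← hsum]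
  refine intervalIntegral.integral_congr fun θ _ => ?_
  rw [← trace_rot _ θ]
  ring

lemma mean_value (hΩ : IsOpen Ω) (hv : ContDiffOn ℝ 2 v Ω) {c : ℂ} {r : ℝ} (hr : 0 < r) (hb : closedBall c r ⊆ Ω) :
    circleAverage v c r - v c = ∫ t in (0:ℝ)..r, t * (Real.log (r / t) *
      circleAverage (fun x => fderiv ℝ (fderiv ℝ v) x 1 1
        + fderiv ℝ (fderiv ℝ v) x Complex.I Complex.I) c t) := by
  set g : ℝ → ℝ → ℝ := fun t θ => fderiv ℝ v (circleMap c t θ) (circleMap 0 1 θ)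
        + t * fderiv ℝ (fderiv ℝ v) (circleMap c t θ) (circleMap 0 1 θ) (circleMap 0 1 θ) with hg
  have hcm : Continuous (fun p : ℝ × ℝ => circleMap c p.1 p.2) := by
    unfold circleMap; fun_prop
  have he : Continuous (fun p : ℝ × ℝ => circleMap 0 1 p.2) := by
    unfold circleMap; fun_prop
  have hpi : (0:ℝ) ≤ 2 * π := by positivity
  have hmaps : Set.MapsTo (fun p : ℝ × ℝ => circleMap c p.1 p.2)
      (Set.Icc 0 r ×ˢ Set.Icc 0 (2 * π)) Ω := fun p hp => circ_mem hb hp.1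
  have hgc : ContinuousOn (fun p : ℝ × ℝ => g p.1 p.2) (Set.Icc 0 r ×ˢ Set.Icc 0 (2 * π)) := by
    have h1 := (dv_cont hΩ hv).comp hcm.continuousOn hmaps
    have h2 := (ddv_cont hΩ hv).comp hcm.continuousOn hmaps
    exact (h1.clm_apply he.continuousOn).add
      (continuousOn_fst.mul ((h2.clm_apply he.continuousOn).clm_apply he.continuousOn))
  obtain ⟨C, hC⟩ := (isCompact_Icc.prod isCompact_Icc).exists_bound_of_continuousOn hgc
  have hintg : Integrable (fun p : ℝ × ℝ => Real.log (r / p.1) * g p.1 p.2)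
      ((volume.restrict (Set.Ioc 0 r)).prod (volume.restrict (Set.Ioc 0 (2 * π)))) := by
    have hb1 : Integrable (fun p : ℝ × ℝ => Real.log (r / p.1) * C)
        ((volume.restrict (Set.Ioc 0 r)).prod (volume.restrict (Set.Ioc 0 (2 * π)))) := by
      have h1 : Integrable (fun t => Real.log (r / t)) (volume.restrict (Set.Ioc 0 r)) :=
        (log_div_int hr).1
      exact h1.mul_prod (integrable_const C)
    refine hb1.mono ?_ ?_
    · refine AEStronglyMeasurable.mul ?_ ?_
      · exact (by fun_prop : Measurable fun p : ℝ × ℝ => Real.log (r / p.1)).aestronglyMeasurable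
      · rw [Measure.prod_restrict]
        exact (hgc.mono (Set.prod_mono Set.Ioc_subset_Icc_self Set.Ioc_subset_Icc_self)).aestronglyMeasurable
          (measurableSet_Ioc.prod measurableSet_Ioc)
    · rw [Measure.prod_restrict]
      filter_upwards [ae_restrict_mem (measurableSet_Ioc.prod measurableSet_Ioc)] with p hp
      rw [norm_mul, norm_mul]
      refine mul_le_mul_of_nonneg_left ?_ (norm_nonneg _)
      exact (hC p ⟨Set.Ioc_subset_Icc_self hp.1, Set.Ioc_subset_Icc_self hp.2⟩).trans (le_abs_self _)
  have hci : IntervalIntegrable (fun θ => v (circleMap c r θ)) volume 0 (2 * π) := by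
    refine Continuous.intervalIntegrable ?_ _ _
    exact hv.continuousOn.comp_continuous (continuous_circleMap c r)
      (fun θ => circ_mem hb ⟨hr.le, le_rfl⟩)
  have h1 : circleAverage v c r - v c = (2 * π)⁻¹ * ∫ θ in (0:ℝ)..2 * π, (v (circleMap c r θ) - v c) := by
    rw [intervalIntegral.integral_sub hci intervalIntegrable_const, circleAverage_def, smul_eq_mul,
      intervalIntegral.integral_const, smul_eq_mul, sub_zero, mul_sub, ← mul_assoc ((2 * π)⁻¹) (2 * π),
      inv_mul_cancel₀ (by positivity), one_mul]
  rw [h1]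
  simp_rw [radial_ftc hΩ hv hr hb]
  have hswap : ∫ θ in (0:ℝ)..2 * π, ∫ t in (0:ℝ)..r, Real.log (r / t) * g t θ
      = ∫ t in (0:ℝ)..r, ∫ θ in (0:ℝ)..2 * π, Real.log (r / t) * g t θ := by
    simp only [intervalIntegral.integral_of_le hr.le, intervalIntegral.integral_of_le hpi]
    exact (integral_integral_swap (f := fun t θ => Real.log (r / t) * g t θ) hintg).symm
  rw [hswap, ← intervalIntegral.integral_const_mul]
  refine intervalIntegral.integral_congr fun t ht => ?_
  rw [Set.uIcc_of_le hr.le] at ht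
  rw [intervalIntegral.integral_const_mul, ang_int hΩ hv hb ht, intervalIntegral.integral_const_mul,
    circleAverage_def, smul_eq_mul]
  ring

end mv
end LG

namespace LG

/-! ### Part 3: mean value identities and comparison -/

lemma min_principle {Ω : Set ℂ} (hopen : IsOpen Ω) (hbd : IsBounded Ω) {w : ℂ → ℝ}
    (hw : ContinuousOn w (closure Ω)) (hfr : ∀ x ∈ frontier Ω, 0 ≤ w x)
    (hmv : ∀ c ∈ Ω, ∀ r, 0 < r → closedBall c r ⊆ Ω → circleAverage w c r ≤ w c) :
    ∀ x ∈ closure Ω, 0 ≤ w x := by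
  intro x hx
  have hK : IsCompact (closure Ω) := hbd.isCompact_closure
  obtain ⟨x1, hx1, hmin⟩ := hK.exists_isMinOn ⟨x, hx⟩ hw
  have hK2 : IsCompact (closure Ω ∩ w ⁻¹' Set.Iic (w x1)) :=
    hK.of_isClosed_subset (hw.preimage_isClosed_of_isClosed isClosed_closure isClosed_Iic)
      Set.inter_subset_left
  obtain ⟨x0, hx0, hmax⟩ := hK2.exists_isMaxOn ⟨x1, hx1, le_refl (w x1)⟩
    (Complex.continuous_re.continuousOn)
  have hx0w : w x0 = w x1 := le_antisymm hx0.2 (hmin hx0.1)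
  have hle : ∀ y ∈ closure Ω, w x0 ≤ w y := fun y hy => by rw [hx0w]; exact hmin hy
  suffices h : 0 ≤ w x0 from h.trans (hle x hx)
  by_contra hneg
  push Not at hneg
  have hx0Ω : x0 ∈ Ω := by
    by_contra hn
    have : x0 ∈ frontier Ω := by
      rw [hopen.frontier_eq]; exact ⟨hx0.1, hn⟩
    linarith [hfr x0 this]
  obtain ⟨r, hr, hrb⟩ := (nhds_basis_closedBall.mem_iff).1 (hopen.mem_nhds hx0Ω)
  have hmem : ∀ θ, circleMap x0 r θ ∈ Ω := fun θ => hrb (circleMap_mem_closedBall _ hr.le _)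
  have hcont : Continuous (fun θ => w (circleMap x0 r θ)) :=
    hw.comp_continuous (continuous_circleMap x0 r) fun θ => subset_closure (hmem θ)
  have hlt : ∫ θ in (0:ℝ)..2 * π, w x0 < ∫ θ in (0:ℝ)..2 * π, w (circleMap x0 r θ) := by
    refine intervalIntegral.integral_lt_integral_of_continuousOn_of_le_of_exists_lt
      (by positivity) continuousOn_const hcont.continuousOn
      (fun θ _ => hle _ (subset_closure (hmem θ))) ⟨0, ⟨le_rfl, by positivity⟩, ?_⟩
    by_contra hcon
    push Not at hcon
    have h2 := hmax (show circleMap x0 r 0 ∈ closure Ω ∩ w ⁻¹' Set.Iic (w x1) from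
      ⟨subset_closure (hmem 0), by
        rw [Set.mem_preimage, Set.mem_Iic, ← hx0w]; exact hcon⟩)
    simp [circleMap] at h2
    linarith
  have h3 := hmv x0 hx0Ω r hr hrb
  rw [circleAverage_def, smul_eq_mul] at h3
  rw [intervalIntegral.integral_const, smul_eq_mul, sub_zero] at hlt
  have hpi : (0:ℝ) < 2 * π := by positivity
  rw [inv_mul_le_iff₀ hpi] at h3
  linarith

namespace Sol
variable (S : Sol)

/-- local log potential -/
def Lp (c : ℂ) (r : ℝ) : ℝ := (2 * π)⁻¹ * ∫ y in ball c r, Real.log (r / ‖y - c‖) * S.F y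

lemma log_ball_nonneg {c y : ℂ} {r : ℝ} (hy : y ∈ ball c r) : 0 ≤ Real.log (r / ‖y - c‖) := by
  rw [mem_ball, dist_eq_norm] at hy
  rcases eq_or_ne (‖y - c‖) 0 with h | h
  · simp [h]
  · apply Real.log_nonneg
    rw [one_le_div (lt_of_le_of_ne (norm_nonneg _) h.symm)]; exact hy.le

lemma logF_meas (c : ℂ) (r : ℝ) :
    Measurable ((ball c r).indicator (fun y => Real.log (r / ‖y - c‖) * S.F y)) := by
  refine Measurable.indicator ?_ measurableSet_ball
  exact (by fun_prop : Measurable fun y : ℂ => Real.log (r / ‖y - c‖)).mul S.F_meas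

lemma logF_int (c : ℂ) {r : ℝ} (hr : 0 < r) :
    Integrable ((ball c r).indicator (fun y => Real.log (r / ‖y - c‖) * S.F y)) := by
  obtain ⟨B, hB, hFB⟩ := S.F_bdd
  refine ((pk_sub_integrable' one_pos r c).const_mul (r * B)).mono'
    (S.logF_meas c r).aestronglyMeasurable (Eventually.of_forall fun y => ?_)
  by_cases hy : y ∈ ball c r
  · rw [Set.indicator_of_mem hy, Real.norm_of_nonneg (mul_nonneg (log_ball_nonneg hy) (S.F_nonneg y))]
    have hy' := hy
    rw [mem_ball, dist_eq_norm] at hy'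
    rw [pk_one hy']
    have h1 : Real.log (r / ‖y - c‖) ≤ r / ‖y - c‖ :=
      Real.log_le_self (div_nonneg hr.le (norm_nonneg _))
    calc _ ≤ r / ‖y - c‖ * B := mul_le_mul h1 (hFB y) (S.F_nonneg y)
          (div_nonneg hr.le (norm_nonneg _))
      _ = _ := by rw [div_eq_mul_inv]; ring
  · rw [Set.indicator_of_notMem hy, norm_zero]
    exact mul_nonneg (mul_nonneg hr.le hB.le) (pk_nonneg _ _ _)

lemma Lp_nonneg (c : ℂ) (r : ℝ) : 0 ≤ S.Lp c r :=
  mul_nonneg (by positivity) (setIntegral_nonneg measurableSet_ball fun y hy =>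
    mul_nonneg (log_ball_nonneg hy) (S.F_nonneg y))

lemma v_mean {c : ℂ} {r : ℝ} (hr : 0 < r) (hb : closedBall c r ⊆ S.Ω) :
    S.v c - circleAverage S.v c r = S.Lp c r := by
  have h1 := mean_value S.hopen S.hv2 hr hb
  have h2 := polar_ball (g := S.F) c hr (fun t => Real.log (r / t)) (S.logF_meas c r) (S.logF_int c hr)
  unfold Lp
  rw [h2, ← intervalIntegral.integral_const_mul]
  rw [← neg_sub, h1, ← intervalIntegral.integral_neg]
  refine intervalIntegral.integral_congr fun t ht => ?_
  rw [Set.uIcc_of_le hr.le] at ht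
  have h3 : circleAverage (fun x => fderiv ℝ (fderiv ℝ S.v) x 1 1
        + fderiv ℝ (fderiv ℝ S.v) x Complex.I Complex.I) c t = -circleAverage S.F c t := by
    have h4 : -circleAverage S.F c t = circleAverage (fun z => (-1:ℝ) • S.F z) c t := by
      rw [circleAverage_fun_smul]; simp
    rw [h4]
    apply circleAverage_congr_sphere
    intro z hz
    rw [abs_of_nonneg ht.1, mem_sphere] at hz
    have hz' : z ∈ S.Ω := hb (by rw [mem_closedBall, hz]; exact ht.2)
    simp only [smul_eq_mul]
    rw [S.hPDE z hz', S.F_eq hz', neg_one_mul]; rfl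
  rw [h3]
  field_simp

lemma circle_int {w : ℂ → ℝ} (hw : ContinuousOn w (closure S.Ω)) {c : ℂ} {r : ℝ} (hr : 0 < r)
    (hb : closedBall c r ⊆ S.Ω) : CircleIntegrable w c r := by
  refine ContinuousOn.circleIntegrable hr.le (hw.mono ?_)
  exact (sphere_subset_closedBall.trans hb).trans subset_closure

lemma N_mean {c : ℂ} {r : ℝ} (hr : 0 < r) (hb : closedBall c r ⊆ S.Ω) :
    S.N c - circleAverage S.N c r = S.Lp c r := by
  have hc : c ∈ S.Ω := hb (mem_closedBall_self hr.le)
  have hpi : (0:ℝ) ≤ 2 * π := by positivity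
  have hmem : ∀ θ, circleMap c r θ ∈ closure S.Ω := fun θ =>
    subset_closure (hb (circleMap_mem_closedBall _ hr.le _))
  have hNc : Continuous (fun θ => S.N (circleMap c r θ)) :=
    S.N_cont.comp_continuous (continuous_circleMap c r) hmem
  have hmeas : Measurable (fun p : ℝ × ℂ => S.ell (circleMap c r p.1 - p.2) * S.F p.2) := by
    refine (S.ell_meas.comp ?_).mul (S.F_meas.comp measurable_snd)
    exact ((continuous_circleMap c r).measurable.comp measurable_fst).sub measurable_snd
  have hintg : Integrable (fun p : ℝ × ℂ => S.ell (circleMap c r p.1 - p.2) * S.F p.2)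
      ((volume.restrict (Set.Ioc 0 (2 * π))).prod volume) := by
    have hi1 : ∀ θ : ℝ, Integrable (fun y : ℂ => S.ell (circleMap c r θ - y) * S.F y) :=
      fun θ => S.ellF_int (hmem θ)
    rw [integrable_prod_iff hmeas.aestronglyMeasurable]
    refine ⟨Eventually.of_forall hi1, ?_⟩
    have : (fun θ : ℝ => ∫ y, ‖S.ell (circleMap c r θ - y) * S.F y‖)
        = fun θ => 2 * π * S.N (circleMap c r θ) := by
      ext θ
      simp_rw [Real.norm_of_nonneg (S.ellF_nonneg (hmem θ) _)]
      unfold N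
      rw [← mul_assoc, mul_inv_cancel₀ (by positivity), one_mul]
    simp only [this]
    exact ((continuous_const.mul hNc).integrableOn_Icc).mono_set Set.Ioc_subset_Icc_self
  have hswap : circleAverage S.N c r = (2 * π)⁻¹ * ∫ y, circleAverage (fun x => S.ell (x - y)) c r * S.F y := by
    rw [circleAverage_def, smul_eq_mul]
    unfold N
    rw [intervalIntegral.integral_const_mul, intervalIntegral.integral_of_le hpi]
    rw [integral_integral_swap (f := fun θ y => S.ell (circleMap c r θ - y) * S.F y) hintg]
    congr 1
    rw [← integral_const_mul]
    congr 1
    ext y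
    rw [circleAverage_def, smul_eq_mul, integral_mul_const, intervalIntegral.integral_of_le hpi]
    ring
  have hintg2 : Integrable (fun y => circleAverage (fun x => S.ell (x - y)) c r * S.F y) := by
    have h := hintg.integral_prod_right.const_mul (2 * π)⁻¹
    refine h.congr (Eventually.of_forall fun y => ?_)
    simp only
    rw [circleAverage_def, smul_eq_mul, integral_mul_const, intervalIntegral.integral_of_le hpi]
    ring
  rw [hswap]
  unfold N Lp
  rw [← mul_sub, ← integral_sub (S.ellF_int (subset_closure hc)) hintg2,
    ← integral_indicator measurableSet_ball]
  congr 1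
  refine integral_congr_ae ?_
  have hs : ∀ᵐ y : ℂ, y ∉ sphere c r := by
    rw [ae_iff]; simp only [not_not]; exact Measure.addHaar_sphere volume c r
  have hs2 : ∀ᵐ y : ℂ, y ≠ c := Measure.ae_ne volume c
  filter_upwards [hs, hs2] with y hy hyc
  have hca : circleAverage (fun x => S.ell (x - y)) c r
      = Real.log S.D - (Real.log r + Real.posLog (r⁻¹ * ‖c - y‖)) := by
    rw [← circleAverage_log_norm_sub_const_eq_log_radius_add_posLog hr.ne',
      ← circleAverage_const (Real.log S.D) c r,
      ← circleAverage_fun_sub (circleIntegrable_const _ _ _) (circleIntegrable_log_norm_sub_const r)]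
    apply circleAverage_congr_sphere
    intro z hz
    rw [abs_of_pos hr] at hz
    have hzy : z ≠ y := fun h => hy (h ▸ hz)
    simp only [ell]
    rw [Real.log_div S.hD0.ne' (norm_ne_zero_iff.2 (sub_ne_zero.2 hzy))]
  have hcy : 0 < ‖c - y‖ := norm_pos_iff.2 (sub_ne_zero.2 hyc.symm)
  rw [← sub_mul, hca]
  have hell : S.ell (c - y) = Real.log S.D - Real.log ‖c - y‖ := by
    unfold ell; rw [Real.log_div S.hD0.ne' hcy.ne']
  rw [hell]
  by_cases hyb : y ∈ ball c r
  · rw [Set.indicator_of_mem hyb]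
    rw [mem_ball, dist_eq_norm, norm_sub_rev] at hyb
    rw [(Real.posLog_eq_zero_iff _).2, norm_sub_rev y c, Real.log_div hr.ne' hcy.ne']
    · ring
    · rw [abs_of_nonneg (by positivity), inv_mul_le_iff₀ hr]; linarith
  · rw [Set.indicator_of_notMem hyb]
    rw [mem_ball, dist_eq_norm, norm_sub_rev, not_lt] at hyb
    rw [Real.posLog_eq_log, Real.log_mul (by positivity) hcy.ne', Real.log_inv]
    · ring
    · rw [abs_of_nonneg (by positivity), inv_mul_eq_div, one_le_div hr]; exact hyb

/-- harmonic correction -/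
def h (x : ℂ) : ℝ := S.N x - S.v x

lemma h_cont : ContinuousOn S.h (closure S.Ω) := S.N_cont.sub S.hvc

lemma h_mean {c : ℂ} {r : ℝ} (hr : 0 < r) (hb : closedBall c r ⊆ S.Ω) :
    circleAverage S.h c r = S.h c := by
  have h1 := S.N_mean hr hb
  have h2 := S.v_mean hr hb
  have h3 : circleAverage S.h c r = circleAverage S.N c r - circleAverage S.v c r :=
    circleAverage_fun_sub (S.circle_int S.N_cont hr hb) (S.circle_int S.hvc hr hb)
  rw [h3]; unfold h; linarith

lemma v_nonneg {x : ℂ} (hx : x ∈ closure S.Ω) : 0 ≤ S.v x := by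
  refine min_principle S.hopen S.hbd S.hvc (fun x hx => (S.hBC x hx).ge) ?_ x hx
  intro c _ r hr hb
  have := S.v_mean hr hb
  linarith [S.Lp_nonneg c r]

lemma h_nonneg {x : ℂ} (hx : x ∈ closure S.Ω) : 0 ≤ S.h x := by
  refine min_principle S.hopen S.hbd S.h_cont (fun x hx => ?_) ?_ x hx
  · unfold h; rw [S.hBC x hx, sub_zero]; exact S.N_nonneg (frontier_subset_closure hx)
  · intro c _ r hr hb
    exact (S.h_mean hr hb).le

lemma v_le_N {x : ℂ} (hx : x ∈ closure S.Ω) : S.v x ≤ S.N x := by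
  have := S.h_nonneg hx
  unfold h at this; linarith

lemma h_le_N {x : ℂ} (hx : x ∈ closure S.Ω) : S.h x ≤ S.N x := by
  have := S.v_nonneg hx
  unfold h; linarith

end Sol
end LG

namespace LG

/-! ### Part 4: a radial cut-off and the Lipschitz extension of the harmonic part -/

def phr (t : ℝ) : ℝ := Real.smoothTransition (2 - t ^ 2)

def phi (z : ℂ) : ℝ := phr ‖z‖

lemma phi_contDiff : ContDiff ℝ 1 phi := by
  have h : ContDiff ℝ 1 (fun z : ℂ => 2 - ‖z‖ ^ 2) := contDiff_const.sub (contDiff_norm_sq ℝ)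
  exact Real.smoothTransition.contDiff.comp h

lemma phi_nonneg (z : ℂ) : 0 ≤ phi z := Real.smoothTransition.nonneg _
lemma phi_le_one (z : ℂ) : phi z ≤ 1 := Real.smoothTransition.le_one _

lemma phi_one {z : ℂ} (h : ‖z‖ ≤ 1) : phi z = 1 := by
  apply Real.smoothTransition.one_of_one_le
  nlinarith [norm_nonneg z]

lemma phi_zero {z : ℂ} (h : 3 / 2 ≤ ‖z‖) : phi z = 0 := by
  apply Real.smoothTransition.zero_of_nonpos
  nlinarith [norm_nonneg z]

lemma phi_supp : tsupport phi ⊆ closedBall 0 (3 / 2) := by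
  refine closure_minimal (fun z hz => ?_) isClosed_closedBall
  rw [mem_closedBall_zero_iff]
  by_contra hcon
  exact hz (phi_zero (not_le.1 hcon).le)

lemma phi_compact : HasCompactSupport phi :=
  (isCompact_closedBall (0:ℂ) (3/2)).of_isClosed_subset (isClosed_tsupport _) phi_supp

/-- scaled cut-off -/
def phs (ρ : ℝ) (z : ℂ) : ℝ := phi (ρ⁻¹ • z)

lemma phs_contDiff (ρ : ℝ) : ContDiff ℝ 1 (phs ρ) :=
  phi_contDiff.comp (contDiff_const_smul (ρ⁻¹))

lemma phs_norm {ρ : ℝ} (hρ : 0 < ρ) (z : ℂ) : phs ρ z = phr (ρ⁻¹ * ‖z‖) := by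
  unfold phs phi
  rw [norm_smul, norm_inv, Real.norm_of_nonneg hρ.le]

lemma phs_zero {ρ : ℝ} (hρ : 0 < ρ) {z : ℂ} (h : 2 * ρ ≤ ‖z‖) : phs ρ z = 0 := by
  apply phi_zero
  rw [norm_smul, norm_inv, Real.norm_of_nonneg hρ.le, inv_mul_eq_div, le_div_iff₀ hρ]
  linarith

lemma phs_compact {ρ : ℝ} (hρ : 0 < ρ) : HasCompactSupport (phs ρ) :=
  HasCompactSupport.of_support_subset_isCompact (isCompact_closedBall (0:ℂ) (2 * ρ)) fun z hz => by
    rw [mem_closedBall_zero_iff]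
    by_contra hcon
    exact hz (phs_zero hρ (not_le.1 hcon).le)

lemma phs_int {ρ : ℝ} (hρ : 0 < ρ) : Integrable (phs ρ) :=
  (phs_contDiff ρ).continuous.integrable_of_hasCompactSupport (phs_compact hρ)

lemma phs_integral_pos {ρ : ℝ} (hρ : 0 < ρ) : 0 < ∫ z, phs ρ z := by
  refine (phs_contDiff ρ).continuous.integral_pos_of_hasCompactSupport_nonneg_nonzero (x := 0)
    (phs_compact hρ) (fun z => phi_nonneg _) ?_
  unfold phs
  rw [smul_zero, phi_one (by simp)]
  exact one_ne_zero

namespace Sol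
variable (S : Sol)

lemma N_integral : IntegrableOn S.N S.Ω ∧ ∫ x in S.Ω, S.N x ≤ (2 * π)⁻¹ * (S.D * kerC 1 S.D) * S.M := by
  have hNi : IntegrableOn S.N S.Ω :=
    (S.N_cont.integrableOn_compact S.isCompact).mono_set subset_closure
  refine ⟨hNi, ?_⟩
  have hmeas : Measurable (fun p : ℂ × ℂ => S.ell (p.1 - p.2) * S.F p.2) :=
    (S.ell_meas.comp (measurable_fst.sub measurable_snd)).mul (S.F_meas.comp measurable_snd)
  have hmem : ∀ᵐ x ∂(volume.restrict S.Ω), x ∈ S.Ω := ae_restrict_mem S.hopen.measurableSet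
  have hintg : Integrable (fun p : ℂ × ℂ => S.ell (p.1 - p.2) * S.F p.2)
      ((volume.restrict S.Ω).prod volume) := by
    rw [integrable_prod_iff hmeas.aestronglyMeasurable]
    refine ⟨hmem.mono fun x hx => S.ellF_int (subset_closure hx), ?_⟩
    refine (Integrable.const_mul hNi (2 * π)).congr (hmem.mono fun x hx => ?_)
    simp only
    simp_rw [Real.norm_of_nonneg (S.ellF_nonneg (subset_closure hx) _)]
    unfold N
    rw [← mul_assoc, mul_inv_cancel₀ (by positivity), one_mul]
  unfold N
  rw [integral_const_mul, mul_assoc]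
  refine mul_le_mul_of_nonneg_left ?_ (by positivity)
  rw [integral_integral_swap (f := fun x y => S.ell (x - y) * S.F y) hintg]
  unfold M
  rw [← integral_const_mul]
  refine integral_mono hintg.integral_prod_right (S.F_int.const_mul _) fun y => ?_
  simp only
  rw [integral_mul_const]
  by_cases hy : y ∈ S.Ω
  · refine mul_le_mul_of_nonneg_right ?_ (S.F_nonneg y)
    calc ∫ x in S.Ω, S.ell (x - y) ≤ ∫ x in S.Ω, S.D * pk 1 S.D (x - y) := by
          refine integral_mono_of_nonneg (hmem.mono fun x hx => ?_)
            ((pk_sub_integrable' one_pos S.D y).const_mul S.D).integrableOn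
            (hmem.mono fun x hx => S.ell_le (S.dist_lt (subset_closure hx) hy))
          exact S.ell_nonneg (S.dist_lt (subset_closure hx) hy)
      _ ≤ ∫ x, S.D * pk 1 S.D (x - y) :=
          setIntegral_le_integral ((pk_sub_integrable' one_pos S.D y).const_mul S.D)
            (Eventually.of_forall fun x => mul_nonneg S.hD0.le (pk_nonneg _ _ _))
      _ = S.D * kerC 1 S.D := by rw [integral_const_mul, pk_sub_integral']
  · rw [S.F_zero hy]; simp

/-- truncated harmonic part -/
def ht (c : ℂ) (r : ℝ) : ℂ → ℝ := (ball c r).indicator S.h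

lemma ht_meas {c : ℂ} {r : ℝ} (hb : ball c r ⊆ S.Ω) : Measurable (S.ht c r) := by
  have hc : ContinuousOn S.h (ball c r) := S.h_cont.mono (hb.trans subset_closure)
  refine (measurable_of_restrict_of_restrict_compl (s := ball c r) measurableSet_ball ?_ ?_)
  · have h := hc.domRestrict.measurable
    convert h using 1
    ext x
    have := x.2
    simp only [Set.domRestrict_apply]
    exact Set.indicator_of_mem this _
  · have : (ball c r)ᶜ.domRestrict (S.ht c r) = fun _ => 0 := by
      ext x
      have := x.2
      simp only [Set.domRestrict_apply]
      exact Set.indicator_of_notMem this _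
    rw [this]; exact measurable_const

lemma ht_nonneg {c : ℂ} {r : ℝ} (hb : ball c r ⊆ S.Ω) (y : ℂ) : 0 ≤ S.ht c r y :=
  Set.indicator_apply_nonneg (fun hy => S.h_nonneg (subset_closure (hb hy)))

lemma ht_int {c : ℂ} {r : ℝ} (hb : ball c r ⊆ S.Ω) : Integrable (S.ht c r) := by
  refine (integrable_indicator_iff measurableSet_ball).2 ?_
  exact (S.h_cont.integrableOn_compact S.isCompact).mono_set (hb.trans subset_closure)

lemma ht_integral {c : ℂ} {r : ℝ} (hb : ball c r ⊆ S.Ω) :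
    ∫ y, S.ht c r y ≤ (2 * π)⁻¹ * (S.D * kerC 1 S.D) * S.M := by
  refine le_trans ?_ S.N_integral.2
  rw [← integral_indicator S.hopen.measurableSet]
  refine integral_mono (S.ht_int hb) ((integrable_indicator_iff S.hopen.measurableSet).2
    S.N_integral.1) fun y => ?_
  unfold ht
  by_cases hy : y ∈ ball c r
  · rw [Set.indicator_of_mem hy, Set.indicator_of_mem (hb hy)]
    exact S.h_le_N (subset_closure (hb hy))
  · rw [Set.indicator_of_notMem hy]
    exact Set.indicator_apply_nonneg (fun hy => S.N_nonneg (subset_closure hy))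

/-- mollified harmonic part -/
def H (c : ℂ) (ρ : ℝ) (x : ℂ) : ℝ :=
  (∫ z, phs ρ z)⁻¹ * ∫ y, S.ht c (3 * ρ) y * phs ρ (x - y)

lemma H_contDiff {c : ℂ} {ρ : ℝ} (hρ : 0 < ρ) (hb : ball c (3 * ρ) ⊆ S.Ω) : ContDiff ℝ 1 (S.H c ρ) := by
  refine contDiff_const.mul ?_
  have := HasCompactSupport.contDiff_convolution_right (𝕜 := ℝ) (n := 1) (μ := volume)
    (ContinuousLinearMap.lsmul ℝ ℝ : ℝ →L[ℝ] ℝ →L[ℝ] ℝ) (phs_compact hρ)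
    (S.ht_int hb).locallyIntegrable (by exact_mod_cast phs_contDiff ρ)
  exact_mod_cast this

lemma H_eq {c : ℂ} {ρ : ℝ} (hρ : 0 < ρ) (hb : ball c (3 * ρ) ⊆ S.Ω) {x : ℂ} (hx : x ∈ ball c ρ) :
    S.H c ρ x = S.h x := by
  have hsub : ∀ t, t < 2 * ρ → closedBall x t ⊆ ball c (3 * ρ) := by
    intro t ht z hz
    rw [mem_closedBall] at hz
    rw [mem_ball] at hx ⊢
    linarith [dist_triangle z x c]
  have hρ2 : 0 < 2 * ρ := by positivity
  have hbdd : ∀ z, |phs ρ z| ≤ 1 := fun z => by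
    unfold phs; rw [abs_of_nonneg (phi_nonneg _)]; exact phi_le_one _
  have hsw : ∀ y, phs ρ (x - y) = phr (ρ⁻¹ * ‖y - x‖) := fun y => by
    rw [phs_norm hρ, norm_sub_rev]
  -- a general radial identity
  have key : ∀ g : ℂ → ℝ, Measurable g → Integrable (fun y => g y * phs ρ (x - y)) →
      ∫ y, g y * phs ρ (x - y)
        = ∫ t in (0:ℝ)..2 * ρ, t * (2 * π * (phr (ρ⁻¹ * t) * circleAverage g x t)) := by
    intro g hg hgi
    have hind : (ball x (2 * ρ)).indicator (fun y => phr (ρ⁻¹ * ‖y - x‖) * g y)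
        = fun y => g y * phs ρ (x - y) := by
      ext y
      by_cases hy : y ∈ ball x (2 * ρ)
      · rw [Set.indicator_of_mem hy, hsw]; ring
      · rw [Set.indicator_of_notMem hy, phs_zero hρ, mul_zero]
        rw [mem_ball, dist_eq_norm, norm_sub_rev, not_lt] at hy; exact hy
    have hps : Measurable (fun y => phs ρ (x - y)) :=
      ((phs_contDiff ρ).continuous.comp (continuous_const.sub continuous_id)).measurable
    rw [← polar_ball (g := g) x hρ2 (fun t => phr (ρ⁻¹ * t)) (by rw [hind]; exact hg.mul hps)
      (by rw [hind]; exact hgi), ← integral_indicator measurableSet_ball, hind]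
  have hpi : Integrable (fun y => phs ρ (x - y)) := (phs_int hρ).comp_sub_left x
  have hpm : AEStronglyMeasurable (fun y => phs ρ (x - y)) := hpi.1
  have k1 := key (S.ht c (3 * ρ)) (S.ht_meas hb) (by
    refine (S.ht_int hb).mul_bdd (c := 1) hpm (Eventually.of_forall fun y => hbdd _))
  have k2 := key (fun _ => 1) measurable_const (by simpa using hpi)
  have k3 : ∫ y, (1:ℝ) * phs ρ (x - y) = ∫ z, phs ρ z := by
    simp only [one_mul]
    exact integral_sub_left_eq_self (phs ρ) volume x
  have k4 : ∫ y, S.ht c (3 * ρ) y * phs ρ (x - y) = (∫ z, phs ρ z) * S.h x := by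
    rw [k1, ← k3, k2, ← intervalIntegral.integral_mul_const]
    rw [intervalIntegral.integral_of_le hρ2.le, intervalIntegral.integral_of_le hρ2.le,
      integral_Ioc_eq_integral_Ioo, integral_Ioc_eq_integral_Ioo]
    refine setIntegral_congr_fun measurableSet_Ioo fun t ht => ?_
    have e1 : circleAverage (S.ht c (3 * ρ)) x t = S.h x := by
      rw [← S.h_mean ht.1 ((hsub t ht.2).trans hb)]
      apply circleAverage_congr_sphere
      intro z hz
      rw [abs_of_pos ht.1] at hz
      exact Set.indicator_of_mem (hsub t ht.2 (sphere_subset_closedBall hz)) _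
    simp only [e1, circleAverage_const]
    ring
  unfold H
  rw [k4, ← mul_assoc, inv_mul_cancel₀ (phs_integral_pos hρ).ne', one_mul]

end Sol

lemma exists_H {ρ : ℝ} (hρ : 0 < ρ) (D : ℝ) : ∃ CH, 0 ≤ CH ∧ ∀ S : Sol, S.D = D → ∀ c,
    ball c (3 * ρ) ⊆ S.Ω → ContDiff ℝ 1 (S.H c ρ) ∧ (∀ x ∈ ball c ρ, S.H c ρ x = S.h x) ∧
      ∀ x, ‖fderiv ℝ (S.H c ρ) x‖ ≤ CH * S.M := by
  obtain ⟨L, hL⟩ := ContDiff.lipschitzWith_of_hasCompactSupport (phs_compact hρ) (phs_contDiff ρ) (by norm_num)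
  have hI := phs_integral_pos hρ
  refine ⟨|(∫ z, phs ρ z)⁻¹ * L * ((2 * π)⁻¹ * (D * kerC 1 D))|, by positivity, fun S hSD c hb =>
    ⟨S.H_contDiff hρ hb, fun x hx => S.H_eq hρ hb hx, fun x => ?_⟩⟩
  have hK : 0 ≤ |(∫ z, phs ρ z)⁻¹ * L * ((2 * π)⁻¹ * (D * kerC 1 D))| * S.M :=
    mul_nonneg (abs_nonneg _) S.M_nonneg
  refine norm_fderiv_le_of_lip' (𝕜 := ℝ) (f := S.H c ρ) (x₀ := x) hK (Eventually.of_forall fun x' => ?_)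
  have hintg : ∀ x, Integrable (fun y => S.ht c (3 * ρ) y * phs ρ (x - y)) := fun x => by
    refine (S.ht_int hb).mul_bdd (c := 1) ((phs_int hρ).comp_sub_left x).1 (Eventually.of_forall fun y => ?_)
    unfold phs; rw [Real.norm_of_nonneg (phi_nonneg _)]; exact phi_le_one _
  unfold Sol.H
  rw [← mul_sub, ← integral_sub (hintg _) (hintg _), norm_mul, Real.norm_of_nonneg (inv_nonneg.2 hI.le)]
  have h1 : ‖∫ y, (S.ht c (3 * ρ) y * phs ρ (x' - y) - S.ht c (3 * ρ) y * phs ρ (x - y))‖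
      ≤ ∫ y, S.ht c (3 * ρ) y * (L * ‖x' - x‖) := by
    refine norm_integral_le_of_norm_le ((S.ht_int hb).mul_const _) (Eventually.of_forall fun y => ?_)
    rw [← mul_sub, norm_mul, Real.norm_of_nonneg (S.ht_nonneg hb y)]
    refine mul_le_mul_of_nonneg_left ?_ (S.ht_nonneg hb y)
    have := hL.dist_le_mul (x' - y) (x - y)
    rw [dist_eq_norm, dist_eq_norm] at this
    simpa using this
  rw [integral_mul_const] at h1
  have h2 := S.ht_integral hb
  rw [hSD] at h2
  calc (∫ z, phs ρ z)⁻¹ * _ ≤ (∫ z, phs ρ z)⁻¹ * (((2 * π)⁻¹ * (D * kerC 1 D) * S.M) * (L * ‖x' - x‖)) := by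
        refine mul_le_mul_of_nonneg_left (h1.trans ?_) (inv_nonneg.2 hI.le)
        exact mul_le_mul_of_nonneg_right h2 (by positivity)
    _ = ((∫ z, phs ρ z)⁻¹ * L * ((2 * π)⁻¹ * (D * kerC 1 D))) * S.M * ‖x' - x‖ := by ring
    _ ≤ _ := by
        refine mul_le_mul_of_nonneg_right ?_ (norm_nonneg _)
        exact mul_le_mul_of_nonneg_right (le_abs_self _) S.M_nonneg

end LG

namespace LG

/-! ### Part 5: the integral identity -/

lemma ci_int {Ω : Set ℂ} (hΩ : IsOpen Ω) {p g : ℂ → ℝ} (hp : ContinuousOn p Ω) (hg : Continuous g)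
    (hgc : HasCompactSupport g) (hgs : tsupport g ⊆ Ω) : Integrable (fun x => p x * g x) := by
  have h1 : Continuous (fun x => p x * g x) :=
    (hp.mul hg.continuousOn).continuous_of_tsupport_subset hΩ (tsupport_mul_subset_right.trans hgs)
  exact h1.integrable_of_hasCompactSupport (hgc.mul_left)

lemma ibp {Ω : Set ℂ} (hΩ : IsOpen Ω) {u g : ℂ → ℝ} (hu : ContDiffOn ℝ 1 u Ω) (hg : ContDiff ℝ 1 g)
    (hgc : HasCompactSupport g) (hgs : tsupport g ⊆ Ω) (e : ℂ) :
    ∫ x, u x * fderiv ℝ g x e = -∫ x, fderiv ℝ u x e * g x := by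
  have hdg : Continuous (fun x => fderiv ℝ g x e) :=
    (hg.continuous_fderiv (by norm_num)).clm_apply continuous_const
  have hdu : ContinuousOn (fun x => fderiv ℝ u x e) Ω :=
    (hu.continuousOn_fderiv_of_isOpen hΩ (by norm_num)).clm_apply continuousOn_const
  refine integral_mul_fderiv_eq_neg_fderiv_mul_of_integrable ?_ ?_ ?_ ?_ ?_
  · exact ci_int hΩ hdu hg.continuous hgc hgs
  · exact ci_int hΩ hu.continuousOn hdg (hgc.fderiv_apply ℝ e)
      ((tsupport_fderiv_apply_subset ℝ e).trans hgs)
  · exact ci_int hΩ hu.continuousOn hg.continuous hgc hgs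
  · intro x hx
    exact (hu.contDiffAt (hΩ.mem_nhds (hgs hx))).differentiableAt (by norm_num)
  · intro x _
    exact hg.differentiable (by norm_num) x

/-- regularised gradient kernel -/
def kk (ε : ℝ) (e z : ℂ) : ℝ := inner ℝ z e / (‖z‖ ^ 2 + ε ^ 2)

lemma kk_odd (ε : ℝ) (e z : ℂ) : kk ε e (-z) = -kk ε e z := by
  unfold kk; rw [inner_neg_left, norm_neg, neg_div]

lemma kk_meas (ε : ℝ) (e : ℂ) : Measurable (kk ε e) := by
  unfold kk
  exact (by fun_prop : Continuous fun z : ℂ => (inner ℝ z e : ℝ)).measurable.div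
    (by fun_prop : Continuous fun z : ℂ => ‖z‖ ^ 2 + ε ^ 2).measurable

lemma kk_bound (ε : ℝ) (e z : ℂ) : ‖z‖ * |kk ε e z| ≤ ‖e‖ := by
  unfold kk
  rw [abs_div, abs_of_nonneg (by positivity : 0 ≤ ‖z‖ ^ 2 + ε ^ 2)]
  rcases eq_or_ne z 0 with rfl | hz
  · simp
  · have hz' : 0 < ‖z‖ := norm_pos_iff.2 hz
    rw [← mul_div_assoc, div_le_iff₀ (by positivity)]
    have := abs_real_inner_le_norm z e
    nlinarith [norm_nonneg e, sq_nonneg ε, mul_le_mul_of_nonneg_left this hz'.le,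
      mul_nonneg (norm_nonneg e) (sq_nonneg ε)]

namespace Sol
variable (S : Sol)

lemma elle_contDiff {ε : ℝ} (hε : 0 < ε) (y : ℂ) : ContDiff ℝ 1 (fun x => S.elle ε (x - y)) := by
  have hD := S.hD0
  unfold elle
  refine contDiff_const.mul (ContDiff.log ?_ ?_)
  · refine contDiff_const.div ?_ (fun z => by positivity)
    exact ((contDiff_norm_sq ℝ).comp (contDiff_id.sub contDiff_const)).add contDiff_const
  · intro x; positivity

lemma elle_fderiv {ε : ℝ} (hε : 0 < ε) (y x e : ℂ) :
    fderiv ℝ (fun x => S.elle ε (x - y)) x e = -kk ε e (x - y) := by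
  have hD := S.hD0
  have h1 : (fun x => S.elle ε (x - y)) = fun x => 1 / 2 * (Real.log (S.D ^ 2)
      - Real.log (‖x - y‖ ^ 2 + ε ^ 2)) := by
    ext x; unfold elle; rw [Real.log_div (by positivity) (by positivity)]
  have h2 : HasFDerivAt (fun x : ℂ => x - y) (ContinuousLinearMap.id ℝ ℂ) x :=
    (hasFDerivAt_id x).sub_const y
  have h3 := ((((h2.norm_sq).add_const (ε ^ 2)).log (by positivity)).const_sub
    (Real.log (S.D ^ 2))).const_mul (1 / 2 : ℝ)
  rw [h1, h3.fderiv]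
  unfold kk
  simp
  field_simp
  ring

section ident
variable {S} {a : ℂ → ℝ}

lemma FaF_zero (has : tsupport a ⊆ S.Ω) {x : ℂ} (hx : x ∉ S.Ω) : a x = 0 := by
  by_contra h
  exact hx (has (subset_tsupport _ h))

lemma f_contDiffOn : ContDiffOn ℝ 1 S.f S.Ω :=
  (contDiffOn_const.mul S.hV1).mul (S.hv2.of_le (by norm_num)).exp

lemma Fa_contDiff (ha : ContDiff ℝ 1 a) (has : tsupport a ⊆ S.Ω) : ContDiff ℝ 1 (fun x => S.F x * a x) := by
  rw [contDiff_iff_contDiffAt]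
  intro x
  by_cases hx : x ∈ S.Ω
  · have h1 : ContDiffAt ℝ 1 (fun x => S.f x * a x) x :=
      (f_contDiffOn.contDiffAt (S.hopen.mem_nhds hx)).mul ha.contDiffAt
    refine h1.congr_of_eventuallyEq ?_
    filter_upwards [S.hopen.mem_nhds hx] with y hy
    rw [S.F_eq hy]
  · have hx' : x ∈ (tsupport a)ᶜ := fun h => hx (has h)
    refine (contDiffAt_const (c := (0:ℝ))).congr_of_eventuallyEq ?_
    filter_upwards [(isClosed_tsupport a).isOpen_compl.mem_nhds hx'] with y hy
    rw [image_eq_zero_of_notMem_tsupport hy, mul_zero]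

lemma Fa_supp : tsupport (fun x => S.F x * a x) ⊆ tsupport a := tsupport_mul_subset_right

lemma Fa_compact (hac : HasCompactSupport a) : HasCompactSupport (fun x => S.F x * a x) := hac.mul_left

lemma Fa_fderiv (ha : ContDiff ℝ 1 a) (has : tsupport a ⊆ S.Ω) (e x : ℂ) : fderiv ℝ (fun x => S.F x * a x) x e
    = S.F x * fderiv ℝ a x e + S.F x * a x * (fderiv ℝ S.V x e / S.V x) + fderiv ℝ S.v x e * (S.F x * a x) := by
  by_cases hx : x ∈ S.Ω
  · have h1 : (fun x => S.F x * a x) =ᶠ[𝓝 x] fun x => S.f x * a x := by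
      filter_upwards [S.hopen.mem_nhds hx] with y hy
      rw [S.F_eq hy]
    have hV := ((S.hV1.contDiffAt (S.hopen.mem_nhds hx)).differentiableAt (by norm_num)).hasFDerivAt
    have hv := v_diff S.hopen S.hv2 hx
    have hA := (ha.differentiable (by norm_num) x).hasFDerivAt
    have hVp := S.hVpos x (subset_closure hx)
    have h2 := ((hV.const_mul S.lam).mul hv.exp).mul hA
    have h3 : fderiv ℝ (fun x => S.f x * a x) x = _ := h2.fderiv
    rw [h1.fderiv_eq, h3, S.F_eq hx]
    simp [f]
    field_simp
    ring
  · have hx' : x ∉ tsupport a := fun h => hx (has h)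
    have e1 : fderiv ℝ (fun x => S.F x * a x) x = 0 :=
      image_eq_zero_of_notMem_tsupport (fun h => hx' (Fa_supp (tsupport_fderiv_subset ℝ h)))
    rw [e1, S.F_zero hx]; simp

/-- the `N`-side of the identity -/
lemma ident_left (ha : ContDiff ℝ 1 a) (hac : HasCompactSupport a)
    (has : tsupport a ⊆ S.Ω) {Hf : ℂ → ℝ} (hH : ContDiff ℝ 1 Hf)
    (hN : ∀ x ∈ tsupport a, S.N x = S.v x + Hf x) (e : ℂ) :
    ∫ x, S.N x * fderiv ℝ (fun x => S.F x * a x) x e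
      = (∫ x, S.F x * fderiv ℝ a x e) + (∫ x, S.F x * a x * (fderiv ℝ S.V x e / S.V x))
        - ∫ x, S.F x * a x * fderiv ℝ Hf x e := by
  have hy := Fa_contDiff ha has
  have hyc := Fa_compact (S := S) hac
  have hys : tsupport (fun x => S.F x * a x) ⊆ S.Ω := Fa_supp.trans has
  have hdy : Continuous (fun x => fderiv ℝ (fun x => S.F x * a x) x e) :=
    (hy.continuous_fderiv (by norm_num)).clm_apply continuous_const
  have hdyc := hyc.fderiv_apply ℝ e
  have hdys := (tsupport_fderiv_apply_subset ℝ (f := fun x => S.F x * a x) e).trans hys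
  have hv1 : ContDiffOn ℝ 1 S.v S.Ω := S.hv2.of_le (by norm_num)
  have i1 := ibp S.hopen hv1 hy hyc hys e
  have i2 := ibp S.hopen hH.contDiffOn hy hyc hys e
  have i3 := ibp S.hopen (u := fun _ => (1:ℝ)) contDiffOn_const hy hyc hys e
  simp only [one_mul, fderiv_fun_const, Pi.zero_apply, zero_apply, zero_mul,
    integral_zero, neg_zero] at i3
  have e1 : ∫ x, S.N x * fderiv ℝ (fun x => S.F x * a x) x e
      = ∫ x, (S.v x * fderiv ℝ (fun x => S.F x * a x) x e + Hf x * fderiv ℝ (fun x => S.F x * a x) x e) := by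
    refine integral_congr_ae (Eventually.of_forall fun x => ?_)
    simp only
    by_cases hx : x ∈ tsupport a
    · rw [hN x hx]; ring
    · have : fderiv ℝ (fun x => S.F x * a x) x = 0 :=
        image_eq_zero_of_notMem_tsupport (fun h => hx (Fa_supp (tsupport_fderiv_subset ℝ h)))
      rw [this]; simp
  rw [e1, integral_add (ci_int S.hopen S.hv2.continuousOn hdy hdyc hdys)
    (ci_int S.hopen hH.continuous.continuousOn hdy hdyc hdys), i1, i2]
  have hFda : Integrable (fun x => S.F x * fderiv ℝ a x e) := by
    have h1 : Integrable (fun x => S.f x * fderiv ℝ a x e) := by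
      refine ci_int S.hopen (S.f_cont.mono subset_closure) ?_ (hac.fderiv_apply ℝ e)
        ((tsupport_fderiv_apply_subset ℝ e).trans has)
      exact (ha.continuous_fderiv (by norm_num)).clm_apply continuous_const
    refine h1.congr (Eventually.of_forall fun x => ?_)
    simp only
    by_cases hx : x ∈ S.Ω
    · rw [S.F_eq hx]
    · have : fderiv ℝ a x = 0 :=
        image_eq_zero_of_notMem_tsupport (fun h => hx (has (tsupport_fderiv_subset ℝ h)))
      rw [this]; simp
  have hVi : Integrable (fun x => S.F x * a x * (fderiv ℝ S.V x e / S.V x)) := by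
    have h1 : Integrable (fun x => (fderiv ℝ S.V x e / S.V x) * (S.F x * a x)) := by
      refine ci_int S.hopen ?_ hy.continuous hyc hys
      refine ContinuousOn.div ?_ (S.hVc.mono subset_closure)
        (fun x hx => (S.hVpos x (subset_closure hx)).ne')
      exact (S.hV1.continuousOn_fderiv_of_isOpen S.hopen (by norm_num)).clm_apply continuousOn_const
    refine h1.congr (Eventually.of_forall fun x => mul_comm _ _)
  have hvi : Integrable (fun x => fderiv ℝ S.v x e * (S.F x * a x)) :=
    ci_int S.hopen ((hv1.continuousOn_fderiv_of_isOpen S.hopen (by norm_num)).clm_apply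
      continuousOn_const) hy.continuous hyc hys
  have e2 : ∫ x, fderiv ℝ (fun x => S.F x * a x) x e = (∫ x, S.F x * fderiv ℝ a x e)
      + (∫ x, S.F x * a x * (fderiv ℝ S.V x e / S.V x)) + ∫ x, fderiv ℝ S.v x e * (S.F x * a x) := by
    simp_rw [Fa_fderiv ha has e]
    have hs : Integrable (fun x => S.F x * fderiv ℝ a x e
        + S.F x * a x * (fderiv ℝ S.V x e / S.V x)) := hFda.add hVi
    rw [integral_add hs hvi, integral_add hFda hVi]
  have e3 : ∫ x, fderiv ℝ Hf x e * (S.F x * a x) = ∫ x, S.F x * a x * fderiv ℝ Hf x e := by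
    simp_rw [mul_comm]
  rw [e3]
  linarith

end ident
end Sol
end LG

namespace LG
namespace Sol
variable {S : Sol} {a : ℂ → ℝ}

/-- double integral kernel -/
def KK (S : Sol) (a : ℂ → ℝ) (ε : ℝ) (e : ℂ) (p : ℂ × ℂ) : ℝ :=
  S.F p.1 * S.F p.2 * ((a p.1 - a p.2) * kk ε e (p.1 - p.2))

lemma FF_int (S : Sol) : Integrable (fun p : ℂ × ℂ => S.F p.1 * S.F p.2) (volume.prod volume) :=
  S.F_int.mul_prod S.F_int

lemma KK_meas (ha : Continuous a) (ε : ℝ) (e : ℂ) : Measurable (KK S a ε e) := by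
  unfold KK
  refine ((S.F_meas.comp measurable_fst).mul (S.F_meas.comp measurable_snd)).mul ?_
  refine ((ha.measurable.comp measurable_fst).sub (ha.measurable.comp measurable_snd)).mul ?_
  exact (kk_meas ε e).comp (measurable_fst.sub measurable_snd)

lemma KK_bound {L : NNReal} (hL : LipschitzWith L a) (ε : ℝ) (e : ℂ) (p : ℂ × ℂ) :
    ‖KK S a ε e p‖ ≤ S.F p.1 * S.F p.2 * (L * ‖e‖) := by
  unfold KK
  have h0 : 0 ≤ S.F p.1 * S.F p.2 := mul_nonneg (S.F_nonneg _) (S.F_nonneg _)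
  rw [norm_mul, Real.norm_of_nonneg h0]
  refine mul_le_mul_of_nonneg_left ?_ h0
  rw [norm_mul]
  have h1 := hL.dist_le_mul p.1 p.2
  rw [dist_eq_norm, dist_eq_norm] at h1
  have h2 := kk_bound ε e (p.1 - p.2)
  calc ‖a p.1 - a p.2‖ * ‖kk ε e (p.1 - p.2)‖ ≤ (L * ‖p.1 - p.2‖) * |kk ε e (p.1 - p.2)| :=
        mul_le_mul_of_nonneg_right h1 (abs_nonneg _)
    _ = L * (‖p.1 - p.2‖ * |kk ε e (p.1 - p.2)|) := by ring
    _ ≤ L * ‖e‖ := mul_le_mul_of_nonneg_left h2 L.2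

lemma KK_int {L : NNReal} (hL : LipschitzWith L a) (ε : ℝ) (e : ℂ) :
    Integrable (KK S a ε e) (volume.prod volume) :=
  (S.FF_int.mul_const (L * ‖e‖)).mono' (KK_meas hL.continuous ε e).aestronglyMeasurable
    (Eventually.of_forall (KK_bound hL ε e))

lemma kk_bound' {ε : ℝ} (hε : 0 < ε) (e z : ℂ) : |kk ε e z| ≤ ‖e‖ / ε := by
  unfold kk
  rw [abs_div, abs_of_nonneg (by positivity : 0 ≤ ‖z‖ ^ 2 + ε ^ 2), div_le_div_iff₀ (by positivity) hε]
  have := abs_real_inner_le_norm z e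
  have h1 : ‖z‖ * ε ≤ ‖z‖ ^ 2 + ε ^ 2 := by nlinarith [sq_nonneg (‖z‖ - ε), norm_nonneg z]
  nlinarith [norm_nonneg e, mul_le_mul_of_nonneg_right this hε.le,
    mul_le_mul_of_nonneg_left h1 (norm_nonneg e)]

lemma ident_right_eps (ha : ContDiff ℝ 1 a) (hac : HasCompactSupport a)
    (has : tsupport a ⊆ S.Ω) (e : ℂ) {ε : ℝ} (hε : 0 < ε) :
    ∫ x, S.Ne ε x * fderiv ℝ (fun x => S.F x * a x) x e
      = (4 * π)⁻¹ * ∫ p, KK S a ε e p ∂(volume.prod volume) := by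
  have hy := Fa_contDiff ha has
  have hyc := Fa_compact (S := S) hac
  have hys : tsupport (fun x => S.F x * a x) ⊆ S.Ω := Fa_supp.trans has
  set y : ℂ → ℝ := fun x => S.F x * a x with hydef
  have hdy : Continuous (fun x => fderiv ℝ y x e) :=
    (hy.continuous_fderiv (by norm_num)).clm_apply continuous_const
  have hdyc := hyc.fderiv_apply ℝ e
  have hdyi : Integrable (fun x => fderiv ℝ y x e) := hdy.integrable_of_hasCompactSupport hdyc
  have hdy0 : ∀ x, x ∉ S.Ω → fderiv ℝ y x e = 0 := fun x hx => by
    have : fderiv ℝ y x = 0 :=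
      image_eq_zero_of_notMem_tsupport (fun h => hx (hys (tsupport_fderiv_subset ℝ h)))
    rw [this]; simp
  obtain ⟨C, hC⟩ := (isCompact_closedBall (0:ℂ) S.D).exists_bound_of_continuousOn
    (S.elle_cont hε).continuousOn
  have hi : Integrable (fun p : ℂ × ℂ => S.elle ε (p.1 - p.2) * S.F p.2 * fderiv ℝ y p.1 e)
      (volume.prod volume) := by
    refine ((hdyi.norm.mul_prod S.F_int).const_mul C).mono' ?_ (Eventually.of_forall fun p => ?_)
    · refine Measurable.aestronglyMeasurable ?_
      refine (((S.elle_cont hε).measurable.comp (measurable_fst.sub measurable_snd)).mul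
        (S.F_meas.comp measurable_snd)).mul (hdy.measurable.comp measurable_fst)
    · rw [norm_mul, norm_mul, Real.norm_of_nonneg (S.F_nonneg _)]
      by_cases h1 : p.1 ∈ S.Ω
      · by_cases h2 : p.2 ∈ S.Ω
        · have := hC (p.1 - p.2) (by
            rw [mem_closedBall_zero_iff]; exact (S.dist_lt (subset_closure h1) h2).le)
          have h3 : 0 ≤ S.F p.2 * ‖fderiv ℝ y p.1 e‖ := mul_nonneg (S.F_nonneg _) (norm_nonneg _)
          nlinarith [mul_le_mul_of_nonneg_right this h3]
        · rw [S.F_zero h2]; simp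
      · rw [hdy0 _ h1]; simp
  have e1 : ∫ x, S.Ne ε x * fderiv ℝ y x e
      = (2 * π)⁻¹ * ∫ x, ∫ z, S.elle ε (x - z) * S.F z * fderiv ℝ y x e := by
    rw [← integral_const_mul]
    congr 1; ext x
    unfold Ne
    rw [integral_mul_const]; ring
  have e2 : ∀ z, ∫ x, S.elle ε (x - z) * S.F z * fderiv ℝ y x e
      = ∫ x, S.F x * S.F z * a x * kk ε e (x - z) := by
    intro z
    have i1 := ibp S.hopen (S.elle_contDiff hε z).contDiffOn hy hyc hys e
    have : ∫ x, S.elle ε (x - z) * S.F z * fderiv ℝ y x e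
        = S.F z * ∫ x, S.elle ε (x - z) * fderiv ℝ y x e := by
      rw [← integral_const_mul]; congr 1; ext x; ring
    rw [this, i1, ← integral_neg, ← integral_const_mul]
    congr 1; ext x
    rw [S.elle_fderiv hε, hydef]; ring
  rw [e1, integral_integral_swap (f := fun x z => S.elle ε (x - z) * S.F z * fderiv ℝ y x e) hi]
  simp_rw [e2]
  -- symmetrise
  obtain ⟨A, hA⟩ := hac.exists_bound_of_continuous ha.continuous
  set g : ℂ × ℂ → ℝ := fun p => S.F p.2 * S.F p.1 * a p.2 * kk ε e (p.2 - p.1) with hg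
  have hgi : Integrable g (volume.prod volume) := by
    refine (S.FF_int.mul_const (A * (‖e‖ / ε))).mono' ?_ (Eventually.of_forall fun p => ?_)
    · refine Measurable.aestronglyMeasurable ?_
      exact (((S.F_meas.comp measurable_snd).mul (S.F_meas.comp measurable_fst)).mul
        (ha.continuous.measurable.comp measurable_snd)).mul
        ((kk_meas ε e).comp (measurable_snd.sub measurable_fst))
    · have h0 : 0 ≤ S.F p.1 * S.F p.2 := mul_nonneg (S.F_nonneg _) (S.F_nonneg _)
      rw [hg]
      simp only
      rw [show S.F p.2 * S.F p.1 * a p.2 * kk ε e (p.2 - p.1)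
        = S.F p.1 * S.F p.2 * (a p.2 * kk ε e (p.2 - p.1)) by ring, norm_mul, Real.norm_of_nonneg h0]
      refine mul_le_mul_of_nonneg_left ?_ h0
      rw [norm_mul]
      exact mul_le_mul (hA _) (kk_bound' hε e _) (norm_nonneg _) ((norm_nonneg _).trans (hA p.2))
  have e3 : ∫ z, ∫ x, S.F x * S.F z * a x * kk ε e (x - z) = ∫ p, g p ∂(volume.prod volume) :=
    (integral_prod g hgi).symm
  have e4 : ∫ p, g p.swap ∂(volume.prod volume) = ∫ p, g p ∂(volume.prod volume) :=
    integral_prod_swap g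
  have e5 : ∫ p, KK S a ε e p ∂(volume.prod volume)
      = ∫ p, g p ∂(volume.prod volume) + ∫ p, g p.swap ∂(volume.prod volume) := by
    have hgs : Integrable (fun p : ℂ × ℂ => g p.swap) (volume.prod volume) := hgi.swap
    rw [← integral_add hgi hgs]
    congr 1; ext p
    simp only [hg, KK, Prod.fst_swap, Prod.snd_swap]
    have : kk ε e (p.2 - p.1) = -kk ε e (p.1 - p.2) := by rw [← kk_odd, neg_sub]
    rw [this]; ring
  rw [e3, e5, e4]
  field_simp
  ring

/-- The main integral identity (one direction). -/
lemma ident (ha : ContDiff ℝ 1 a) (hac : HasCompactSupport a)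
    (has : tsupport a ⊆ S.Ω) {Hf : ℂ → ℝ} (hH : ContDiff ℝ 1 Hf)
    (hN : ∀ x ∈ tsupport a, S.N x = S.v x + Hf x) (e : ℂ) :
    (∫ x, S.F x * fderiv ℝ a x e) + (∫ x, S.F x * a x * (fderiv ℝ S.V x e / S.V x))
        - ∫ x, S.F x * a x * fderiv ℝ Hf x e
      = (4 * π)⁻¹ * ∫ p, KK S a 0 e p ∂(volume.prod volume) := by
  rw [← ident_left ha hac has hH hN e]
  obtain ⟨L, hL⟩ := ContDiff.lipschitzWith_of_hasCompactSupport hac ha (by norm_num)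
  have hy := Fa_contDiff ha has
  have hyc := Fa_compact (S := S) hac
  have hys : tsupport (fun x => S.F x * a x) ⊆ S.Ω := Fa_supp.trans has
  have hdy : Continuous (fun x => fderiv ℝ (fun x => S.F x * a x) x e) :=
    (hy.continuous_fderiv (by norm_num)).clm_apply continuous_const
  have hdyc := hyc.fderiv_apply ℝ e
  have hdyi : Integrable (fun x => fderiv ℝ (fun x => S.F x * a x) x e) :=
    hdy.integrable_of_hasCompactSupport hdyc
  have hdys := (tsupport_fderiv_apply_subset ℝ (f := fun x => S.F x * a x) e).trans hys
  have hdy0 : ∀ x, x ∉ S.Ω → fderiv ℝ (fun x => S.F x * a x) x e = 0 := fun x hx =>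
    image_eq_zero_of_notMem_tsupport (f := fun x => fderiv ℝ (fun x => S.F x * a x) x e)
      (fun h => hx (hdys h))
  obtain ⟨C, hC0, hC⟩ := S.Ne_near
  set u : ℕ → ℝ := fun n => 1 / ((n:ℝ) + 1) with hu
  have hu0 : ∀ n, 0 < u n := fun n => by simp only [hu]; positivity
  have hulim : Tendsto u atTop (𝓝 0) := tendsto_one_div_add_atTop_nhds_zero_nat
  have l1 : Tendsto (fun n => (4 * π)⁻¹ * ∫ p, KK S a (u n) e p ∂(volume.prod volume)) atTop
      (𝓝 ((4 * π)⁻¹ * ∫ p, KK S a 0 e p ∂(volume.prod volume))) := by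
    refine Tendsto.const_mul _ ?_
    refine tendsto_integral_of_dominated_convergence (fun p : ℂ × ℂ => S.F p.1 * S.F p.2 * (L * ‖e‖))
      (fun n => (KK_meas hL.continuous _ e).aestronglyMeasurable) (S.FF_int.mul_const _)
      (fun n => Eventually.of_forall (KK_bound hL _ e)) (Eventually.of_forall fun p => ?_)
    unfold KK
    refine Tendsto.const_mul _ (Tendsto.const_mul _ ?_)
    unfold kk
    rcases eq_or_ne (p.1 - p.2) 0 with hz | hz
    · simp [hz]
    · refine Tendsto.div tendsto_const_nhds (tendsto_const_nhds.add (hulim.pow 2)) ?_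
      have := norm_pos_iff.2 hz
      positivity
  have l2 : Tendsto (fun n => (4 * π)⁻¹ * ∫ p, KK S a (u n) e p ∂(volume.prod volume)) atTop
      (𝓝 (∫ x, S.N x * fderiv ℝ (fun x => S.F x * a x) x e)) := by
    rw [tendsto_iff_norm_sub_tendsto_zero]
    refine squeeze_zero (fun n => norm_nonneg _)
      (g := fun n => (C * ∫ x, ‖fderiv ℝ (fun x => S.F x * a x) x e‖) * u n) (fun n => ?_)
      (by simpa using hulim.const_mul (C * ∫ x, ‖fderiv ℝ (fun x => S.F x * a x) x e‖))
    rw [← ident_right_eps ha hac has e (hu0 n), norm_sub_rev]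
    have hi1 : Integrable (fun x => S.Ne (u n) x * fderiv ℝ (fun x => S.F x * a x) x e) :=
      ci_int S.hopen ((S.Ne_cont (hu0 n)).mono subset_closure) hdy hdyc hdys
    have hi2 : Integrable (fun x => S.N x * fderiv ℝ (fun x => S.F x * a x) x e) :=
      ci_int S.hopen (S.N_cont.mono subset_closure) hdy hdyc hdys
    rw [← integral_sub hi2 hi1, mul_assoc, mul_comm _ (u n), ← mul_assoc, ← integral_const_mul]
    refine norm_integral_le_of_norm_le (hdyi.norm.const_mul _) (Eventually.of_forall fun x => ?_)
    rw [← sub_mul, norm_mul]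
    by_cases hx : x ∈ S.Ω
    · exact mul_le_mul_of_nonneg_right (hC _ (hu0 n) x (subset_closure hx)) (norm_nonneg _)
    · rw [hdy0 x hx]; simp
  exact tendsto_nhds_unique l2 l1

end Sol
end LG

namespace LG

/-- unit cut-off field component -/
def G1 (e z : ℂ) : ℝ := phi z * inner ℝ z e

lemma G1_contDiff (e : ℂ) : ContDiff ℝ 1 (G1 e) := by
  unfold G1
  exact phi_contDiff.mul (contDiff_id.inner ℝ contDiff_const)

lemma G1_zero {e z : ℂ} (h : 3 / 2 ≤ ‖z‖) : G1 e z = 0 := by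
  unfold G1; rw [phi_zero h, zero_mul]

lemma G1_compact (e : ℂ) : HasCompactSupport (G1 e) := by
  unfold G1
  exact phi_compact.mul_right

lemma G1_lip (e : ℂ) : ∃ K, LipschitzWith K (G1 e) :=
  (G1_contDiff e).lipschitzWith_of_hasCompactSupport (G1_compact e) (by norm_num)

/-- common Lipschitz constant -/
lemma exists_K0 : ∃ K : NNReal, LipschitzWith K (G1 1) ∧ LipschitzWith K (G1 Complex.I) := by
  obtain ⟨K1, h1⟩ := G1_lip 1
  obtain ⟨K2, h2⟩ := G1_lip Complex.I
  exact ⟨max K1 K2, h1.weaken (le_max_left _ _), h2.weaken (le_max_right _ _)⟩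

/-- scaled cut-off field component -/
def cut (a : ℝ) (c e x : ℂ) : ℝ := a * G1 e (a⁻¹ • (x - c))

lemma cut_contDiff (a : ℝ) (c e : ℂ) : ContDiff ℝ 1 (cut a c e) := by
  unfold cut
  exact contDiff_const.mul ((G1_contDiff e).comp ((contDiff_id.sub contDiff_const).const_smul _))

lemma norm_scale {a : ℝ} (ha : 0 < a) (c x : ℂ) : ‖a⁻¹ • (x - c)‖ = ‖x - c‖ / a := by
  rw [norm_smul, norm_inv, Real.norm_of_nonneg ha.le]; field_simp

lemma cut_zero {a : ℝ} (ha : 0 < a) {c e x : ℂ} (h : 3 / 2 * a ≤ ‖x - c‖) : cut a c e x = 0 := by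
  unfold cut
  rw [G1_zero (by rw [norm_scale ha, le_div_iff₀ ha]; exact h), mul_zero]

lemma cut_eq {a : ℝ} (ha : 0 < a) {c e x : ℂ} (h : ‖x - c‖ ≤ a) :
    cut a c e x = inner ℝ (x - c) e := by
  unfold cut G1
  rw [phi_one (by rw [norm_scale ha, div_le_one ha]; exact h), one_mul, inner_smul_left]
  simp; field_simp

lemma cut_le {a : ℝ} (ha : 0 < a) {c e x : ℂ} (he : ‖e‖ = 1) : |cut a c e x| ≤ ‖x - c‖ := by
  unfold cut G1
  rw [inner_smul_left]
  have h1 := abs_real_inner_le_norm (x - c) e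
  rw [he, mul_one] at h1
  have : a * (phi (a⁻¹ • (x - c)) * ((starRingEnd ℝ) a⁻¹ * inner ℝ (x - c) e))
      = phi (a⁻¹ • (x - c)) * inner ℝ (x - c) e := by
    simp; field_simp
  rw [this, abs_mul, abs_of_nonneg (phi_nonneg _)]
  calc _ ≤ 1 * |inner ℝ (x - c) e| := mul_le_mul_of_nonneg_right (phi_le_one _) (abs_nonneg _)
    _ ≤ _ := by rw [one_mul]; exact h1

lemma cut_supp {a : ℝ} (ha : 0 < a) (c e : ℂ) : tsupport (cut a c e) ⊆ closedBall c (3 / 2 * a) := by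
  refine closure_minimal (fun x hx => ?_) isClosed_closedBall
  by_contra h
  rw [mem_closedBall, dist_eq_norm, not_le] at h
  exact hx (cut_zero ha h.le)

lemma cut_compact {a : ℝ} (ha : 0 < a) (c e : ℂ) : HasCompactSupport (cut a c e) :=
  (isCompact_closedBall c (3 / 2 * a)).of_isClosed_subset (isClosed_tsupport _) (cut_supp ha c e)

lemma cut_lip {a : ℝ} (ha : 0 < a) (c e : ℂ) {K : NNReal} (hK : LipschitzWith K (G1 e)) :
    LipschitzWith K (cut a c e) := by
  refine LipschitzWith.of_dist_le_mul fun x y => ?_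
  have h := hK.dist_le_mul (a⁻¹ • (x - c)) (a⁻¹ • (y - c))
  rw [dist_eq_norm, dist_eq_norm, ← smul_sub, norm_smul, norm_inv, Real.norm_of_nonneg ha.le,
    sub_sub_sub_cancel_right] at h
  rw [dist_eq_norm, dist_eq_norm]
  unfold cut
  rw [← mul_sub, norm_mul, Real.norm_of_nonneg ha.le]
  calc _ ≤ a * (K * (a⁻¹ * ‖x - y‖)) := mul_le_mul_of_nonneg_left h ha.le
    _ = _ := by field_simp

lemma cut_fderiv_le {a : ℝ} (ha : 0 < a) (c e : ℂ) {K : NNReal} (hK : LipschitzWith K (G1 e))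
    (he : ‖e‖ = 1) (x : ℂ) : |fderiv ℝ (cut a c e) x e| ≤ K := by
  have h := norm_fderiv_le_of_lipschitz ℝ (cut_lip ha c e hK) (x₀ := x)
  have h2 := (fderiv ℝ (cut a c e) x).le_opNorm e
  rw [he, mul_one] at h2
  exact h2.trans h

lemma cut_fderiv_in {a : ℝ} (ha : 0 < a) {c e x : ℂ} (he : ‖e‖ = 1) (hx : x ∈ ball c a) :
    fderiv ℝ (cut a c e) x e = 1 := by
  have h : cut a c e =ᶠ[𝓝 x] fun y => inner ℝ (y - c) e := by
    filter_upwards [isOpen_ball.mem_nhds hx] with y hy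
    exact cut_eq ha (by rw [mem_ball, dist_eq_norm] at hy; exact hy.le)
  rw [h.fderiv_eq]
  have h2 : HasFDerivAt (fun y : ℂ => inner ℝ (y - c) e) (innerSL ℝ e) x := by
    have := ((innerSL ℝ e).hasFDerivAt (x := x - c)).comp x ((hasFDerivAt_id x).sub_const c)
    refine (this.congr_of_eventuallyEq (Eventually.of_forall fun y => ?_))
    simp [real_inner_comm]
  rw [h2.fderiv]
  simp [he]

lemma cut_fderiv_out {a : ℝ} (ha : 0 < a) {c e x : ℂ} (hx : x ∉ closedBall c (3 / 2 * a)) :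
    fderiv ℝ (cut a c e) x e = 0 := by
  have : fderiv ℝ (cut a c e) x = 0 :=
    image_eq_zero_of_notMem_tsupport (fun h => hx (cut_supp ha c e (tsupport_fderiv_subset ℝ h)))
  rw [this]; simp

/-- symmetric kernel -/
def kx (a : ℝ) (c : ℂ) (p : ℂ × ℂ) : ℝ :=
  (cut a c 1 p.1 - cut a c 1 p.2) * kk 0 1 (p.1 - p.2)
    + (cut a c Complex.I p.1 - cut a c Complex.I p.2) * kk 0 Complex.I (p.1 - p.2)

lemma kx_symm (a : ℝ) (c x y : ℂ) : kx a c (x, y) = kx a c (y, x) := by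
  unfold kx
  simp only
  rw [← neg_sub y x, kk_odd, kk_odd]; ring

lemma kx_le {a : ℝ} (ha : 0 < a) (c : ℂ) {K : NNReal} (h1 : LipschitzWith K (G1 1))
    (h2 : LipschitzWith K (G1 Complex.I)) (x y : ℂ) : |kx a c (x, y)| ≤ 2 * K := by
  have key : ∀ e : ℂ, ‖e‖ = 1 → LipschitzWith K (G1 e) →
      |(cut a c e x - cut a c e y) * kk 0 e (x - y)| ≤ K := fun e he hK => by
    have h1 := (cut_lip ha c e hK).dist_le_mul x y
    rw [dist_eq_norm, dist_eq_norm] at h1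
    have h2 := kk_bound 0 e (x - y)
    rw [abs_mul]
    calc _ ≤ (K * ‖x - y‖) * |kk 0 e (x - y)| :=
          mul_le_mul_of_nonneg_right h1 (abs_nonneg _)
      _ = K * (‖x - y‖ * |kk 0 e (x - y)|) := by ring
      _ ≤ K * ‖e‖ := mul_le_mul_of_nonneg_left h2 K.2
      _ = K := by rw [he, mul_one]
  unfold kx
  refine (abs_add_le _ _).trans ?_
  have := key 1 (by simp) h1
  have := key Complex.I (by simp) h2
  simp only
  linarith

lemma kx_in {a : ℝ} (ha : 0 < a) {c x y : ℂ} (hx : x ∈ ball c a) (hy : y ∈ ball c a) (hxy : x ≠ y) :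
    kx a c (x, y) = 1 := by
  rw [mem_ball, dist_eq_norm] at hx hy
  unfold kx
  simp only
  rw [cut_eq ha hx.le, cut_eq ha hy.le, cut_eq ha hx.le, cut_eq ha hy.le]
  unfold kk
  have h0 : ‖x - y‖ ^ 2 ≠ 0 := by
    have := norm_pos_iff.2 (sub_ne_zero.2 hxy); positivity
  rw [← inner_sub_left, ← inner_sub_left, sub_sub_sub_cancel_right]
  have h3 : inner ℝ (x - y) 1 = (x - y).re := by simp [Complex.inner]
  have h4 : inner ℝ (x - y) Complex.I = (x - y).im := by simp [Complex.inner]; ring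
  rw [h3, h4]
  have h5 : ‖x - y‖ ^ 2 = (x - y).re * (x - y).re + (x - y).im * (x - y).im := by
    rw [Complex.sq_norm, Complex.normSq_apply]
  simp only [ne_eq, OfNat.ofNat_ne_zero, not_false_eq_true, zero_pow, add_zero]
  rw [← mul_div_assoc, ← mul_div_assoc, ← add_div, ← h5, div_self h0]

lemma kx_far {a Λ : ℝ} (ha : 0 < a) (hΛ : 2 ≤ Λ) {c x y : ℂ} (hx : x ∈ ball c a)
    (hy : y ∉ ball c (Λ * a)) : |kx a c (x, y)| ≤ 4 / (Λ * a) * ‖x - c‖ := by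
  rw [mem_ball, dist_eq_norm] at hx hy
  push Not at hy
  have h1 : Λ * a / 2 ≤ ‖x - y‖ := by
    have : ‖y - c‖ ≤ ‖x - y‖ + ‖x - c‖ := by
      rw [norm_sub_rev x y]; calc _ = ‖(y - x) + (x - c)‖ := by ring_nf
        _ ≤ _ := norm_add_le _ _
    nlinarith
  have hΛa : 0 < Λ * a := by positivity
  have hc0 : ∀ e, cut a c e y = 0 := fun e => cut_zero ha (by nlinarith)
  have key : ∀ e : ℂ, ‖e‖ = 1 →
      |(cut a c e x - cut a c e y) * kk 0 e (x - y)| ≤ 2 / (Λ * a) * ‖x - c‖ := fun e he => by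
    rw [hc0, sub_zero, abs_mul]
    have h2 := kk_bound 0 e (x - y)
    rw [he] at h2
    have h3 : |kk 0 e (x - y)| ≤ 2 / (Λ * a) := by
      rw [le_div_iff₀ hΛa]
      nlinarith [abs_nonneg (kk 0 e (x - y))]
    have h4 := cut_le ha (c := c) (x := x) he
    calc _ ≤ ‖x - c‖ * (2 / (Λ * a)) := mul_le_mul h4 h3 (abs_nonneg _) (norm_nonneg _)
      _ = _ := by ring
  unfold kx
  refine (abs_add_le _ _).trans ?_
  have e1 := key 1 (by simp)
  have e2 := key Complex.I (by simp)
  simp only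
  calc _ ≤ 2 / (Λ * a) * ‖x - c‖ + 2 / (Λ * a) * ‖x - c‖ := add_le_add e1 e2
    _ = _ := by ring

lemma kx_out {a Λ : ℝ} (ha : 0 < a) (hΛ : 2 ≤ Λ) {c x y : ℂ} (hx : x ∉ ball c (Λ * a))
    (hy : y ∉ ball c (Λ * a)) : kx a c (x, y) = 0 := by
  rw [mem_ball, dist_eq_norm] at hx hy
  push Not at hx hy
  have hcx : ∀ e, cut a c e x = 0 := fun e => cut_zero ha (by nlinarith)
  have hcy : ∀ e, cut a c e y = 0 := fun e => cut_zero ha (by nlinarith)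
  unfold kx; simp [hcx, hcy]

lemma ae_ne_diag : ∀ᵐ p : ℂ × ℂ ∂(volume.prod volume), p.1 ≠ p.2 := by
  have hm : MeasurableSet {p : ℂ × ℂ | p.1 = p.2} := measurableSet_eq_fun measurable_fst measurable_snd
  rw [ae_iff]
  simp only [ne_eq, not_not]
  rw [Measure.measure_prod_null hm]
  refine Eventually.of_forall fun x => ?_
  have : Prod.mk x ⁻¹' {p : ℂ × ℂ | p.1 = p.2} = {x} := by ext y; simp [eq_comm]
  simp [this]

namespace Sol
variable (S : Sol)

/-- mass of a set -/
def ms (A : Set ℂ) : ℝ := ∫ x in A, S.F x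

/-- first moment -/
def mo (c : ℂ) (r : ℝ) : ℝ := ∫ x in ball c r, ‖x - c‖ * S.F x

lemma ms_nonneg (A : Set ℂ) : 0 ≤ S.ms A := integral_nonneg S.F_nonneg

lemma ms_mono {A B : Set ℂ} (h : A ⊆ B) : S.ms A ≤ S.ms B :=
  setIntegral_mono_set S.F_int.integrableOn (Eventually.of_forall S.F_nonneg) h.eventuallyLE

lemma ms_le (A : Set ℂ) : S.ms A ≤ S.M :=
  setIntegral_le_integral S.F_int (Eventually.of_forall S.F_nonneg)

lemma mo_int (c : ℂ) (r : ℝ) : IntegrableOn (fun x => ‖x - c‖ * S.F x) (ball c r) := by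
  refine Integrable.mono' (S.F_int.integrableOn.const_mul |r|)
    (((measurable_id.sub_const c).norm).mul S.F_meas).aestronglyMeasurable ?_
  filter_upwards [ae_restrict_mem measurableSet_ball] with x hx
  rw [mem_ball, dist_eq_norm] at hx
  rw [norm_mul, norm_norm, Real.norm_of_nonneg (S.F_nonneg _)]
  exact mul_le_mul_of_nonneg_right (hx.le.trans (le_abs_self r)) (S.F_nonneg _)

lemma mo_nonneg (c : ℂ) (r : ℝ) : 0 ≤ S.mo c r :=
  integral_nonneg fun _ => mul_nonneg (norm_nonneg _) (S.F_nonneg _)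

lemma mo_mono (c : ℂ) {r s : ℝ} (h : r ≤ s) : S.mo c r ≤ S.mo c s :=
  setIntegral_mono_set (S.mo_int c s)
    (Eventually.of_forall fun _ => mul_nonneg (norm_nonneg _) (S.F_nonneg _))
    (ball_subset_ball h).eventuallyLE

lemma mo_le (c : ℂ) {r : ℝ} (hr : 0 ≤ r) : S.mo c r ≤ r * S.M := by
  have h1 : S.mo c r ≤ r * S.ms (ball c r) := by
    unfold mo ms
    rw [← integral_const_mul]
    refine setIntegral_mono_on (S.mo_int c r) (S.F_int.integrableOn.const_mul r) measurableSet_ball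
      fun x hx => ?_
    rw [mem_ball, dist_eq_norm] at hx
    exact mul_le_mul_of_nonneg_right hx.le (S.F_nonneg _)
  exact h1.trans (mul_le_mul_of_nonneg_left (S.ms_le _) hr)

set_option maxHeartbeats 1000000 in
lemma kx_est {a Λ : ℝ} (ha : 0 < a) (hΛ : 2 ≤ Λ) (c : ℂ) {K : NNReal} (h1 : LipschitzWith K (G1 1))
    (h2 : LipschitzWith K (G1 Complex.I)) :
    |(∫ p, KK S (cut a c 1) 0 1 p ∂(volume.prod volume))
      + (∫ p, KK S (cut a c Complex.I) 0 Complex.I p ∂(volume.prod volume))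
      - S.ms (ball c a) ^ 2| ≤ 4 * K * S.M * S.ms (ball c (Λ * a) \ ball c a)
        + 8 / (Λ * a) * S.M * S.mo c a := by
  have hΛa : 0 < Λ * a := by positivity
  have hBm : MeasurableSet (ball c a) := measurableSet_ball
  have hAm : MeasurableSet (ball c (Λ * a) \ ball c a) := measurableSet_ball.diff measurableSet_ball
  set FB := (ball c a).indicator S.F with hFB
  set FA := (ball c (Λ * a) \ ball c a).indicator S.F with hFA
  set J := (ball c a).indicator (fun x => ‖x - c‖ * S.F x) with hJ
  have iFB : Integrable FB := S.F_int.indicator hBm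
  have iFA : Integrable FA := S.F_int.indicator hAm
  have iJ : Integrable J := (integrable_indicator_iff hBm).2 (S.mo_int c a)
  have eFB : ∫ x, FB x = S.ms (ball c a) := integral_indicator hBm
  have eFA : ∫ x, FA x = S.ms (ball c (Λ * a) \ ball c a) := integral_indicator hAm
  have eJ : ∫ x, J x = S.mo c a := integral_indicator hBm
  have i1 := KK_int (S := S) (cut_lip ha c 1 h1) 0 1
  have i2 := KK_int (S := S) (cut_lip ha c Complex.I h2) 0 Complex.I
  have i3 : Integrable (fun p : ℂ × ℂ => FB p.1 * FB p.2) (volume.prod volume) := iFB.mul_prod iFB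
  have i4 : Integrable (fun p : ℂ × ℂ => FA p.1 * S.F p.2) (volume.prod volume) := iFA.mul_prod S.F_int
  have i5 : Integrable (fun p : ℂ × ℂ => S.F p.1 * FA p.2) (volume.prod volume) := S.F_int.mul_prod iFA
  have i6 : Integrable (fun p : ℂ × ℂ => J p.1 * S.F p.2) (volume.prod volume) := iJ.mul_prod S.F_int
  have i7 : Integrable (fun p : ℂ × ℂ => S.F p.1 * J p.2) (volume.prod volume) := S.F_int.mul_prod iJ
  have e3 : ∫ p : ℂ × ℂ, FB p.1 * FB p.2 ∂(volume.prod volume) = S.ms (ball c a) ^ 2 := by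
    rw [integral_prod_mul, eFB, sq]
  have e4 : ∫ p : ℂ × ℂ, FA p.1 * S.F p.2 ∂(volume.prod volume)
      = S.ms (ball c (Λ * a) \ ball c a) * S.M := by
    rw [integral_prod_mul, eFA]; rfl
  have e5 : ∫ p : ℂ × ℂ, S.F p.1 * FA p.2 ∂(volume.prod volume)
      = S.M * S.ms (ball c (Λ * a) \ ball c a) := by
    rw [integral_prod_mul, eFA]; rfl
  have e6 : ∫ p : ℂ × ℂ, J p.1 * S.F p.2 ∂(volume.prod volume) = S.mo c a * S.M := by
    rw [integral_prod_mul, eJ]; rfl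
  have e7 : ∫ p : ℂ × ℂ, S.F p.1 * J p.2 ∂(volume.prod volume) = S.M * S.mo c a := by
    rw [integral_prod_mul, eJ]; rfl
  have i12 : Integrable (fun p => KK S (cut a c 1) 0 1 p + KK S (cut a c Complex.I) 0 Complex.I p)
      (volume.prod volume) := i1.add i2
  rw [← e3, ← integral_add i1 i2, ← integral_sub i12 i3]
  have iA : Integrable (fun p : ℂ × ℂ => 2 * K * (FA p.1 * S.F p.2 + S.F p.1 * FA p.2))
      (volume.prod volume) := (i4.add i5).const_mul _
  have iB : Integrable (fun p : ℂ × ℂ => 4 / (Λ * a) * (J p.1 * S.F p.2 + S.F p.1 * J p.2))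
      (volume.prod volume) := (i6.add i7).const_mul _
  have hR : 4 * K * S.M * S.ms (ball c (Λ * a) \ ball c a) + 8 / (Λ * a) * S.M * S.mo c a
      = ∫ p : ℂ × ℂ, (2 * K * (FA p.1 * S.F p.2 + S.F p.1 * FA p.2)
        + 4 / (Λ * a) * (J p.1 * S.F p.2 + S.F p.1 * J p.2)) ∂(volume.prod volume) := by
    rw [integral_add iA iB, integral_const_mul, integral_const_mul, integral_add i4 i5,
      integral_add i6 i7, e4, e5, e6, e7]
    ring
  rw [hR]
  rw [← Real.norm_eq_abs]
  refine norm_integral_le_of_norm_le (iA.add iB) ?_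
  filter_upwards [ae_ne_diag] with p hp
  obtain ⟨x, y⟩ := p
  simp only at hp ⊢
  have hKK : KK S (cut a c 1) 0 1 (x, y) + KK S (cut a c Complex.I) 0 Complex.I (x, y)
      = S.F x * S.F y * kx a c (x, y) := by
    unfold KK kx; simp only; ring
  rw [hKK]
  have hFx := S.F_nonneg x
  have hFy := S.F_nonneg y
  have hxy := mul_nonneg hFx hFy
  have nA : ∀ z, 0 ≤ FA z := fun z => Set.indicator_nonneg (fun _ _ => S.F_nonneg _) z
  have nJ : ∀ z, 0 ≤ J z := fun z =>
    Set.indicator_nonneg (fun _ _ => mul_nonneg (norm_nonneg _) (S.F_nonneg _)) z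
  have nK : (0:ℝ) ≤ K := K.2
  have hk := kx_le ha c h1 h2 x y
  have p1 : 0 ≤ FA x * S.F y := mul_nonneg (nA x) hFy
  have p2 : 0 ≤ S.F x * FA y := mul_nonneg hFx (nA y)
  have p3 : 0 ≤ J x * S.F y := mul_nonneg (nJ x) hFy
  have p4 : 0 ≤ S.F x * J y := mul_nonneg hFx (nJ y)
  have q : 0 ≤ 4 / (Λ * a) := by positivity
  have q1 := mul_nonneg (mul_nonneg zero_le_two nK) p1
  have q2 := mul_nonneg (mul_nonneg zero_le_two nK) p2
  have q3 := mul_nonneg q p3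
  have q4 := mul_nonneg q p4
  have hnorm : ‖S.F x * S.F y * kx a c (x, y)‖ = S.F x * S.F y * |kx a c (x, y)| := by
    rw [norm_mul, Real.norm_of_nonneg hxy]; rfl
  by_cases hxA : x ∈ ball c (Λ * a) \ ball c a
  · have : FB x = 0 := Set.indicator_of_notMem hxA.2 _
    have h5 : FA x = S.F x := Set.indicator_of_mem hxA _
    rw [this, zero_mul, sub_zero, hnorm]
    calc _ ≤ S.F x * S.F y * (2 * K) := mul_le_mul_of_nonneg_left hk hxy
      _ = 2 * K * (FA x * S.F y) := by rw [h5]; ring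
      _ ≤ _ := by rw [mul_add, mul_add]; linarith
  by_cases hyA : y ∈ ball c (Λ * a) \ ball c a
  · have : FB y = 0 := Set.indicator_of_notMem hyA.2 _
    have h5 : FA y = S.F y := Set.indicator_of_mem hyA _
    rw [this, mul_zero, sub_zero, hnorm]
    calc _ ≤ S.F x * S.F y * (2 * K) := mul_le_mul_of_nonneg_left hk hxy
      _ = 2 * K * (S.F x * FA y) := by rw [h5]; ring
      _ ≤ _ := by rw [mul_add, mul_add]; linarith
  by_cases hxB : x ∈ ball c a
  · have h5 : FB x = S.F x := Set.indicator_of_mem hxB _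
    by_cases hyB : y ∈ ball c a
    · have h6 : FB y = S.F y := Set.indicator_of_mem hyB _
      rw [h5, h6, kx_in ha hxB hyB hp, mul_one, sub_self, norm_zero]
      positivity
    · have h6 : FB y = 0 := Set.indicator_of_notMem hyB _
      have h7 : y ∉ ball c (Λ * a) := fun h => hyA ⟨h, hyB⟩
      have h8 : J x = ‖x - c‖ * S.F x := Set.indicator_of_mem hxB _
      rw [h6, mul_zero, sub_zero, hnorm]
      calc _ ≤ S.F x * S.F y * (4 / (Λ * a) * ‖x - c‖) :=
            mul_le_mul_of_nonneg_left (kx_far ha hΛ hxB h7) hxy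
        _ = 4 / (Λ * a) * (J x * S.F y) := by rw [h8]; ring
        _ ≤ _ := by rw [mul_add, mul_add]; linarith
  · have h6 : FB x = 0 := Set.indicator_of_notMem hxB _
    have h7 : x ∉ ball c (Λ * a) := fun h => hxA ⟨h, hxB⟩
    rw [h6, zero_mul, sub_zero, hnorm]
    by_cases hyB : y ∈ ball c a
    · have h8 : J y = ‖y - c‖ * S.F y := Set.indicator_of_mem hyB _
      rw [kx_symm]
      calc _ ≤ S.F x * S.F y * (4 / (Λ * a) * ‖y - c‖) :=
            mul_le_mul_of_nonneg_left (kx_far ha hΛ hyB h7) hxy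
        _ = 4 / (Λ * a) * (S.F x * J y) := by rw [h8]; ring
        _ ≤ _ := by rw [mul_add, mul_add]; linarith
    · have h8 : y ∉ ball c (Λ * a) := fun h => hyA ⟨h, hyB⟩
      rw [kx_out ha hΛ h7 h8, abs_zero, mul_zero]
      positivity

end Sol
end LG

namespace LG
namespace Sol
variable (S : Sol)

lemma low_est {a : ℝ} (ha : 0 < a) (c e : ℂ) (he : ‖e‖ = 1) {g : ℂ → ℝ} {C : ℝ} (hC0 : 0 ≤ C)
    (hg : ∀ x ∈ closedBall c (3 / 2 * a), |g x| ≤ C) :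
    |∫ x, S.F x * cut a c e x * g x| ≤ C * S.mo c (2 * a) := by
  have i1 : Integrable ((ball c (2 * a)).indicator (fun x => ‖x - c‖ * S.F x)) :=
    (integrable_indicator_iff measurableSet_ball).2 (S.mo_int c (2 * a))
  have e1 : C * S.mo c (2 * a)
      = ∫ x, C * (ball c (2 * a)).indicator (fun x => ‖x - c‖ * S.F x) x := by
    rw [integral_const_mul, integral_indicator measurableSet_ball]; rfl
  rw [e1, ← Real.norm_eq_abs]
  refine norm_integral_le_of_norm_le (i1.const_mul C) (Eventually.of_forall fun x => ?_)
  have n0 : 0 ≤ (ball c (2 * a)).indicator (fun x => ‖x - c‖ * S.F x) x :=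
    Set.indicator_nonneg (fun _ _ => mul_nonneg (norm_nonneg _) (S.F_nonneg _)) x
  by_cases hx : x ∈ closedBall c (3 / 2 * a)
  · have hx2 : x ∈ ball c (2 * a) := by
      rw [mem_closedBall] at hx; rw [mem_ball]; linarith
    rw [Set.indicator_of_mem hx2, norm_mul, norm_mul, Real.norm_of_nonneg (S.F_nonneg _)]
    have h1 := cut_le ha (c := c) (x := x) he
    have h2 := hg x hx
    calc S.F x * ‖cut a c e x‖ * ‖g x‖ ≤ S.F x * ‖x - c‖ * C :=
          mul_le_mul (mul_le_mul_of_nonneg_left h1 (S.F_nonneg _)) h2 (norm_nonneg _)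
            (mul_nonneg (S.F_nonneg _) (norm_nonneg _))
      _ = _ := by ring
  · have : cut a c e x = 0 := cut_zero ha (by
      rw [mem_closedBall, dist_eq_norm, not_le] at hx; exact hx.le)
    rw [this]; simp only [mul_zero, zero_mul, norm_zero]
    exact mul_nonneg hC0 n0

lemma div_int {a : ℝ} (ha : 0 < a) (c e : ℂ) (he : ‖e‖ = 1) {K : NNReal}
    (hK : LipschitzWith K (G1 e)) : Integrable (fun x => S.F x * fderiv ℝ (cut a c e) x e) := by
  refine S.F_int.mul_bdd (c := K) ?_ (Eventually.of_forall fun x => cut_fderiv_le ha c e hK he x)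
  exact (((cut_contDiff a c e).continuous_fderiv (by norm_num)).clm_apply
    continuous_const).aestronglyMeasurable

lemma div_est {a Λ : ℝ} (ha : 0 < a) (hΛ : 2 ≤ Λ) (c e : ℂ) (he : ‖e‖ = 1) {K : NNReal}
    (hK : LipschitzWith K (G1 e)) :
    |(∫ x, S.F x * fderiv ℝ (cut a c e) x e) - S.ms (ball c a)|
      ≤ K * S.ms (ball c (Λ * a) \ ball c a) := by
  have hBm : MeasurableSet (ball c a) := measurableSet_ball
  have hAm : MeasurableSet (ball c (Λ * a) \ ball c a) := measurableSet_ball.diff measurableSet_ball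
  set FB := (ball c a).indicator S.F with hFB
  set FA := (ball c (Λ * a) \ ball c a).indicator S.F with hFA
  have iFB : Integrable FB := S.F_int.indicator hBm
  have iFA : Integrable FA := S.F_int.indicator hAm
  have eFB : ∫ x, FB x = S.ms (ball c a) := integral_indicator hBm
  have eFA : ∫ x, FA x = S.ms (ball c (Λ * a) \ ball c a) := integral_indicator hAm
  rw [← eFB, ← eFA, ← integral_const_mul, ← integral_sub (S.div_int ha c e he hK) iFB,
    ← Real.norm_eq_abs]
  refine norm_integral_le_of_norm_le (iFA.const_mul _) (Eventually.of_forall fun x => ?_)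
  have nA : ∀ z, 0 ≤ FA z := fun z => Set.indicator_nonneg (fun _ _ => S.F_nonneg _) z
  have nK : (0:ℝ) ≤ K := K.2
  by_cases hxB : x ∈ ball c a
  · have h5 : FB x = S.F x := Set.indicator_of_mem hxB _
    rw [h5, cut_fderiv_in ha he hxB, mul_one, sub_self, norm_zero]
    exact mul_nonneg nK (nA x)
  have h5 : FB x = 0 := Set.indicator_of_notMem hxB _
  rw [h5, sub_zero]
  by_cases hxA : x ∈ ball c (Λ * a)
  · have h6 : FA x = S.F x := Set.indicator_of_mem (show x ∈ ball c (Λ * a) \ ball c a from ⟨hxA, hxB⟩) _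
    rw [h6, norm_mul, Real.norm_of_nonneg (S.F_nonneg _), mul_comm]
    exact mul_le_mul_of_nonneg_right (cut_fderiv_le ha c e hK he x) (S.F_nonneg _)
  · rw [cut_fderiv_out ha (fun h => hxA ?_), mul_zero, norm_zero]
    · exact mul_nonneg nK (nA x)
    · rw [mem_closedBall] at h; rw [mem_ball]; nlinarith

end Sol

lemma exists_quant : ∃ K : ℝ, 0 ≤ K ∧ ∀ (S : Sol) (a Λ : ℝ) (c : ℂ) (Hf : ℂ → ℝ) (CV CH : ℝ),
    0 < a → 2 ≤ Λ → closedBall c (3 / 2 * a) ⊆ S.Ω → ContDiff ℝ 1 Hf →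
    (∀ x ∈ closedBall c (3 / 2 * a), S.N x = S.v x + Hf x) →
    0 ≤ CV → (∀ x ∈ closedBall c (3 / 2 * a), ‖fderiv ℝ S.V x‖ / S.V x ≤ CV) →
    0 ≤ CH → (∀ x, ‖fderiv ℝ Hf x‖ ≤ CH) →
    |2 * S.ms (ball c a) - S.ms (ball c a) ^ 2 / (4 * π)|
      ≤ K * (1 + S.M) * S.ms (ball c (Λ * a) \ ball c a) + K / (Λ * a) * S.M * S.mo c a
        + K * (CV + CH) * S.mo c (2 * a) := by
  obtain ⟨K, hK1, hKI⟩ := exists_K0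
  refine ⟨2 * K + 8, by positivity, fun S a Λ c Hf CV CH ha hΛ hcb hH hN hCV hV hCH hHb => ?_⟩
  have nK : (0:ℝ) ≤ K := K.2
  have key : ∀ e : ℂ, ‖e‖ = 1 → LipschitzWith K (G1 e) →
      |S.ms (ball c a) - (4 * π)⁻¹ * ∫ p, Sol.KK S (cut a c e) 0 e p ∂(volume.prod volume)|
        ≤ K * S.ms (ball c (Λ * a) \ ball c a) + (CV + CH) * S.mo c (2 * a) := fun e he hK => by
    have h1 := Sol.ident (S := S) (cut_contDiff a c e) (cut_compact ha c e)
      ((cut_supp ha c e).trans hcb) hH (fun x hx => hN x (cut_supp ha c e hx)) e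
    have h2 := S.div_est ha hΛ c e he hK
    have h3 := S.low_est ha c e he (g := fun x => fderiv ℝ S.V x e / S.V x) hCV (fun x hx => by
      have hV0 := S.hVpos x (subset_closure (hcb hx))
      rw [abs_div, abs_of_pos hV0]
      refine le_trans ?_ (hV x hx)
      have := (fderiv ℝ S.V x).le_opNorm e
      rw [he, mul_one] at this
      exact div_le_div_of_nonneg_right this hV0.le)
    have h4 := S.low_est ha c e he (g := fun x => fderiv ℝ Hf x e) hCH (fun x hx => by
      have := (fderiv ℝ Hf x).le_opNorm e
      rw [he, mul_one] at this
      exact this.trans (hHb x))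
    rw [← h1]
    rw [abs_le] at *
    constructor <;> nlinarith
  have k1 := key 1 (by simp) hK1
  have k2 := key Complex.I (by simp) hKI
  have k3 := S.kx_est ha hΛ c hK1 hKI
  set A1 := ∫ p, Sol.KK S (cut a c 1) 0 1 p ∂(volume.prod volume)
  set A2 := ∫ p, Sol.KK S (cut a c Complex.I) 0 Complex.I p ∂(volume.prod volume)
  set s := S.ms (ball c a)
  have he0 := S.ms_nonneg (ball c (Λ * a) \ ball c a)
  set e := S.ms (ball c (Λ * a) \ ball c a)
  have hm0 := S.mo_nonneg c a
  have hm1 := S.mo_nonneg c (2 * a)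
  have hM0 := S.M_nonneg
  have hπ : (4 * π)⁻¹ ≤ 1 := inv_le_one_of_one_le₀ (by nlinarith [Real.pi_gt_three])
  have hπ0 : 0 ≤ (4 * π)⁻¹ := by positivity
  have k4 : |(4 * π)⁻¹ * (A1 + A2 - s ^ 2)| ≤ 4 * K * S.M * e * (4 * π)⁻¹ + 8 / (Λ * a) * S.M * S.mo c a := by
    rw [abs_mul, abs_of_nonneg hπ0]
    have hq : 0 ≤ 8 / (Λ * a) * S.M * S.mo c a := by positivity
    have := mul_le_mul_of_nonneg_left k3 hπ0
    nlinarith [mul_le_mul_of_nonneg_left hπ hq]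
  have hπ2 : 4 * (4 * π)⁻¹ ≤ 1 := by
    rw [mul_inv, ← mul_assoc, mul_inv_cancel₀ (by norm_num), one_mul]
    exact inv_le_one_of_one_le₀ (by linarith [Real.pi_gt_three])
  have k5 : 4 * K * S.M * e * (4 * π)⁻¹ ≤ K * S.M * e := by
    have : 0 ≤ K * S.M * e := by positivity
    nlinarith
  have k6 : |2 * s - s ^ 2 / (4 * π)| ≤ 2 * (K * e + (CV + CH) * S.mo c (2 * a))
      + (K * S.M * e + 8 / (Λ * a) * S.M * S.mo c a) := by
    have e1 : 2 * s - s ^ 2 / (4 * π) = (s - (4 * π)⁻¹ * A1) + (s - (4 * π)⁻¹ * A2)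
        + (4 * π)⁻¹ * (A1 + A2 - s ^ 2) := by
      rw [div_eq_inv_mul]; ring
    rw [e1]
    refine (abs_add_three _ _ _).trans ?_
    linarith
  refine k6.trans ?_
  have r1 : 0 ≤ e * (K * S.M + 8 + 8 * S.M) := by positivity
  have r2 : 0 ≤ (2 * K : ℝ) / (Λ * a) * S.M * S.mo c a := by positivity
  have r3 : 0 ≤ (2 * K + 6 : ℝ) * (CV + CH) * S.mo c (2 * a) := by positivity
  have e2 : (2 * K + 8 : ℝ) / (Λ * a) = 2 * K / (Λ * a) + 8 / (Λ * a) := by ring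
  rw [e2]
  nlinarith

end LG

namespace LG

lemma kerC_scale {t : ℝ} (ht : 0 < t) : kerC 1 t = t * kerC 1 1 := by
  have h1 := Measure.integral_comp_smul (volume : Measure ℂ) (pk 1 1) t⁻¹
  rw [Complex.finrank_real_complex] at h1
  have h2 : ∀ z : ℂ, pk 1 1 (t⁻¹ • z) = t * pk 1 t z := fun z => by
    have hn : ‖t⁻¹ • z‖ = ‖z‖ / t := by
      rw [norm_smul, norm_inv, Real.norm_of_nonneg ht.le]; field_simp
    by_cases h : ‖z‖ < t
    · rw [pk_one h, pk_one (by rw [hn, div_lt_one ht]; exact h), hn]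
      rw [inv_div]; rfl
    · have h3 : ¬ ‖t⁻¹ • z‖ < 1 := by rw [hn, div_lt_one ht]; exact h
      unfold pk
      rw [Set.indicator_of_notMem (s := Set.Iio (1:ℝ)) h3, Set.indicator_of_notMem (s := Set.Iio t) h,
        mul_zero]
  simp only [h2] at h1
  rw [integral_const_mul] at h1
  have h3 : |(t⁻¹ ^ 2)⁻¹| = t ^ 2 := by
    rw [abs_of_nonneg (by positivity)]; field_simp
  rw [h3, smul_eq_mul] at h1
  have h4 : t * kerC 1 t = t * (t * kerC 1 1) := by
    unfold kerC; rw [h1]; ring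
  exact mul_left_cancel₀ ht.ne' h4

namespace Sol
variable (S : Sol)

lemma logF_le {c : ℂ} {t A : ℝ} (ht : 0 < t) (hA : ∀ y ∈ ball c t, S.F y ≤ A) :
    ∫ y in ball c t, Real.log (t / ‖y - c‖) * S.F y ≤ A * t ^ 2 * kerC 1 1 := by
  have hA0 : 0 ≤ A := (S.F_nonneg c).trans (hA c (mem_ball_self ht))
  have e1 : A * t ^ 2 * kerC 1 1 = ∫ y, t * A * pk 1 t (y - c) := by
    rw [integral_const_mul, pk_sub_integral', kerC_scale ht]; ring
  rw [e1, ← integral_indicator measurableSet_ball]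
  refine integral_mono (S.logF_int c ht) ((pk_sub_integrable' one_pos t c).const_mul (t * A))
    fun y => ?_
  simp only
  by_cases hy : y ∈ ball c t
  · rw [Set.indicator_of_mem hy]
    have hy' := hy
    rw [mem_ball, dist_eq_norm] at hy'
    rw [pk_one hy']
    have h1 : Real.log (t / ‖y - c‖) ≤ t / ‖y - c‖ :=
      Real.log_le_self (div_nonneg ht.le (norm_nonneg _))
    calc _ ≤ t / ‖y - c‖ * A := mul_le_mul h1 (hA y hy) (S.F_nonneg y)
          (div_nonneg ht.le (norm_nonneg _))
      _ = _ := by rw [div_eq_mul_inv]; ring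
  · rw [Set.indicator_of_notMem hy]
    exact mul_nonneg (mul_nonneg ht.le hA0) (pk_nonneg _ _ _)

lemma Lp_le {c : ℂ} {t A : ℝ} (ht : 0 < t) (hA : ∀ y ∈ ball c t, S.F y ≤ A) :
    S.Lp c t ≤ A * t ^ 2 * kerC 1 1 := by
  have h := S.logF_le ht hA
  have h0 : 0 ≤ ∫ y in ball c t, Real.log (t / ‖y - c‖) * S.F y :=
    setIntegral_nonneg measurableSet_ball fun y hy =>
      mul_nonneg (log_ball_nonneg hy) (S.F_nonneg y)
  unfold Lp
  have hπ : (2 * π)⁻¹ ≤ 1 := inv_le_one_of_one_le₀ (by nlinarith [Real.pi_gt_three])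
  nlinarith

lemma N_up {x : ℂ} (hx : x ∈ closure S.Ω) {t r A : ℝ} (ht : 0 < t) (htr : t ≤ r) (hr : r ≤ S.D)
    (hA : ∀ y ∈ ball x t, S.F y ≤ A) :
    2 * π * S.N x ≤ S.ms (ball x r) * Real.log (S.D / t) + A * t ^ 2 * kerC 1 1
      + S.M * Real.log (S.D / r) := by
  have hr0 : 0 < r := ht.trans_le htr
  have hD := S.hD0
  have l1 : 0 ≤ Real.log (S.D / r) := Real.log_nonneg (by rw [one_le_div hr0]; exact hr)
  have l2 : 0 ≤ Real.log (S.D / t) := Real.log_nonneg (by rw [one_le_div ht]; exact htr.trans hr)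
  have e0 : 2 * π * S.N x = ∫ y, S.ell (x - y) * S.F y := by
    unfold N; rw [← mul_assoc, mul_inv_cancel₀ (by positivity), one_mul]
  have i1 : Integrable (fun y => (ball x r).indicator S.F y * Real.log (S.D / t)) :=
    (S.F_int.indicator measurableSet_ball).mul_const _
  have i2 := S.logF_int x ht
  have i3 : Integrable (fun y => S.F y * Real.log (S.D / r)) := S.F_int.mul_const _
  have i12 : Integrable (fun y => (ball x r).indicator S.F y * Real.log (S.D / t)
    + (ball x t).indicator (fun y => Real.log (t / ‖y - x‖) * S.F y) y) := i1.add i2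
  have e1 : ∫ y, ((ball x r).indicator S.F y * Real.log (S.D / t)
      + (ball x t).indicator (fun y => Real.log (t / ‖y - x‖) * S.F y) y
      + S.F y * Real.log (S.D / r)) = S.ms (ball x r) * Real.log (S.D / t)
      + (∫ y in ball x t, Real.log (t / ‖y - x‖) * S.F y) + S.M * Real.log (S.D / r) := by
    rw [integral_add i12 i3, integral_add i1 i2, integral_mul_const, integral_mul_const,
      integral_indicator measurableSet_ball, integral_indicator measurableSet_ball]
    rfl
  have h2 : 2 * π * S.N x ≤ ∫ y, ((ball x r).indicator S.F y * Real.log (S.D / t)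
      + (ball x t).indicator (fun y => Real.log (t / ‖y - x‖) * S.F y) y
      + S.F y * Real.log (S.D / r)) := by
    rw [e0]
    refine integral_mono (S.ellF_int hx) (i12.add i3) fun y => ?_
    simp only
    have hF := S.F_nonneg y
    unfold ell
    rw [norm_sub_rev]
    by_cases hyr : y ∈ ball x r
    · rw [Set.indicator_of_mem hyr]
      by_cases hyt : y ∈ ball x t
      · rw [Set.indicator_of_mem hyt]
        rcases eq_or_ne (‖y - x‖) 0 with h | h
        · rw [h]; simp only [div_zero, Real.log_zero, zero_mul, add_zero]; positivity
        · have hp : 0 < ‖y - x‖ := lt_of_le_of_ne (norm_nonneg _) h.symm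
          have : Real.log (S.D / ‖y - x‖) = Real.log (S.D / t) + Real.log (t / ‖y - x‖) := by
            rw [← Real.log_mul (by positivity) (by positivity)]
            congr 1; field_simp
          rw [this]
          nlinarith [mul_nonneg hF l1]
      · rw [Set.indicator_of_notMem hyt]
        rw [mem_ball, dist_eq_norm, not_lt] at hyt
        have : Real.log (S.D / ‖y - x‖) ≤ Real.log (S.D / t) :=
          Real.log_le_log (div_pos hD (ht.trans_le hyt)) (div_le_div_of_nonneg_left hD.le ht hyt)
        nlinarith [mul_nonneg hF l1, mul_le_mul_of_nonneg_right this hF]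
    · rw [Set.indicator_of_notMem hyr, Set.indicator_of_notMem
        (fun h => hyr (ball_subset_ball htr h))]
      rw [mem_ball, dist_eq_norm, not_lt] at hyr
      have : Real.log (S.D / ‖y - x‖) ≤ Real.log (S.D / r) :=
          Real.log_le_log (div_pos hD (hr0.trans_le hyr)) (div_le_div_of_nonneg_left hD.le hr0 hyr)
      nlinarith [mul_le_mul_of_nonneg_right this hF]
  have h3 := S.logF_le ht hA
  linarith

lemma avg_cont {c : ℂ} {r : ℝ} (hr : 0 < r) (hb : closedBall c r ⊆ S.Ω) :
    ContinuousOn (fun t => circleAverage S.v c t) (Set.Icc 0 r) := by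
  have hcl : ∀ t, max 0 (min t r) ∈ Set.Icc 0 r := fun t =>
    ⟨le_max_left _ _, max_le hr.le (min_le_right _ _)⟩
  have h1 : Continuous (fun p : ℝ × ℝ => S.v (circleMap c (max 0 (min p.1 r)) p.2)) := by
    refine S.hvc.comp_continuous (by unfold circleMap; fun_prop) fun p => ?_
    refine subset_closure (hb ?_)
    have := hcl p.1
    rw [mem_closedBall, dist_eq_norm, circleMap_sub_center, norm_circleMap_zero,
      abs_of_nonneg this.1]
    exact this.2
  have h2 : Continuous (fun t => ∫ θ in (0:ℝ)..2 * π, S.v (circleMap c (max 0 (min t r)) θ)) :=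
    intervalIntegral.continuous_parametric_intervalIntegral_of_continuous' (by exact h1) 0 (2 * π)
  refine (h2.const_smul (2 * π)⁻¹).continuousOn.congr fun t ht => ?_
  unfold circleAverage
  rw [Pi.smul_apply]
  rw [min_eq_left ht.2, max_eq_right ht.1]

lemma ms_lower {c : ℂ} {r A vm : ℝ} (hr : 0 < r) (hb : closedBall c r ⊆ S.Ω)
    (hA : ∀ y ∈ ball c r, S.F y ≤ A) (hAr : A * r ^ 2 * kerC 1 1 ≤ 1 / 2) (hvm : 0 < vm)
    (hV : ∀ y ∈ S.Ω, vm ≤ S.V y) :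
    S.lam * vm * Real.exp (S.v c) * (π * r ^ 2 / 2) ≤ S.ms (ball c r) := by
  have hA0 : 0 ≤ A := (S.F_nonneg c).trans (hA c (mem_ball_self hr))
  have hbb : ball c r ⊆ S.Ω := ball_subset_closedBall.trans hb
  set g : ℂ → ℝ := fun y => 1 + S.v y - S.v c with hg
  have hgc : ContinuousOn g (closedBall c r) := by
    refine (continuousOn_const.add (S.hvc.mono (hb.trans subset_closure))).sub continuousOn_const
  have him : Measurable ((ball c r).indicator (fun y => (fun _ => (1:ℝ)) ‖y - c‖ * g y)) := by
    classical
    simp only [one_mul]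
    rw [← Set.piecewise_eq_indicator]
    exact (hgc.mono ball_subset_closedBall).measurable_piecewise continuousOn_const measurableSet_ball
  have hgi : IntegrableOn g (ball c r) :=
    (hgc.integrableOn_compact (isCompact_closedBall c r)).mono_set ball_subset_closedBall
  have hii : Integrable ((ball c r).indicator (fun y => (fun _ => (1:ℝ)) ‖y - c‖ * g y)) := by
    simp only [one_mul]
    exact (integrable_indicator_iff measurableSet_ball).2 hgi
  have h1 := polar_ball (g := g) c hr (fun _ => 1) him hii
  simp only [one_mul] at h1
  have hcirc : ∀ t ∈ Set.Ioc 0 r, circleAverage g c t = 1 + circleAverage S.v c t - S.v c := by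
    intro t ht
    have hci := S.circle_int S.hvc ht.1 ((closedBall_subset_closedBall ht.2).trans hb)
    have e1 : g = fun y => (1 - S.v c) + S.v y := by funext y; simp only [hg]; ring
    rw [e1, circleAverage_fun_add (circleIntegrable_const _ _ _) hci, circleAverage_const]
    ring
  have hlow : ∀ t ∈ Set.Ioc 0 r, 1 / 2 ≤ 1 + circleAverage S.v c t - S.v c := by
    intro t ht
    have h2 := S.v_mean ht.1 ((closedBall_subset_closedBall ht.2).trans hb)
    have h3 := S.Lp_le ht.1 (fun y hy => hA y (ball_subset_ball ht.2 hy))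
    have h4 : A * t ^ 2 * kerC 1 1 ≤ A * r ^ 2 * kerC 1 1 := by
      have := kerC_nonneg 1 1
      have := ht.1.le
      have := ht.2
      gcongr
    linarith
  have h5 : π * r ^ 2 / 2 ≤ ∫ y in ball c r, g y := by
    rw [h1]
    have e2 : ∫ t in (0:ℝ)..r, t * (2 * π * circleAverage g c t)
        = ∫ t in (0:ℝ)..r, t * (2 * π * (1 + circleAverage S.v c t - S.v c)) := by
      rw [intervalIntegral.integral_of_le hr.le, intervalIntegral.integral_of_le hr.le]
      refine setIntegral_congr_fun measurableSet_Ioc fun t ht => ?_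
      rw [hcirc t ht]
    have e3 : π * r ^ 2 / 2 = ∫ t in (0:ℝ)..r, t * π := by
      rw [intervalIntegral.integral_mul_const, integral_id]; ring
    rw [e2, e3]
    refine intervalIntegral.integral_mono_on_of_le_Ioo hr.le ?_ ?_ fun t ht => ?_
    · exact (continuous_id.mul continuous_const).intervalIntegrable _ _
    · refine ContinuousOn.intervalIntegrable ?_
      rw [Set.uIcc_of_le hr.le]
      exact continuousOn_id.mul (continuousOn_const.mul
        ((continuousOn_const.add (S.avg_cont hr hb)).sub continuousOn_const))
    · have := hlow t ⟨ht.1, ht.2.le⟩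
      have hpi := Real.pi_pos
      refine mul_le_mul_of_nonneg_left ?_ ht.1.le
      nlinarith
  have hc0 : 0 ≤ S.lam * vm * Real.exp (S.v c) := by have := S.hlam; positivity
  calc _ ≤ S.lam * vm * Real.exp (S.v c) * ∫ y in ball c r, g y :=
        mul_le_mul_of_nonneg_left h5 hc0
    _ = ∫ y in ball c r, S.lam * vm * Real.exp (S.v c) * g y := by rw [integral_const_mul]
    _ ≤ _ := by
      refine setIntegral_mono_on (hgi.const_mul _) S.F_int.integrableOn measurableSet_ball
        fun y hy => ?_
      rw [S.F_eq (hbb hy)]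
      unfold f
      have h6 : Real.exp (S.v c) * g y ≤ Real.exp (S.v y) := by
        have : S.v y = S.v c + (S.v y - S.v c) := by ring
        rw [this, Real.exp_add]
        refine mul_le_mul_of_nonneg_left ?_ (Real.exp_pos _).le
        have := Real.add_one_le_exp (S.v y - S.v c)
        simp only [hg]; linarith
      have h7 := hV y (hbb hy)
      have hl := S.hlam
      calc _ = S.lam * vm * (Real.exp (S.v c) * g y) := by ring
        _ ≤ S.lam * vm * Real.exp (S.v y) := mul_le_mul_of_nonneg_left h6 (by positivity)
        _ ≤ _ := by gcongr

end Sol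
end LG

namespace LG

lemma ker_split {a b p : ℝ} (ha : 0 < a) (hb : 0 < b) (hp : 0 < p) (hp1 : p ≤ 1) :
    a ^ (-2 + 2 * p) * b ^ (-p) ≤ a ^ (p - 2) + b ^ (p - 2) := by
  rcases le_total a b with h | h
  · have h1 : b ^ (-p) ≤ a ^ (-p) := Real.rpow_le_rpow_of_nonpos ha h (by linarith)
    calc _ ≤ a ^ (-2 + 2 * p) * a ^ (-p) := mul_le_mul_of_nonneg_left h1 (by positivity)
      _ = a ^ (p - 2) := by rw [← Real.rpow_add ha]; congr 1; ring
      _ ≤ _ := by have : 0 ≤ b ^ (p - 2) := by positivity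
                  linarith
  · have h1 : a ^ (-2 + 2 * p) ≤ b ^ (-2 + 2 * p) := Real.rpow_le_rpow_of_nonpos hb h (by linarith)
    calc _ ≤ b ^ (-2 + 2 * p) * b ^ (-p) := mul_le_mul_of_nonneg_right h1 (by positivity)
      _ = b ^ (p - 2) := by rw [← Real.rpow_add hb]; congr 1; ring
      _ ≤ _ := by have : 0 ≤ a ^ (p - 2) := by positivity
                  linarith

namespace Sol
variable (S : Sol)

lemma pkF_int {q : ℝ} (hq : 0 < q) (x : ℂ) : Integrable (fun y => pk q S.D (x - y) * S.F y) := by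
  obtain ⟨B, hB, hFB⟩ := S.F_bdd
  refine (pk_sub_integrable hq S.D x).mul_bdd (c := B) S.F_meas.aestronglyMeasurable
    (Eventually.of_forall fun y => ?_)
  rw [Real.norm_of_nonneg (S.F_nonneg y)]; exact hFB y

lemma ae_ne (x : ℂ) : ∀ᵐ y : ℂ, y ≠ x := by
  rw [ae_iff]; simp

lemma exp_jensen {x : ℂ} (hx : x ∈ closure S.Ω) {A : Set ℂ} (hA : MeasurableSet A) {p : ℝ}
    (hp : 0 < p) (hp1 : p ≤ 1) (hμ : S.ms A ≤ 2 * π * p) :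
    Real.exp ((2 * π)⁻¹ * ∫ y in A, S.ell (x - y) * S.F y)
      ≤ 1 + (2 * π * p)⁻¹ * ∫ y in A, S.D ^ p * (pk (2 - p) S.D (x - y) * S.F y) := by
  set m := (2 * π)⁻¹ * ∫ y in A, S.ell (x - y) * S.F y with hm
  have hpi := Real.pi_pos
  have hm0 : 0 ≤ m := mul_nonneg (by positivity) (integral_nonneg fun y => S.ellF_nonneg hx y)
  have hI : ∫ y in A, S.ell (x - y) * S.F y = 2 * π * m := by
    rw [hm, ← mul_assoc, mul_inv_cancel₀ (by positivity), one_mul]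
  have i1 : IntegrableOn (fun y => S.D ^ p * (pk (2 - p) S.D (x - y) * S.F y)) A :=
    ((S.pkF_int (by linarith) x).const_mul _).integrableOn
  have i2 : IntegrableOn (fun y => (1 - m) * S.F y) A := (S.F_int.const_mul _).integrableOn
  have i3 : IntegrableOn (fun y => p * (S.ell (x - y) * S.F y)) A :=
    ((S.ellF_int hx).const_mul _).integrableOn
  have i23 : IntegrableOn (fun y => (1 - m) * S.F y + p * (S.ell (x - y) * S.F y)) A := i2.add i3
  have h1 : Real.exp m * ((1 - m) * S.ms A + p * (2 * π * m))
      ≤ ∫ y in A, S.D ^ p * (pk (2 - p) S.D (x - y) * S.F y) := by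
    have e1 : Real.exp m * ((1 - m) * S.ms A + p * (2 * π * m))
        = ∫ y in A, Real.exp m * ((1 - m) * S.F y + p * (S.ell (x - y) * S.F y)) := by
      rw [integral_const_mul, integral_add i2 i3, integral_const_mul, integral_const_mul, hI]; rfl
    rw [e1]
    refine integral_mono_ae (i23.const_mul _) i1 (ae_restrict_of_ae ?_)
    filter_upwards [ae_ne x] with y hy
    by_cases hyΩ : y ∈ S.Ω
    · have hd := S.dist_lt hx hyΩ
      have hpos : 0 < ‖x - y‖ := norm_pos_iff.2 (sub_ne_zero.2 hy.symm)
      have hF := S.F_nonneg y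
      rw [pk_eq hd]
      have e2 : S.D ^ p * ‖x - y‖ ^ (2 - p - 2) = Real.exp (p * S.ell (x - y)) := by
        unfold ell
        rw [mul_comm p, Real.exp_mul, Real.exp_log (div_pos S.hD0 hpos),
          Real.div_rpow S.hD0.le hpos.le, div_eq_mul_inv, ← Real.rpow_neg hpos.le]
        congr 2; ring
      rw [← mul_assoc (S.D ^ p), e2]
      have e3 : Real.exp (p * S.ell (x - y)) = Real.exp m * Real.exp (p * S.ell (x - y) - m) := by
        rw [← Real.exp_add]; congr 1; ring
      have e4 := Real.add_one_le_exp (p * S.ell (x - y) - m)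
      rw [e3]
      calc _ = Real.exp m * ((p * S.ell (x - y) - m + 1) * S.F y) := by ring
        _ ≤ Real.exp m * (Real.exp (p * S.ell (x - y) - m) * S.F y) := by gcongr
        _ = _ := by ring
    · rw [S.F_zero hyΩ]; simp
  have hμ0 := S.ms_nonneg A
  have h2p : 0 < 2 * π * p := by positivity
  set I := ∫ y in A, S.D ^ p * (pk (2 - p) S.D (x - y) * S.F y)
  set θ := (2 * π * p)⁻¹ * S.ms A with hθ
  have hθ0 : 0 ≤ θ := by positivity
  have hθ1 : θ ≤ 1 := by rw [hθ, inv_mul_le_iff₀ h2p]; linarith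
  have h2 : Real.exp m * ((1 - m) * θ + m) ≤ (2 * π * p)⁻¹ * I := by
    calc _ = (2 * π * p)⁻¹ * (Real.exp m * ((1 - m) * S.ms A + p * (2 * π * m))) := by
          rw [hθ]; field_simp
      _ ≤ _ := mul_le_mul_of_nonneg_left h1 (by positivity)
  have hE := Real.exp_pos m
  have h3 : Real.exp m * (1 - m) ≤ 1 := by
    have := Real.add_one_le_exp (-m)
    calc Real.exp m * (1 - m) ≤ Real.exp m * Real.exp (-m) := by gcongr; linarith
      _ = 1 := by rw [← Real.exp_add]; simp
  rcases le_total m 1 with h | h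
  · have : 0 ≤ Real.exp m * ((1 - m) * θ) :=
      mul_nonneg hE.le (mul_nonneg (by linarith) hθ0)
    nlinarith
  · have : 0 ≤ Real.exp m * ((m - 1) * (1 - θ)) :=
      mul_nonneg hE.le (mul_nonneg (by linarith) (by linarith))
    nlinarith

/-- upper bound of the potential away from the core -/
lemma N_split {c x : ℂ} {l g r : ℝ} (hg : 0 < g) (hgD : g ≤ S.D)
    (hx : x ∈ closure S.Ω) (hxr : ‖x - c‖ + g ≤ r) (hxl : 2 * l ≤ ‖x - c‖) (hx0 : 0 < ‖x - c‖)
    (hxD : ‖x - c‖ < S.D) :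
    2 * π * S.N x ≤ S.ms (ball c l) * Real.log (2 * S.D / ‖x - c‖)
      + (∫ y in ball c r \ ball c l, S.ell (x - y) * S.F y) + S.M * Real.log (S.D / g) := by
  have hD := S.hD0
  have hAm : MeasurableSet (ball c r \ ball c l) := measurableSet_ball.diff measurableSet_ball
  have l1 : 0 ≤ Real.log (S.D / g) := Real.log_nonneg (by rw [one_le_div hg]; exact hgD)
  have l2 : 0 ≤ Real.log (2 * S.D / ‖x - c‖) :=
    Real.log_nonneg (by rw [one_le_div hx0]; linarith)
  have e0 : 2 * π * S.N x = ∫ y, S.ell (x - y) * S.F y := by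
    unfold N; rw [← mul_assoc, mul_inv_cancel₀ (by positivity), one_mul]
  have i1 : Integrable (fun y => (ball c l).indicator S.F y * Real.log (2 * S.D / ‖x - c‖)) :=
    (S.F_int.indicator measurableSet_ball).mul_const _
  have i2 : Integrable ((ball c r \ ball c l).indicator (fun y => S.ell (x - y) * S.F y)) :=
    (S.ellF_int hx).indicator hAm
  have i3 : Integrable (fun y => S.F y * Real.log (S.D / g)) := S.F_int.mul_const _
  have i12 : Integrable (fun y => (ball c l).indicator S.F y * Real.log (2 * S.D / ‖x - c‖)
    + (ball c r \ ball c l).indicator (fun y => S.ell (x - y) * S.F y) y) := i1.add i2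
  have e1 : ∫ y, ((ball c l).indicator S.F y * Real.log (2 * S.D / ‖x - c‖)
      + (ball c r \ ball c l).indicator (fun y => S.ell (x - y) * S.F y) y
      + S.F y * Real.log (S.D / g)) = S.ms (ball c l) * Real.log (2 * S.D / ‖x - c‖)
      + (∫ y in ball c r \ ball c l, S.ell (x - y) * S.F y) + S.M * Real.log (S.D / g) := by
    rw [integral_add i12 i3, integral_add i1 i2, integral_mul_const, integral_mul_const,
      integral_indicator measurableSet_ball, integral_indicator hAm]
    rfl
  rw [← e1, e0]
  refine integral_mono (S.ellF_int hx) (i12.add i3) fun y => ?_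
  simp only
  have hF := S.F_nonneg y
  have hEF := S.ellF_nonneg hx y
  have n1 := mul_nonneg hF l1
  by_cases hyl : y ∈ ball c l
  · rw [Set.indicator_of_mem hyl, Set.indicator_of_notMem (fun h => h.2 hyl)]
    rw [mem_ball, dist_eq_norm] at hyl
    have htri : ‖x - c‖ ≤ ‖x - y‖ + ‖y - c‖ := norm_sub_le_norm_sub_add_norm_sub x y c
    have hxy : ‖x - c‖ / 2 ≤ ‖x - y‖ := by linarith
    have : S.ell (x - y) ≤ Real.log (2 * S.D / ‖x - c‖) := by
      unfold ell
      refine Real.log_le_log (div_pos hD (by linarith)) ?_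
      rw [div_le_div_iff₀ (by linarith) hx0]
      nlinarith
    nlinarith [mul_le_mul_of_nonneg_right this hF]
  · rw [Set.indicator_of_notMem hyl]
    by_cases hyr : y ∈ ball c r
    · rw [Set.indicator_of_mem (show y ∈ ball c r \ ball c l from ⟨hyr, hyl⟩)]
      linarith
    · rw [Set.indicator_of_notMem (fun h => hyr h.1)]
      rw [mem_ball, dist_eq_norm, not_lt] at hyr
      have htri : ‖y - c‖ ≤ ‖x - y‖ + ‖x - c‖ := by
        rw [norm_sub_rev x y]; exact norm_sub_le_norm_sub_add_norm_sub y x c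
      have : S.ell (x - y) ≤ Real.log (S.D / g) := by
        unfold ell
        exact Real.log_le_log (div_pos hD (by linarith))
          (div_le_div_of_nonneg_left hD.le hg (by linarith))
      nlinarith [mul_le_mul_of_nonneg_right this hF]

end Sol
end LG

namespace LG
namespace Sol
variable (S : Sol)

/-- potential of the mass in `A` with respect to a power kernel -/
def cv (p : ℝ) (A : Set ℂ) (x : ℂ) : ℝ := ∫ y in A, pk p S.D (x - y) * S.F y

lemma cv_eq (p : ℝ) {A : Set ℂ} (hA : MeasurableSet A) :
    S.cv p A = convolution (A.indicator S.F) (pk p S.D) (ContinuousLinearMap.mul ℝ ℝ) volume := by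
  ext x
  rw [convolution_def]
  unfold cv
  rw [← integral_indicator hA]
  refine integral_congr_ae (Eventually.of_forall fun y => ?_)
  by_cases hy : y ∈ A
  · simp [hy, mul_comm]
  · simp [hy]

lemma cv_int {p : ℝ} (hp : 0 < p) {A : Set ℂ} (hA : MeasurableSet A) : Integrable (S.cv p A) := by
  rw [S.cv_eq p hA]
  exact (S.F_int.indicator hA).integrable_convolution _ (pk_integrable hp S.D)

lemma cv_integral {p : ℝ} (hp : 0 < p) {A : Set ℂ} (hA : MeasurableSet A) :
    ∫ x, S.cv p A x = S.ms A * kerC p S.D := by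
  rw [S.cv_eq p hA, integral_convolution _ (S.F_int.indicator hA) (pk_integrable hp S.D),
    integral_indicator hA]
  rfl

lemma cv_nonneg (p : ℝ) (A : Set ℂ) (x : ℂ) : 0 ≤ S.cv p A x :=
  integral_nonneg fun y => mul_nonneg (pk_nonneg _ _ _) (S.F_nonneg y)

lemma cv_split {p : ℝ} (hp : 0 < p) (hp1 : p ≤ 1) (A : Set ℂ) {x c : ℂ} (hx : x ∈ closure S.Ω)
    (h0 : 0 < ‖x - c‖) (hD : ‖x - c‖ < S.D) :
    ‖x - c‖ ^ (-2 + 2 * p) * S.cv (2 - p) A x ≤ pk p S.D (x - c) * S.ms A + S.cv p A x := by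
  unfold cv ms
  rw [← integral_const_mul, ← integral_const_mul]
  have i1 : IntegrableOn (fun y => pk p S.D (x - c) * S.F y) A := (S.F_int.const_mul _).integrableOn
  have i2 : IntegrableOn (fun y => pk p S.D (x - y) * S.F y) A := (S.pkF_int hp x).integrableOn
  rw [← integral_add i1 i2]
  refine integral_mono_ae (((S.pkF_int (by linarith) x).const_mul _).integrableOn) (i1.add i2)
    (ae_restrict_of_ae ?_)
  filter_upwards [ae_ne x] with y hy
  by_cases hyΩ : y ∈ S.Ω
  · have hd := S.dist_lt hx hyΩ
    have hpos : 0 < ‖x - y‖ := norm_pos_iff.2 (sub_ne_zero.2 hy.symm)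
    have hF := S.F_nonneg y
    have := ker_split h0 hpos hp hp1
    rw [pk_eq hd, pk_eq hd, pk_eq hD, show 2 - p - 2 = -p by ring]
    calc _ = (‖x - c‖ ^ (-2 + 2 * p) * ‖x - y‖ ^ (-p)) * S.F y := by ring
      _ ≤ (‖x - c‖ ^ (p - 2) + ‖x - y‖ ^ (p - 2)) * S.F y := by gcongr
      _ = _ := by ring
  · simp [S.F_zero hyΩ]

lemma pointwise_ann {c x : ℂ} {l g r2 ρ p vM : ℝ} (hp : 0 < p) (hp1 : p ≤ 1)
    (hg : 0 < g) (hgD : g ≤ S.D) (hc : c ∈ S.Ω)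
    (hx : x ∈ S.Ω) (hxr : ‖x - c‖ + g ≤ r2) (hρ : 0 < ρ) (hl : 2 * l ≤ ρ) (hxρ : ρ ≤ ‖x - c‖)
    (hA : S.ms (ball c r2 \ ball c l) ≤ 2 * π * p) (hB : S.ms (ball c l) ≤ 8 * π + 2 * π * p)
    (hvM : ∀ y ∈ S.Ω, S.V y ≤ vM) :
    ‖x - c‖ * S.F x ≤ (vM * (2 * S.D) ^ (4 + p) * Real.exp (S.M * Real.log (S.D / g)) * S.D ^ p)
      * S.lam * ρ ^ (-1 - 3 * p)
      * (2 * pk p S.D (x - c) + (2 * π * p)⁻¹ * S.cv p (ball c r2 \ ball c l) x) := by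
  have hpi := Real.pi_pos
  have hD := S.hD0
  set a := ‖x - c‖ with ha
  set A := ball c r2 \ ball c l with hAdef
  have ha0 : 0 < a := lt_of_lt_of_le hρ hxρ
  have haD : a < S.D := S.hD x (subset_closure hx) c (subset_closure hc)
  have hxc := subset_closure hx
  have hAm : MeasurableSet A := measurableSet_ball.diff measurableSet_ball
  have hN := S.N_split (c := c) (l := l) (r := r2) hg hgD hxc hxr (by linarith) ha0 haD
  have hJ := S.exp_jensen hxc hAm hp hp1 hA
  have hVpos := S.hVpos x hxc
  have hv := S.v_le_N hxc
  have hvM0 : 0 < vM := hVpos.trans_le (hvM x hx)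
  have l1 : 0 ≤ Real.log (S.D / g) := Real.log_nonneg (by rw [one_le_div hg]; exact hgD)
  have l2 : 0 ≤ Real.log (2 * S.D / a) := Real.log_nonneg (by rw [one_le_div ha0]; linarith)
  set J := ∫ y in A, S.ell (x - y) * S.F y with hJd
  set P := ∫ y in A, S.D ^ p * (pk (2 - p) S.D (x - y) * S.F y) with hPd
  have hP : P = S.D ^ p * S.cv (2 - p) A x := by
    rw [hPd, integral_const_mul]; rfl
  have hNle : S.N x ≤ Real.log (2 * S.D / a) * (4 + p) + S.M * Real.log (S.D / g) + (2 * π)⁻¹ * J := by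
    have h1 : S.ms (ball c l) * Real.log (2 * S.D / a) ≤ (8 * π + 2 * π * p) * Real.log (2 * S.D / a) :=
      mul_le_mul_of_nonneg_right hB l2
    have h2 : 0 ≤ S.M * Real.log (S.D / g) := mul_nonneg S.M_nonneg l1
    have h3 : S.M * Real.log (S.D / g) ≤ 2 * π * (S.M * Real.log (S.D / g)) := by
      nlinarith [Real.pi_gt_three]
    have h4 : 2 * π * S.N x ≤ 2 * π * (Real.log (2 * S.D / a) * (4 + p) + S.M * Real.log (S.D / g) + (2 * π)⁻¹ * J) := by
      have : 2 * π * ((2 * π)⁻¹ * J) = J := by field_simp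
      rw [mul_add, this]
      linarith
    exact le_of_mul_le_mul_left h4 (by positivity)
  have hexp : Real.exp (S.v x) ≤ (2 * S.D / a) ^ (4 + p) * Real.exp (S.M * Real.log (S.D / g))
      * (1 + (2 * π * p)⁻¹ * P) := by
    calc Real.exp (S.v x) ≤ Real.exp (Real.log (2 * S.D / a) * (4 + p) + S.M * Real.log (S.D / g) + (2 * π)⁻¹ * J) :=
          Real.exp_le_exp.2 (hv.trans hNle)
      _ = (2 * S.D / a) ^ (4 + p) * Real.exp (S.M * Real.log (S.D / g)) * Real.exp ((2 * π)⁻¹ * J) := by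
          rw [Real.exp_add, Real.exp_add, Real.exp_mul, Real.exp_log (by positivity)]
      _ ≤ _ := by gcongr
  have hpow : a * (2 * S.D / a) ^ (4 + p) ≤ (2 * S.D) ^ (4 + p) * ρ ^ (-1 - 3 * p) * a ^ (-2 + 2 * p) := by
    have e : a * (2 * S.D / a) ^ (4 + p) = (2 * S.D) ^ (4 + p) * a ^ (-1 - 3 * p) * a ^ (-2 + 2 * p) := by
      rw [Real.div_rpow (by positivity) ha0.le, mul_assoc, ← Real.rpow_add ha0, div_eq_mul_inv,
        ← Real.rpow_neg ha0.le, show -1 - 3 * p + (-2 + 2 * p) = 1 + -(4 + p) by ring,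
        Real.rpow_add ha0, Real.rpow_one]
      ring
    rw [e]
    have : a ^ (-1 - 3 * p) ≤ ρ ^ (-1 - 3 * p) :=
      Real.rpow_le_rpow_of_nonpos hρ hxρ (by linarith)
    gcongr
  have hk : a ^ (-2 + 2 * p) ≤ S.D ^ p * pk p S.D (x - c) := by
    rw [pk_eq haD, show -2 + 2 * p = p + (p - 2) by ring, Real.rpow_add ha0]
    have : a ^ p ≤ S.D ^ p := Real.rpow_le_rpow ha0.le haD.le hp.le
    gcongr
  have hs := S.cv_split hp hp1 A hxc ha0 haD
  have hpk := pk_nonneg p S.D (x - c)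
  have hP0 : 0 ≤ P := by rw [hP]; exact mul_nonneg (by positivity) (S.cv_nonneg _ _ _)
  have hfin : a ^ (-2 + 2 * p) * (1 + (2 * π * p)⁻¹ * P) ≤
      S.D ^ p * (2 * pk p S.D (x - c) + (2 * π * p)⁻¹ * S.cv p A x) := by
    have h5 : (2 * π * p)⁻¹ * S.ms A ≤ 1 := by rw [inv_mul_le_iff₀ (by positivity)]; linarith
    have h6 : pk p S.D (x - c) * ((2 * π * p)⁻¹ * S.ms A) ≤ pk p S.D (x - c) * 1 :=
      mul_le_mul_of_nonneg_left h5 hpk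
    have hq : 0 ≤ (2 * π * p)⁻¹ := by positivity
    have hDp : 0 ≤ S.D ^ p := by positivity
    rw [hP]
    calc _ = a ^ (-2 + 2 * p) + S.D ^ p * ((2 * π * p)⁻¹ * (a ^ (-2 + 2 * p) * S.cv (2 - p) A x)) := by ring
      _ ≤ S.D ^ p * pk p S.D (x - c) + S.D ^ p * ((2 * π * p)⁻¹ * (pk p S.D (x - c) * S.ms A + S.cv p A x)) := by
          gcongr
      _ = S.D ^ p * (pk p S.D (x - c) + pk p S.D (x - c) * ((2 * π * p)⁻¹ * S.ms A) + (2 * π * p)⁻¹ * S.cv p A x) := by ring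
      _ ≤ S.D ^ p * (pk p S.D (x - c) + pk p S.D (x - c) * 1 + (2 * π * p)⁻¹ * S.cv p A x) := by gcongr
      _ = _ := by ring
  have hlam := S.hlam
  have hJ0 : 0 ≤ 1 + (2 * π * p)⁻¹ * P := by positivity
  rw [S.F_eq hx]
  unfold f
  have hVx := hvM x hx
  calc a * (S.lam * S.V x * Real.exp (S.v x))
      ≤ a * (S.lam * vM * ((2 * S.D / a) ^ (4 + p) * Real.exp (S.M * Real.log (S.D / g))
      * (1 + (2 * π * p)⁻¹ * P))) := by gcongr
    _ = S.lam * vM * Real.exp (S.M * Real.log (S.D / g)) * (a * (2 * S.D / a) ^ (4 + p)) * (1 + (2 * π * p)⁻¹ * P) := by ring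
    _ ≤ S.lam * vM * Real.exp (S.M * Real.log (S.D / g)) * ((2 * S.D) ^ (4 + p) * ρ ^ (-1 - 3 * p) * a ^ (-2 + 2 * p)) * (1 + (2 * π * p)⁻¹ * P) := by gcongr
    _ = S.lam * vM * Real.exp (S.M * Real.log (S.D / g)) * (2 * S.D) ^ (4 + p) * ρ ^ (-1 - 3 * p) * (a ^ (-2 + 2 * p) * (1 + (2 * π * p)⁻¹ * P)) := by ring
    _ ≤ S.lam * vM * Real.exp (S.M * Real.log (S.D / g)) * (2 * S.D) ^ (4 + p) * ρ ^ (-1 - 3 * p) * (S.D ^ p * (2 * pk p S.D (x - c) + (2 * π * p)⁻¹ * S.cv p A x)) := by gcongr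
    _ = _ := by ring

lemma ann_est {c : ℂ} {l g r1 ρ p vM : ℝ} (hp : 0 < p) (hp1 : p ≤ 1)
    (hg : 0 < g) (hgD : g ≤ S.D) (hc : c ∈ S.Ω)
    (hb : ball c r1 ⊆ S.Ω) (hρ : 0 < ρ) (hl : 2 * l ≤ ρ)
    (hA : S.ms (ball c (r1 + g) \ ball c l) ≤ 2 * π * p) (hB : S.ms (ball c l) ≤ 8 * π + 2 * π * p)
    (hvM : ∀ y ∈ S.Ω, S.V y ≤ vM) :
    S.mo c r1 ≤ ρ * S.M +
      3 * kerC p S.D * (vM * (2 * S.D) ^ (4 + p) * Real.exp (S.M * Real.log (S.D / g)) * S.D ^ p)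
      * S.lam * ρ ^ (-1 - 3 * p) := by
  have hpi := Real.pi_pos
  have hD := S.hD0
  set A := ball c (r1 + g) \ ball c l with hAdef
  have hAm : MeasurableSet A := measurableSet_ball.diff measurableSet_ball
  set C := (vM * (2 * S.D) ^ (4 + p) * Real.exp (S.M * Real.log (S.D / g)) * S.D ^ p)
      * S.lam * ρ ^ (-1 - 3 * p) with hC
  have hvM0 : 0 < vM := (S.hVpos c (subset_closure hc)).trans_le (hvM c hc)
  have hlam := S.hlam
  have hC0 : 0 ≤ C := by rw [hC]; positivity
  have i1 : Integrable (fun x => ρ * S.F x) := S.F_int.const_mul _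
  have i2 : Integrable (fun x => 2 * pk p S.D (x - c)) := (pk_sub_integrable' hp S.D c).const_mul _
  have i3 : Integrable (fun x => (2 * π * p)⁻¹ * S.cv p A x) := (S.cv_int hp hAm).const_mul _
  have i23 : Integrable (fun x => 2 * pk p S.D (x - c) + (2 * π * p)⁻¹ * S.cv p A x) := i2.add i3
  have i4 : Integrable (fun x => C * (2 * pk p S.D (x - c) + (2 * π * p)⁻¹ * S.cv p A x)) := i23.const_mul _
  have i14 : Integrable (fun x => ρ * S.F x + C * (2 * pk p S.D (x - c) + (2 * π * p)⁻¹ * S.cv p A x)) :=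
    i1.add i4
  have hnn : ∀ x, 0 ≤ 2 * pk p S.D (x - c) + (2 * π * p)⁻¹ * S.cv p A x := fun x =>
    add_nonneg (mul_nonneg zero_le_two (pk_nonneg _ _ _)) (mul_nonneg (by positivity) (S.cv_nonneg _ _ _))
  have h1 : S.mo c r1 ≤ ∫ x in ball c r1, (ρ * S.F x + C * (2 * pk p S.D (x - c) + (2 * π * p)⁻¹ * S.cv p A x)) := by
    unfold mo
    refine setIntegral_mono_on (S.mo_int c r1) i14.integrableOn measurableSet_ball fun x hx => ?_
    have hF := S.F_nonneg x
    rcases le_total ‖x - c‖ ρ with h | h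
    · have := mul_le_mul_of_nonneg_right h hF
      have := mul_nonneg hC0 (hnn x)
      linarith
    · have hx' := hx
      rw [mem_ball, dist_eq_norm] at hx'
      have h2 := S.pointwise_ann (r2 := r1 + g) hp hp1 hg hgD hc (hb hx) (by linarith) hρ hl h hA hB hvM
      have h3 : 0 ≤ ρ * S.F x := mul_nonneg hρ.le hF
      linarith
  have h2 : ∫ x in ball c r1, (ρ * S.F x + C * (2 * pk p S.D (x - c) + (2 * π * p)⁻¹ * S.cv p A x))
      ≤ ∫ x, (ρ * S.F x + C * (2 * pk p S.D (x - c) + (2 * π * p)⁻¹ * S.cv p A x)) :=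
    setIntegral_le_integral i14 (Eventually.of_forall fun x =>
      add_nonneg (mul_nonneg hρ.le (S.F_nonneg x)) (mul_nonneg hC0 (hnn x)))
  have h3 : ∫ x, (ρ * S.F x + C * (2 * pk p S.D (x - c) + (2 * π * p)⁻¹ * S.cv p A x))
      = ρ * S.M + C * (2 * kerC p S.D + (2 * π * p)⁻¹ * (S.ms A * kerC p S.D)) := by
    rw [integral_add i1 i4, integral_const_mul, integral_const_mul, integral_add i2 i3,
      integral_const_mul, integral_const_mul, S.cv_integral hp hAm, pk_sub_integral']
    rfl
  have hk := kerC_nonneg p S.D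
  have h5 : (2 * π * p)⁻¹ * S.ms A ≤ 1 := by rw [inv_mul_le_iff₀ (by positivity)]; linarith
  have h6 : (2 * π * p)⁻¹ * (S.ms A * kerC p S.D) ≤ kerC p S.D := by
    rw [← mul_assoc]; exact mul_le_of_le_one_left hk h5
  have h7 : C * (2 * kerC p S.D + (2 * π * p)⁻¹ * (S.ms A * kerC p S.D)) ≤ C * (3 * kerC p S.D) :=
    mul_le_mul_of_nonneg_left (by linarith) hC0
  calc _ ≤ ρ * S.M + C * (3 * kerC p S.D) := by linarith
    _ = _ := by rw [hC]; ring

end Sol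
end LG

namespace LG

namespace Sol
variable (S : Sol)

lemma ms_union {A B : Set ℂ} (hAB : Disjoint A B) (hB : MeasurableSet B) :
    S.ms (A ∪ B) = S.ms A + S.ms B :=
  setIntegral_union hAB hB S.F_int.integrableOn S.F_int.integrableOn

lemma ms_diff {A B : Set ℂ} (hAB : A ⊆ B) (hA : MeasurableSet A) (hB : MeasurableSet B) :
    S.ms (B \ A) = S.ms B - S.ms A := by
  have := S.ms_union (A := A) (B := B \ A) Set.disjoint_sdiff_right (hB.diff hA)
  rw [Set.union_sdiff_cancel hAB] at this
  linarith

end Sol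

/-- A blowing-up sequence of solutions, transported to `ℂ`. -/
structure Seq (m : ℕ) where
  Ω : Set ℂ
  V : ℂ → ℝ
  D : ℝ
  lam : ℕ → ℝ
  v : ℕ → ℂ → ℝ
  xs : Fin m → ℂ
  xp : Fin m → ℕ → ℂ
  R : ℝ
  hopen : IsOpen Ω
  hbd : IsBounded Ω
  hD1 : 1 ≤ D
  hD : ∀ x ∈ closure Ω, ∀ y ∈ closure Ω, ‖x - y‖ < D
  hVpos : ∀ x ∈ closure Ω, 0 < V x
  hVc : ContinuousOn V (closure Ω)
  hV1 : ContDiffOn ℝ 1 V Ω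
  hlam : ∀ k, 0 < lam k
  hv2 : ∀ k, ContDiffOn ℝ 2 (v k) Ω
  hvc : ∀ k, ContinuousOn (v k) (closure Ω)
  hPDE : ∀ k, ∀ x ∈ Ω, fderiv ℝ (fderiv ℝ (v k)) x 1 1
    + fderiv ℝ (fderiv ℝ (v k)) x Complex.I Complex.I = -(lam k * V x * Real.exp (v k x))
  hBC : ∀ k, ∀ x ∈ frontier Ω, v k x = 0
  hR : 0 < R
  hR2 : ∀ j, closedBall (xs j) (2 * R) ⊆ Ω
  hsep : ∀ i j, i ≠ j → 2 * R ≤ ‖xs i - xs j‖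
  hlim : ∀ j, Tendsto (xp j) atTop (𝓝 (xs j))
  hmem : ∀ j k, xp j k ∈ ball (xs j) R
  hmax : ∀ j k, ∀ x ∈ ball (xp j k) R, v k x ≤ v k (xp j k)
  hblow : ∀ j, Tendsto (fun k => v k (xp j k)) atTop atTop
  hlam0 : Tendsto lam atTop (𝓝 0)
  hmass : Tendsto (fun k => ∫ x in Ω, lam k * V x * Real.exp (v k x)) atTop (𝓝 (8 * π * m))

namespace Seq
variable {m : ℕ} (Q : Seq m)

def S (k : ℕ) : Sol where
  Ω := Q.Ω
  V := Q.V
  v := Q.v k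
  lam := Q.lam k
  D := Q.D
  hopen := Q.hopen
  hbd := Q.hbd
  hD1 := Q.hD1
  hD := Q.hD
  hVpos := Q.hVpos
  hVc := Q.hVc
  hV1 := Q.hV1
  hlam := Q.hlam k
  hv2 := Q.hv2 k
  hvc := Q.hvc k
  hPDE := Q.hPDE k
  hBC := Q.hBC k

lemma M_tendsto : Tendsto (fun k => (Q.S k).M) atTop (𝓝 (8 * π * m)) := by
  refine Q.hmass.congr fun k => ?_
  unfold Sol.M Sol.F
  rw [integral_indicator (Q.S k).hopen.measurableSet]
  rfl

lemma exists_Mb : ∃ Mb, 0 < Mb ∧ ∀ k, (Q.S k).M ≤ Mb := by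
  obtain ⟨b, hb⟩ := Q.M_tendsto.bddAbove_range
  exact ⟨max b 1, by positivity, fun k => (hb ⟨k, rfl⟩).trans (le_max_left _ _)⟩

lemma xs_mem (j : Fin m) : Q.xs j ∈ Q.Ω := Q.hR2 j (mem_closedBall_self (by have := Q.hR; positivity))

lemma ball_sub (j : Fin m) (k : ℕ) : ball (Q.xp j k) Q.R ⊆ Q.Ω := by
  refine Set.Subset.trans ?_ (Q.hR2 j)
  intro x hx
  have h1 := Q.hmem j k
  rw [mem_ball] at hx h1
  rw [mem_closedBall]
  have := dist_triangle x (Q.xp j k) (Q.xs j)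
  linarith

lemma xp_mem (j : Fin m) (k : ℕ) : Q.xp j k ∈ Q.Ω := Q.ball_sub j k (mem_ball_self Q.hR)

lemma R_lt_D (j : Fin m) : 2 * Q.R < Q.D := by
  have hR := Q.hR
  have h1 : Q.xs j + ((2 * Q.R : ℝ) : ℂ) ∈ Q.Ω := by
    apply Q.hR2 j
    rw [mem_closedBall, dist_eq_norm, add_sub_cancel_left, Complex.norm_real,
      Real.norm_of_nonneg (by positivity)]
  have h2 := Q.hD _ (subset_closure h1) _ (subset_closure (Q.xs_mem j))
  rwa [add_sub_cancel_left, Complex.norm_real, Real.norm_of_nonneg (by positivity)] at h2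

lemma exists_V (j : Fin m) : ∃ vm vM, 0 < vm ∧ 0 < vM ∧ ∀ y ∈ closure Q.Ω, vm ≤ Q.V y ∧ Q.V y ≤ vM := by
  have hc : IsCompact (closure Q.Ω) := Q.hbd.isCompact_closure
  have hne : (closure Q.Ω).Nonempty := ⟨Q.xs j, subset_closure (Q.xs_mem j)⟩
  obtain ⟨a, ha, hmin⟩ := hc.exists_isMinOn hne Q.hVc
  obtain ⟨b, hb, hmx⟩ := hc.exists_isMaxOn hne Q.hVc
  exact ⟨Q.V a, Q.V b, Q.hVpos a ha, Q.hVpos b hb, fun y hy => ⟨hmin hy, hmx hy⟩⟩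

lemma exists_CV (j : Fin m) : ∃ CV, 0 ≤ CV ∧ ∀ x ∈ closedBall (Q.xs j) (2 * Q.R),
    ‖fderiv ℝ Q.V x‖ / Q.V x ≤ CV := by
  have hc : ContinuousOn (fun x => ‖fderiv ℝ Q.V x‖ / Q.V x) (closedBall (Q.xs j) (2 * Q.R)) := by
    refine ContinuousOn.div ?_ ?_ ?_
    · exact ((Q.hV1.continuousOn_fderiv_of_isOpen Q.hopen le_rfl).mono (Q.hR2 j)).norm
    · exact Q.hVc.mono ((Q.hR2 j).trans subset_closure)
    · exact fun x hx => (Q.hVpos x (subset_closure (Q.hR2 j hx))).ne'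
  obtain ⟨C, hC⟩ := (isCompact_closedBall _ _).exists_bound_of_continuousOn hc
  exact ⟨max C 0, le_max_right _ _, fun x hx =>
    (le_abs_self _).trans ((hC x hx).trans (le_max_left _ _))⟩

lemma near (j : Fin m) {η : ℝ} (hη : 0 < η) : ∀ᶠ k in atTop, ‖Q.xp j k - Q.xs j‖ < η := by
  have := (Metric.tendsto_nhds.1 (Q.hlim j)) η hη
  filter_upwards [this] with k hk
  rwa [dist_eq_norm] at hk

lemma quant (j : Fin m) : ∃ C, 0 < C ∧ ∀ k, ‖Q.xp j k - Q.xs j‖ < Q.R / 8 → ∀ a Λ, 0 < a →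
    a ≤ Q.R / 8 → 2 ≤ Λ →
    |2 * (Q.S k).ms (ball (Q.xp j k) a) - (Q.S k).ms (ball (Q.xp j k) a) ^ 2 / (4 * π)|
      ≤ C * ((Q.S k).ms (ball (Q.xp j k) (Λ * a) \ ball (Q.xp j k) a)
        + (Q.S k).mo (Q.xp j k) a / (Λ * a) + (Q.S k).mo (Q.xp j k) (2 * a)) := by
  obtain ⟨K, hK, hq⟩ := exists_quant
  have hR := Q.hR
  obtain ⟨CH, hCH, hH⟩ := exists_H (ρ := Q.R / 2) (by positivity) Q.D
  obtain ⟨CV, hCV, hV⟩ := Q.exists_CV j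
  obtain ⟨Mb, hMb, hM⟩ := Q.exists_Mb
  refine ⟨K * (1 + Mb) + K * Mb + K * (CV + CH * Mb) + 1, by positivity, fun k hk a Λ ha haR hΛ => ?_⟩
  have hin : ∀ x ∈ closedBall (Q.xp j k) (3 / 2 * a), x ∈ ball (Q.xs j) (Q.R / 2) := by
    intro x hx
    rw [mem_closedBall] at hx
    rw [← dist_eq_norm] at hk
    rw [mem_ball]
    have := dist_triangle x (Q.xp j k) (Q.xs j)
    linarith
  have hin2 : ∀ x ∈ closedBall (Q.xp j k) (3 / 2 * a), x ∈ closedBall (Q.xs j) (2 * Q.R) := by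
    intro x hx
    have := hin x hx
    rw [mem_ball] at this
    rw [mem_closedBall]; linarith
  obtain ⟨h1, h2, h3⟩ := hH (Q.S k) rfl (Q.xs j) (by
    refine Set.Subset.trans ?_ (Q.hR2 j)
    refine (ball_subset_closedBall).trans (closedBall_subset_closedBall ?_)
    linarith)
  have h4 := hq (Q.S k) a Λ (Q.xp j k) _ CV (CH * Mb) ha hΛ (fun x hx => Q.hR2 j (hin2 x hx)) h1
    (fun x hx => by rw [h2 x (hin x hx)]; unfold Sol.h; ring) hCV (fun x hx => hV x (hin2 x hx))
    (by positivity) (fun x => (h3 x).trans (mul_le_mul_of_nonneg_left (hM k) hCH))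
  refine h4.trans ?_
  have n1 := (Q.S k).ms_nonneg (ball (Q.xp j k) (Λ * a) \ ball (Q.xp j k) a)
  have n2 := (Q.S k).mo_nonneg (Q.xp j k) a
  have n3 := (Q.S k).mo_nonneg (Q.xp j k) (2 * a)
  have n0 := (Q.S k).M_nonneg
  have hMk := hM k
  set e := (Q.S k).ms (ball (Q.xp j k) (Λ * a) \ ball (Q.xp j k) a)
  set m1 := (Q.S k).mo (Q.xp j k) a
  set m2 := (Q.S k).mo (Q.xp j k) (2 * a)
  set M := (Q.S k).M
  have hq0 : 0 ≤ m1 / (Λ * a) := by positivity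
  have p1 : K * (1 + M) * e ≤ K * (1 + Mb) * e := by gcongr
  have p2 : K / (Λ * a) * M * m1 = K * M * (m1 / (Λ * a)) := by ring
  have p3 : K * M * (m1 / (Λ * a)) ≤ K * Mb * (m1 / (Λ * a)) := by gcongr
  set C := K * (1 + Mb) + K * Mb + K * (CV + CH * Mb) + 1 with hC
  have q1 : K * (1 + Mb) ≤ C := by
    have : 0 ≤ K * Mb + K * (CV + CH * Mb) := by positivity
    linarith
  have q2 : K * Mb ≤ C := by
    have : 0 ≤ K * (1 + Mb) + K * (CV + CH * Mb) := by positivity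
    linarith
  have q3 : K * (CV + CH * Mb) ≤ C := by
    have : 0 ≤ K * (1 + Mb) + K * Mb := by positivity
    linarith
  have r1 := mul_le_mul_of_nonneg_right q1 n1
  have r2 := mul_le_mul_of_nonneg_right q2 hq0
  have r3 := mul_le_mul_of_nonneg_right q3 n3
  rw [p2, mul_add, mul_add]
  linarith

/-- the concentration scale -/
def dl (j : Fin m) (k : ℕ) : ℝ := Real.exp (-(Q.v k (Q.xp j k) + Real.log (Q.lam k)) / 2)

lemma dl_pos (j : Fin m) (k : ℕ) : 0 < Q.dl j k := Real.exp_pos _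

lemma dl_eq (j : Fin m) (k : ℕ) : Q.lam k * Real.exp (Q.v k (Q.xp j k)) = 1 / Q.dl j k ^ 2 := by
  unfold dl
  rw [← Real.exp_nat_mul, one_div, ← Real.exp_neg]
  conv_lhs => rw [← Real.exp_log (Q.hlam k), ← Real.exp_add]
  congr 1
  push_cast
  ring

lemma F_le (j : Fin m) (k : ℕ) {vM : ℝ} (hvM : 0 < vM) (hV : ∀ y ∈ Q.Ω, Q.V y ≤ vM) :
    ∀ y ∈ ball (Q.xp j k) Q.R, (Q.S k).F y ≤ vM / Q.dl j k ^ 2 := by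
  intro y hy
  have hyΩ := Q.ball_sub j k hy
  rw [(Q.S k).F_eq hyΩ]
  have h1 := Q.hmax j k y hy
  have h2 := hV y hyΩ
  have h3 := Q.hlam k
  calc Q.lam k * Q.V y * Real.exp (Q.v k y)
      ≤ Q.lam k * vM * Real.exp (Q.v k (Q.xp j k)) := by gcongr
    _ = vM * (Q.lam k * Real.exp (Q.v k (Q.xp j k))) := by ring
    _ = _ := by rw [Q.dl_eq]; ring

lemma dl_lt (j : Fin m) {η : ℝ} (hη : 0 < η) : ∀ᶠ k in atTop, Q.dl j k < η := by
  have key : ∀ η, 0 < η → η ≤ Q.R → ∀ᶠ k in atTop, Q.dl j k < η := by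
    intro η hη hηR
    obtain ⟨vm, vM, hvm, hvM, hV⟩ := Q.exists_V j
    obtain ⟨Mb, hMb, hM⟩ := Q.exists_Mb
    have hRD := Q.R_lt_D j
    have hR := Q.hR
    filter_upwards [(Q.hblow j).eventually_gt_atTop
      ((Mb * Real.log (Q.D / η) + vM * kerC 1 1 + Mb * Real.log (Q.D / Q.R)) / (2 * π))] with k hk
    by_contra hcon
    push Not at hcon
    have hd := Q.dl_pos j k
    have hb : ∀ y ∈ ball (Q.xp j k) η, (Q.S k).F y ≤ vM / η ^ 2 := by
      intro y hy
      refine (Q.F_le j k hvM (fun y hy => (hV y (subset_closure hy)).2) y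
        (ball_subset_ball hηR hy)).trans ?_
      gcongr
    have hup := (Q.S k).N_up (subset_closure (Q.xp_mem j k)) hη hηR
      (show Q.R ≤ (Q.S k).D from (by linarith : Q.R ≤ Q.D)) hb
    have hv := (Q.S k).v_le_N (subset_closure (Q.xp_mem j k))
    change Q.v k (Q.xp j k) ≤ _ at hv
    change _ ≤ _ * Real.log (Q.D / η) + _ + _ * Real.log (Q.D / Q.R) at hup
    have l1 : 0 ≤ Real.log (Q.D / η) := Real.log_nonneg (by rw [one_le_div hη]; linarith)
    have l2 : 0 ≤ Real.log (Q.D / Q.R) := Real.log_nonneg (by rw [one_le_div hR]; linarith)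
    have e1 : vM / η ^ 2 * η ^ 2 = vM := by field_simp
    rw [e1] at hup
    have g1 := mul_le_mul_of_nonneg_right (((Q.S k).ms_le (ball (Q.xp j k) Q.R)).trans (hM k)) l1
    have g2 := mul_le_mul_of_nonneg_right (hM k) l2
    rw [div_lt_iff₀ (by positivity)] at hk
    have hpi := Real.pi_pos
    have g3 := mul_le_mul_of_nonneg_left hv (by positivity : 0 ≤ 2 * π)
    linarith
  filter_upwards [key (min η Q.R) (lt_min hη Q.hR) (min_le_right _ _)] with k hk
  exact hk.trans_le (min_le_left _ _)

lemma core_lower (j : Fin m) : ∃ c0, 0 < c0 ∧ ∀ᶠ k in atTop,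
    c0 ≤ (Q.S k).ms (ball (Q.xp j k) (Q.dl j k)) := by
  obtain ⟨vm, vM, hvm, hvM, hV⟩ := Q.exists_V j
  have hκ := kerC_nonneg 1 1
  have hpi := Real.pi_pos
  set θ := (1 + 2 * (vM * kerC 1 1))⁻¹ with hθ
  have hθ0 : 0 < θ := by positivity
  have hθ1 : θ ≤ 1 := inv_le_one_of_one_le₀ (by
    have : 0 ≤ 2 * (vM * kerC 1 1) := by positivity
    linarith)
  have hθ2 : vM * θ ^ 2 * kerC 1 1 ≤ 1 / 2 := by
    have h1 : θ * (1 + 2 * (vM * kerC 1 1)) = 1 := inv_mul_cancel₀ (by positivity)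
    have h2 : vM * θ ^ 2 * kerC 1 1 ≤ vM * θ * kerC 1 1 := by
      have : θ ^ 2 ≤ θ := by nlinarith
      gcongr
    nlinarith
  refine ⟨vm * (π * θ ^ 2 / 2), by positivity, ?_⟩
  filter_upwards [Q.dl_lt j Q.hR] with k hk
  have hd := Q.dl_pos j k
  have hle : θ * Q.dl j k ≤ Q.dl j k := by nlinarith
  have hsub : closedBall (Q.xp j k) (θ * Q.dl j k) ⊆ ball (Q.xp j k) Q.R :=
    closedBall_subset_ball (by linarith)
  have h := (Q.S k).ms_lower (c := Q.xp j k) (r := θ * Q.dl j k) (A := vM / Q.dl j k ^ 2) (vm := vm)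
    (by positivity) (hsub.trans (Q.ball_sub j k))
    (fun y hy => Q.F_le j k hvM (fun y hy => (hV y (subset_closure hy)).2) y
      (hsub (ball_subset_closedBall hy)))
    (by
      have : vM / Q.dl j k ^ 2 * (θ * Q.dl j k) ^ 2 * kerC 1 1 = vM * θ ^ 2 * kerC 1 1 := by
        field_simp
      rw [this]; exact hθ2) hvm (fun y hy => (hV y (subset_closure hy)).1)
  refine le_trans (le_of_eq ?_) (h.trans ((Q.S k).ms_mono (ball_subset_ball hle)))
  change _ = Q.lam k * vm * Real.exp (Q.v k (Q.xp j k)) * _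
  have e := Q.dl_eq j k
  calc vm * (π * θ ^ 2 / 2) = vm * (1 / Q.dl j k ^ 2) * (π * (θ * Q.dl j k) ^ 2 / 2) := by
        field_simp
    _ = _ := by rw [← e]; ring

end Seq
end LG

namespace LG

lemma quad {s c0 τ : ℝ} (hc : 0 < c0) (hs : c0 ≤ s) (h : |2 * s - s ^ 2 / (4 * π)| ≤ τ) :
    |s - 8 * π| ≤ 4 * π * τ / c0 := by
  have hpi := Real.pi_pos
  have e : 2 * s - s ^ 2 / (4 * π) = -(s * (s - 8 * π) / (4 * π)) := by field_simp; ring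
  rw [e, abs_neg, abs_div, abs_mul, abs_of_pos (hc.trans_le hs), abs_of_pos (by positivity : 0 < 4 * π),
    div_le_iff₀ (by positivity)] at h
  rw [le_div_iff₀ hc]
  have := mul_le_mul_of_nonneg_right hs (abs_nonneg (s - 8 * π))
  linarith

namespace Sol
variable (S : Sol)

lemma ms_ann (c : ℂ) {a r : ℝ} (ha : 0 < a) : S.ms (ball c r \ ball c a) ≤ S.mo c r / a := by
  rw [le_div_iff₀ ha]
  unfold ms mo
  rw [mul_comm, ← integral_const_mul]
  have hm : MeasurableSet (ball c r \ ball c a) := measurableSet_ball.diff measurableSet_ball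
  calc ∫ x in ball c r \ ball c a, a * S.F x ≤ ∫ x in ball c r \ ball c a, ‖x - c‖ * S.F x := by
        refine setIntegral_mono_on (S.F_int.const_mul _).integrableOn
          ((S.mo_int c r).mono_set Set.sdiff_subset) hm fun x hx => ?_
        have := hx.2
        rw [mem_ball, dist_eq_norm, not_lt] at this
        exact mul_le_mul_of_nonneg_right this (S.F_nonneg x)
    _ ≤ _ := setIntegral_mono_set (S.mo_int c r)
        (Eventually.of_forall fun x => mul_nonneg (norm_nonneg _) (S.F_nonneg x))
        (Eventually.of_forall fun x hx => hx.1)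

lemma pigeon (c : ℂ) {d Λ : ℝ} (hd : 0 < d) (hΛ : 1 ≤ Λ) {n : ℕ} (hn : 0 < n) :
    ∃ i < n, S.ms (ball c (Λ * (Λ ^ i * d)) \ ball c (Λ ^ i * d)) ≤ S.M / n := by
  by_contra hcon
  push Not at hcon
  have h1 : ∀ i, S.ms (ball c (Λ * (Λ ^ i * d)) \ ball c (Λ ^ i * d))
      = S.ms (ball c (Λ ^ (i + 1) * d)) - S.ms (ball c (Λ ^ i * d)) := by
    intro i
    rw [show Λ * (Λ ^ i * d) = Λ ^ (i + 1) * d by ring]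
    refine S.ms_diff (ball_subset_ball ?_) measurableSet_ball measurableSet_ball
    have := pow_le_pow_right₀ hΛ (Nat.le_succ i)
    gcongr
  have h2 : ∑ i ∈ Finset.range n, S.M / n <
      ∑ i ∈ Finset.range n, (S.ms (ball c (Λ ^ (i + 1) * d)) - S.ms (ball c (Λ ^ i * d))) := by
    refine Finset.sum_lt_sum_of_nonempty (Finset.nonempty_range_iff.2 hn.ne') fun i hi => ?_
    rw [← h1]; exact hcon i (Finset.mem_range.1 hi)
  rw [Finset.sum_range_sub (fun i => S.ms (ball c (Λ ^ i * d)))] at h2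
  simp only [Finset.sum_const, Finset.card_range, nsmul_eq_mul] at h2
  rw [mul_div_cancel₀ _ (by positivity)] at h2
  have h3 := S.ms_le (ball c (Λ ^ n * d))
  have h4 := S.ms_nonneg (ball c (Λ ^ 0 * d))
  linarith

end Sol

namespace Seq
variable {m : ℕ} (Q : Seq m)

lemma core (j : Fin m) {η : ℝ} (hη : 0 < η) : ∃ L, 1 ≤ L ∧ ∀ᶠ k in atTop,
    8 * π - η ≤ (Q.S k).ms (ball (Q.xp j k) (L * Q.dl j k)) := by
  have hpi := Real.pi_pos
  have hR := Q.hR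
  obtain ⟨c0, hc0, hcore⟩ := Q.core_lower j
  obtain ⟨C, hC, hq⟩ := Q.quant j
  obtain ⟨Mb, hMb, hM⟩ := Q.exists_Mb
  set τ := η * c0 / (4 * π) with hτ
  have hτ0 : 0 < τ := by positivity
  set Λ := 2 + 3 * C * Mb / τ with hΛ
  have hΛ2 : 2 ≤ Λ := by
    have : 0 ≤ 3 * C * Mb / τ := by positivity
    linarith
  have hΛ3 : C * (Mb / Λ) ≤ τ / 3 := by
    rw [← mul_div_assoc, div_le_iff₀ (by linarith)]
    have : τ / 3 * (3 * C * Mb / τ) = C * Mb := by field_simp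
    rw [hΛ, mul_add, this]; linarith
  obtain ⟨n, hn⟩ := exists_nat_gt (3 * C * Mb / τ)
  have hn0 : (0:ℝ) < n := lt_of_le_of_lt (by positivity) hn
  have hn3 : C * (Mb / n) ≤ τ / 3 := by
    rw [← mul_div_assoc, div_le_iff₀ hn0]
    rw [div_lt_iff₀ hτ0] at hn
    linarith
  have hL1 : 1 ≤ Λ ^ n := one_le_pow₀ (by linarith)
  refine ⟨Λ ^ n, hL1, ?_⟩
  set b := min (Q.R / 8) (τ / (6 * C * Mb)) with hb
  have hb0 : 0 < b := lt_min (by positivity) (by positivity)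
  filter_upwards [hcore, Q.near j (by positivity : 0 < Q.R / 8),
    Q.dl_lt j (by positivity : 0 < b / Λ ^ n)] with k h1 h2 h3
  have hd := Q.dl_pos j k
  rw [lt_div_iff₀ (by positivity), mul_comm] at h3
  obtain ⟨i, hi, hp⟩ := (Q.S k).pigeon (Q.xp j k) hd (by linarith : 1 ≤ Λ) (by exact_mod_cast hn0 : 0 < n)
  set a := Λ ^ i * Q.dl j k with ha
  have hi1 : 1 ≤ Λ ^ i := one_le_pow₀ (by linarith)
  have ha0 : 0 < a := by positivity
  have haL : a ≤ Λ ^ n * Q.dl j k := by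
    have := pow_le_pow_right₀ (by linarith : 1 ≤ Λ) hi.le
    rw [ha]; gcongr
  have hab : a ≤ b := haL.trans h3.le
  have hda : Q.dl j k ≤ a := by rw [ha]; nlinarith
  have hqk := hq k h2 a Λ ha0 (hab.trans (min_le_left _ _)) hΛ2
  have hMk := hM k
  have hMn := (Q.S k).M_nonneg
  have t1 : C * (Q.S k).ms (ball (Q.xp j k) (Λ * a) \ ball (Q.xp j k) a) ≤ τ / 3 := by
    refine le_trans ?_ hn3
    have : (Q.S k).M / n ≤ Mb / n := by gcongr
    exact mul_le_mul_of_nonneg_left (hp.trans this) hC.le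
  have t2 : C * ((Q.S k).mo (Q.xp j k) a / (Λ * a)) ≤ τ / 3 := by
    refine le_trans (mul_le_mul_of_nonneg_left ?_ hC.le) hΛ3
    have h5 := (Q.S k).mo_le (Q.xp j k) ha0.le
    rw [div_le_div_iff₀ (by positivity) (by linarith)]
    have : a * (Q.S k).M ≤ a * Mb := by gcongr
    calc (Q.S k).mo (Q.xp j k) a * Λ ≤ (a * Mb) * Λ := by
          refine mul_le_mul_of_nonneg_right (by linarith) (by linarith)
      _ = _ := by ring
  have t3 : C * (Q.S k).mo (Q.xp j k) (2 * a) ≤ τ / 3 := by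
    have h5 := (Q.S k).mo_le (Q.xp j k) (by positivity : 0 ≤ 2 * a)
    have h6 : a ≤ τ / (6 * C * Mb) := hab.trans (min_le_right _ _)
    rw [le_div_iff₀ (by positivity)] at h6
    have h7 : 2 * a * (Q.S k).M ≤ 2 * a * Mb := by gcongr
    have h8 := mul_le_mul_of_nonneg_left (h5.trans h7) hC.le
    linarith
  have hs := h1.trans ((Q.S k).ms_mono (ball_subset_ball hda))
  have hfin := quad hc0 hs (hqk.trans (by rw [mul_add, mul_add]; linarith : _ ≤ τ))
  have e : 4 * π * τ / c0 = η := by rw [hτ]; field_simp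
  rw [e] at hfin
  have h9 := (abs_le.1 hfin).1
  have h10 := (Q.S k).ms_mono (ball_subset_ball (x := Q.xp j k) haL)
  linarith

lemma core' (j : Fin m) {η r : ℝ} (hη : 0 < η) (hr : 0 < r) : ∀ᶠ k in atTop,
    8 * π - η ≤ (Q.S k).ms (ball (Q.xp j k) r) := by
  obtain ⟨L, hL, h⟩ := Q.core j hη
  filter_upwards [h, Q.dl_lt j (by positivity : 0 < r / L)] with k h1 h2
  rw [lt_div_iff₀ (by positivity), mul_comm] at h2
  exact h1.trans ((Q.S k).ms_mono (ball_subset_ball h2.le))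

lemma upper (j : Fin m) {η : ℝ} (hη : 0 < η) : ∀ᶠ k in atTop,
    (Q.S k).ms (ball (Q.xp j k) (Q.R + Q.R / 2)) ≤ 8 * π + η := by
  classical
  have hR := Q.hR
  have hm0 : 0 < m := j.pos
  have hm : (0:ℝ) < m := by exact_mod_cast hm0
  set η' := η / m with hη'
  have hη0 : 0 < η' := by positivity
  have hall : ∀ᶠ k in atTop, ∀ i, 8 * π - η' ≤ (Q.S k).ms (ball (Q.xp i k) (Q.R / 8)) :=
    eventually_all.2 fun i => Q.core' i hη0 (by positivity)
  have hnear : ∀ᶠ k in atTop, ∀ i, ‖Q.xp i k - Q.xs i‖ < Q.R / 8 :=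
    eventually_all.2 fun i => Q.near i (by positivity)
  have hMe : ∀ᶠ k in atTop, (Q.S k).M < 8 * π * m + η' :=
    Q.M_tendsto.eventually_lt_const (by linarith)
  filter_upwards [hall, hnear, hMe] with k h1 h2 h3
  set r : Fin m → ℝ := fun i => if i = j then Q.R + Q.R / 2 else Q.R / 8 with hr
  set B : Fin m → Set ℂ := fun i => ball (Q.xp i k) (r i) with hB
  have hdisj : Pairwise (Function.onFun Disjoint B) := by
    intro i i' hii
    refine ball_disjoint_ball ?_
    have hsep := Q.hsep i i' hii
    have ha := h2 i
    have hb := h2 i'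
    have t1 : ‖Q.xs i - Q.xs i'‖ ≤ ‖Q.xp i k - Q.xs i‖ + ‖Q.xp i k - Q.xp i' k‖ + ‖Q.xp i' k - Q.xs i'‖ := by
      rw [show Q.xs i - Q.xs i' = -(Q.xp i k - Q.xs i) + (Q.xp i k - Q.xp i' k) + (Q.xp i' k - Q.xs i') by ring]
      refine (norm_add_le _ _).trans ?_
      have := norm_add_le (-(Q.xp i k - Q.xs i)) (Q.xp i k - Q.xp i' k)
      rw [norm_neg] at this
      linarith
    rw [dist_eq_norm]
    have hrr : r i + r i' ≤ Q.R + Q.R / 2 + Q.R / 8 := by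
      simp only [hr]
      by_cases e1 : i = j <;> by_cases e2 : i' = j
      · exact absurd (e1.trans e2.symm) hii
      all_goals simp only [e1, e2, if_true, if_false]; linarith
    linarith
  have hsum : ∑ i, (Q.S k).ms (B i) ≤ (Q.S k).M := by
    have := integral_iUnion_fintype (f := (Q.S k).F) (μ := volume) (s := B)
      (fun i => measurableSet_ball) hdisj (fun i => (Q.S k).F_int.integrableOn)
    change _ = ∑ i, (Q.S k).ms (B i) at this
    rw [← this]
    exact (Q.S k).ms_le _
  rw [← Finset.add_sum_erase _ _ (Finset.mem_univ j)] at hsum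
  have hcard : ((Finset.univ.erase j).card : ℝ) = m - 1 := by
    rw [Finset.card_erase_of_mem (Finset.mem_univ j), Finset.card_univ, Fintype.card_fin,
      Nat.cast_sub hm0]
    simp
  have hlow : ((m:ℝ) - 1) * (8 * π - η') ≤ ∑ i ∈ Finset.univ.erase j, (Q.S k).ms (B i) := by
    rw [← hcard, ← nsmul_eq_mul]
    refine Finset.card_nsmul_le_sum _ _ _ fun i hi => ?_
    have : r i = Q.R / 8 := by simp [hr, (Finset.mem_erase.1 hi).1]
    simp only [hB]
    rw [this]
    exact h1 i
  have hj : (Q.S k).ms (B j) = (Q.S k).ms (ball (Q.xp j k) (Q.R + Q.R / 2)) := by simp [hB, hr]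
  rw [hj] at hsum
  have e : η = m * η' := by rw [hη']; field_simp
  rw [e]
  nlinarith

end Seq
end LG

namespace LG
namespace Seq
variable {m : ℕ} (Q : Seq m)

lemma dl_upper (j : Fin m) {p : ℝ} (hp : 0 < p) : ∃ C1, 0 < C1 ∧ ∀ᶠ k in atTop,
    Q.dl j k ≤ C1 * Q.lam k ^ (1 / (2 + p)) := by
  obtain ⟨vm, vM, hvm, hvM, hV⟩ := Q.exists_V j
  obtain ⟨Mb, hMb, hM⟩ := Q.exists_Mb
  have hRD := Q.R_lt_D j
  have hR := Q.hR
  have hD := Q.hD1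
  have hpi := Real.pi_pos
  set C' := (8 * π + 2 * π * p) * Real.log Q.D + vM * kerC 1 1 + Mb * Real.log (Q.D / Q.R) with hC'
  refine ⟨Real.exp (C' / (4 * π + 2 * π * p)), Real.exp_pos _, ?_⟩
  filter_upwards [Q.upper j (by positivity : 0 < 2 * π * p), Q.dl_lt j hR] with k h1 h2
  have hd := Q.dl_pos j k
  have hup := (Q.S k).N_up (subset_closure (Q.xp_mem j k)) hd h2.le
      (show Q.R ≤ (Q.S k).D from (by linarith : Q.R ≤ Q.D))
      (fun y hy => Q.F_le j k hvM (fun y hy => (hV y (subset_closure hy)).2) y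
        (ball_subset_ball h2.le hy))
  have hv := (Q.S k).v_le_N (subset_closure (Q.xp_mem j k))
  change Q.v k (Q.xp j k) ≤ _ at hv
  change _ ≤ _ * Real.log (Q.D / Q.dl j k) + _ + _ * Real.log (Q.D / Q.R) at hup
  have l1 : 0 ≤ Real.log (Q.D / Q.dl j k) := Real.log_nonneg (by rw [one_le_div hd]; linarith)
  have l2 : 0 ≤ Real.log (Q.D / Q.R) := Real.log_nonneg (by rw [one_le_div hR]; linarith)
  have e1 : vM / Q.dl j k ^ 2 * Q.dl j k ^ 2 = vM := by field_simp
  rw [e1] at hup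
  have hms : (Q.S k).ms (ball (Q.xp j k) Q.R) ≤ 8 * π + 2 * π * p :=
    ((Q.S k).ms_mono (ball_subset_ball (by linarith))).trans h1
  have g1 := mul_le_mul_of_nonneg_right hms l1
  have g2 := mul_le_mul_of_nonneg_right (hM k) l2
  have g3 := mul_le_mul_of_nonneg_left hv (by positivity : 0 ≤ 2 * π)
  have el : Real.log (Q.dl j k) = -(Q.v k (Q.xp j k) + Real.log (Q.lam k)) / 2 := by
    unfold dl; rw [Real.log_exp]
  rw [Real.log_div (by linarith) hd.ne'] at g1 hup
  have g4 : (4 * π + 2 * π * p) * Real.log (Q.dl j k) ≤ 2 * π * Real.log (Q.lam k) + C' := by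
    have : Q.v k (Q.xp j k) = -2 * Real.log (Q.dl j k) - Real.log (Q.lam k) := by rw [el]; ring
    rw [this] at g3
    rw [hC']
    linarith
  have g5 : Real.log (Q.dl j k) ≤ C' / (4 * π + 2 * π * p) + Real.log (Q.lam k) * (1 / (2 + p)) := by
    have h0 : (0:ℝ) < 4 * π + 2 * π * p := by positivity
    have e : C' / (4 * π + 2 * π * p) + Real.log (Q.lam k) * (1 / (2 + p))
        = (2 * π * Real.log (Q.lam k) + C') / (4 * π + 2 * π * p) := by
      have : 2 + p ≠ 0 := by positivity
      rw [show 4 * π + 2 * π * p = 2 * π * (2 + p) by ring]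
      field_simp
      ring
    rw [e, le_div_iff₀ h0]
    linarith
  rw [← Real.exp_log hd, Real.rpow_def_of_pos (Q.hlam k), ← Real.exp_add]
  exact Real.exp_le_exp.2 g5

lemma mo_bound (j : Fin m) {ε : ℝ} (hε : 0 < ε) (hε2 : ε < 1 / 2) : ∃ C, 0 < C ∧ ∀ᶠ k in atTop,
    (Q.S k).mo (Q.xp j k) Q.R ≤ C * Q.lam k ^ (1 / 2 - ε / 2) := by
  obtain ⟨vm, vM, hvm, hvM, hV⟩ := Q.exists_V j
  obtain ⟨Mb, hMb, hM⟩ := Q.exists_Mb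
  have hRD := Q.R_lt_D j
  have hR := Q.hR
  have hD0 : 0 < Q.D := by linarith
  have hpi := Real.pi_pos
  set p := ε / 3 with hp
  have hp0 : 0 < p := by positivity
  obtain ⟨C1, hC1, hdl⟩ := Q.dl_upper j hp0
  obtain ⟨L, hL, hcore⟩ := Q.core j (by positivity : 0 < π * p)
  set q := 1 / (2 + p) with hq
  set A := 2 * L * C1 with hA
  have hA0 : 0 < A := by positivity
  have hκ := kerC_nonneg p Q.D
  set C2 := 3 * kerC p Q.D * (vM * (2 * Q.D) ^ (4 + p) * Real.exp (Mb * Real.log (Q.D / (Q.R / 2))) * Q.D ^ p) with hC2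
  have hC20 : 0 ≤ C2 := by positivity
  refine ⟨A * Mb + C2 * A ^ (-1 - 3 * p), by positivity, ?_⟩
  filter_upwards [hdl, hcore, Q.upper j (by positivity : 0 < π * p),
    Q.dl_lt j (by positivity : 0 < Q.R / L), Q.hlam0.eventually_lt_const one_pos]
    with k h1 h2 h3 h4 h5
  have hd := Q.dl_pos j k
  have hl := Q.hlam k
  rw [lt_div_iff₀ (by positivity), mul_comm] at h4
  set ρ := A * Q.lam k ^ q with hρ
  have hρ0 : 0 < ρ := by positivity
  have hl2 : 2 * (L * Q.dl j k) ≤ ρ := by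
    calc 2 * (L * Q.dl j k) ≤ 2 * (L * (C1 * Q.lam k ^ q)) := by gcongr
      _ = ρ := by rw [hρ, hA]; ring
  have hsub : ball (Q.xp j k) (L * Q.dl j k) ⊆ ball (Q.xp j k) (Q.R + Q.R / 2) :=
    ball_subset_ball (by linarith)
  have hann := (Q.S k).ann_est (c := Q.xp j k) (l := L * Q.dl j k) (g := Q.R / 2) (r1 := Q.R)
    (ρ := ρ) (p := p) (vM := vM) hp0 (by linarith) (by positivity)
    (show Q.R / 2 ≤ Q.D by linarith) (Q.xp_mem j k) (Q.ball_sub j k) hρ0 hl2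
    (by
      rw [(Q.S k).ms_diff hsub measurableSet_ball measurableSet_ball]
      linarith)
    (((Q.S k).ms_mono hsub).trans (h3.trans (by
      have : 0 < π * p := by positivity
      linarith)))
    (fun y hy => (hV y (subset_closure hy)).2)
  change _ ≤ ρ * (Q.S k).M + 3 * kerC p Q.D * (vM * (2 * Q.D) ^ (4 + p) *
    Real.exp ((Q.S k).M * Real.log (Q.D / (Q.R / 2))) * Q.D ^ p) * Q.lam k * ρ ^ (-1 - 3 * p) at hann
  have hMk := hM k
  have l2 : 0 ≤ Real.log (Q.D / (Q.R / 2)) :=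
    Real.log_nonneg (by rw [one_le_div (by positivity)]; linarith)
  have b1 : (Q.S k).mo (Q.xp j k) Q.R ≤ ρ * Mb + C2 * Q.lam k * ρ ^ (-1 - 3 * p) := by
    refine hann.trans ?_
    rw [hC2]
    gcongr
  have ex : ρ ^ (-1 - 3 * p) = A ^ (-1 - 3 * p) * Q.lam k ^ (q * (-1 - 3 * p)) := by
    rw [hρ, Real.mul_rpow hA0.le (by positivity), ← Real.rpow_mul hl.le]
  have hq2 : q ≤ 1 / 2 := by
    rw [hq]; exact one_div_le_one_div_of_le (by norm_num) (by linarith)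
  have hq1 : 1 / 2 - ε / 2 ≤ q := by
    rw [hq, le_div_iff₀ (by positivity), hp]; nlinarith
  have b2 : Q.lam k ^ q ≤ Q.lam k ^ (1 / 2 - ε / 2) :=
    Real.rpow_le_rpow_of_exponent_ge hl h5.le hq1
  have b3 : Q.lam k * Q.lam k ^ (q * (-1 - 3 * p)) ≤ Q.lam k ^ (1 / 2 - ε / 2) := by
    have : Q.lam k * Q.lam k ^ (q * (-1 - 3 * p)) = Q.lam k ^ (1 + q * (-1 - 3 * p)) := by
      rw [Real.rpow_add hl, Real.rpow_one]
    rw [this]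
    refine Real.rpow_le_rpow_of_exponent_ge hl h5.le ?_
    have := mul_le_mul_of_nonneg_right hq2 (by positivity : 0 ≤ 1 + 3 * p)
    rw [hp] at this ⊢
    linarith
  have hAp : 0 ≤ A ^ (-1 - 3 * p) := by positivity
  calc _ ≤ ρ * Mb + C2 * Q.lam k * ρ ^ (-1 - 3 * p) := b1
    _ = A * Mb * Q.lam k ^ q + C2 * A ^ (-1 - 3 * p) * (Q.lam k * Q.lam k ^ (q * (-1 - 3 * p))) := by
        rw [ex, hρ]; ring
    _ ≤ A * Mb * Q.lam k ^ (1 / 2 - ε / 2) + C2 * A ^ (-1 - 3 * p) * Q.lam k ^ (1 / 2 - ε / 2) := by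
        gcongr
    _ = _ := by ring

lemma final (j : Fin m) {ε : ℝ} (hε : 0 < ε) (hε2 : ε < 1 / 2) : ∃ C, 0 < C ∧ ∀ᶠ k in atTop,
    |(Q.S k).ms (ball (Q.xp j k) Q.R) - 8 * π| ≤ C * Q.lam k ^ (1 / 2 - ε / 2) := by
  have hR := Q.hR
  have hpi := Real.pi_pos
  obtain ⟨c0, hc0, hcore⟩ := Q.core_lower j
  obtain ⟨C, hC, hq⟩ := Q.quant j
  obtain ⟨C3, hC3, hmo⟩ := Q.mo_bound j hε hε2
  set E := 4 * π * (C * (8 / Q.R + 4 / Q.R + 1)) / c0 + 8 / Q.R with hE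
  have hE0 : 0 < E := by positivity
  refine ⟨E * C3, by positivity, ?_⟩
  filter_upwards [hcore, hmo, Q.near j (by positivity : 0 < Q.R / 8),
    Q.dl_lt j (by positivity : 0 < Q.R / 8)] with k h1 h2 h3 h4
  have hqk := hq k h3 (Q.R / 8) 2 (by positivity) le_rfl le_rfl
  set mo := (Q.S k).mo (Q.xp j k) Q.R with hmod
  have a1 : (Q.S k).ms (ball (Q.xp j k) (2 * (Q.R / 8)) \ ball (Q.xp j k) (Q.R / 8)) ≤ 8 / Q.R * mo := by
    refine ((Q.S k).ms_ann (Q.xp j k) (by positivity)).trans ?_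
    have := (Q.S k).mo_mono (Q.xp j k) (by linarith : 2 * (Q.R / 8) ≤ Q.R)
    calc _ ≤ mo / (Q.R / 8) := by gcongr
      _ = _ := by field_simp
  have a2 : (Q.S k).mo (Q.xp j k) (Q.R / 8) / (2 * (Q.R / 8)) ≤ 4 / Q.R * mo := by
    have := (Q.S k).mo_mono (Q.xp j k) (by linarith : (Q.R / 8) ≤ Q.R)
    calc _ ≤ mo / (2 * (Q.R / 8)) := by gcongr
      _ = _ := by field_simp; ring
  have a3 : (Q.S k).mo (Q.xp j k) (2 * (Q.R / 8)) ≤ mo :=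
    (Q.S k).mo_mono (Q.xp j k) (by linarith : 2 * (Q.R / 8) ≤ Q.R)
  have a4 : (Q.S k).ms (ball (Q.xp j k) Q.R \ ball (Q.xp j k) (Q.R / 8)) ≤ 8 / Q.R * mo := by
    refine ((Q.S k).ms_ann (Q.xp j k) (by positivity)).trans (le_of_eq ?_)
    rw [hmod]; field_simp
  have a5 := (Q.S k).ms_nonneg (ball (Q.xp j k) Q.R \ ball (Q.xp j k) (Q.R / 8))
  rw [(Q.S k).ms_diff (ball_subset_ball (by linarith)) measurableSet_ball measurableSet_ball] at a4 a5
  have hs := h1.trans ((Q.S k).ms_mono (ball_subset_ball h4.le))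
  have a6 := quad hc0 hs (hqk.trans (mul_le_mul_of_nonneg_left
    (add_le_add (add_le_add a1 a2) a3) hC.le))
  have a7 : 4 * π * (C * (8 / Q.R * mo + 4 / Q.R * mo + mo)) / c0 + 8 / Q.R * mo = E * mo := by
    rw [hE]; ring
  have a8 : E * mo ≤ E * C3 * Q.lam k ^ (1 / 2 - ε / 2) := by
    rw [mul_assoc]; exact mul_le_mul_of_nonneg_left h2 hE0.le
  refine le_trans ?_ a8
  rw [← a7]
  rw [abs_le] at a6 ⊢
  constructor <;> linarith [a6.1, a6.2]

lemma final_err (j : Fin m) {ε : ℝ} (hε : 0 < ε) (hε2 : ε < 1 / 2) :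
    ∃ err : ℕ → ℝ, Tendsto err atTop (𝓝 0) ∧ ∀ᶠ k in atTop,
      (Q.S k).ms (ball (Q.xp j k) Q.R) = 8 * π + err k * Q.lam k ^ ((1 : ℝ) / 2 - ε) := by
  obtain ⟨C, hC, h⟩ := Q.final j hε hε2
  refine ⟨fun k => ((Q.S k).ms (ball (Q.xp j k) Q.R) - 8 * π) / Q.lam k ^ ((1 : ℝ) / 2 - ε), ?_, ?_⟩
  · have hlim : Tendsto (fun k => C * Q.lam k ^ (ε / 2)) atTop (𝓝 0) := by
      have := (Q.hlam0.rpow_const (p := ε / 2) (Or.inr (by positivity))).const_mul C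
      rwa [Real.zero_rpow (by positivity), mul_zero] at this
    refine squeeze_zero_norm' ?_ hlim
    filter_upwards [h] with k hk
    have hl := Q.hlam k
    rw [norm_div, Real.norm_eq_abs, Real.norm_of_nonneg (by positivity : 0 ≤ Q.lam k ^ ((1 : ℝ) / 2 - ε)),
      div_le_iff₀ (by positivity), mul_assoc, ← Real.rpow_add hl]
    have e : ε / 2 + (1 / 2 - ε) = 1 / 2 - ε / 2 := by ring
    rw [e]
    exact hk
  · refine Eventually.of_forall fun k => ?_
    have hl := Q.hlam k
    have : Q.lam k ^ ((1 : ℝ) / 2 - ε) ≠ 0 := by positivity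
    rw [div_mul_cancel₀ _ this]
    ring

end Seq
end LG

namespace LG

/-- the standard identification of `ℂ` with the plane -/
def ee : ℂ ≃ₗᵢ[ℝ] E2 := Complex.orthonormalBasisOneI.repr

lemma ee_one : ee 1 = EuclideanSpace.single 0 1 := by
  have := Complex.orthonormalBasisOneI.repr_self 0
  simpa [ee] using this

lemma ee_I : ee Complex.I = EuclideanSpace.single 1 1 := by
  have := Complex.orthonormalBasisOneI.repr_self 1
  simpa [ee] using this

lemma second_transport {f : E2 → ℝ} {Ω : Set E2} (ho : IsOpen Ω) (hf : ContDiffOn ℝ 2 f Ω) {x : ℂ}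
    (hx : ee x ∈ Ω) (u : ℂ) :
    fderiv ℝ (fderiv ℝ (fun z => f (ee z))) x u u
      = fderiv ℝ (fun y => fderiv ℝ f y (ee u)) (ee x) (ee u) := by
  have hd : DifferentiableAt ℝ (fderiv ℝ f) (ee x) :=
    ((hf.contDiffAt (ho.mem_nhds hx)).fderiv_right (m := 1) (by norm_num)).differentiableAt (by norm_num)
  have h1 : fderiv ℝ (fun z => f (ee z)) = fun z => (fderiv ℝ f (ee z)).comp
      (ee.toContinuousLinearEquiv : ℂ →L[ℝ] E2) := by
    ext1 z
    exact ee.toContinuousLinearEquiv.comp_right_fderiv (f := f) (x := z)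
  have he : HasFDerivAt (fun z => ee z) (ee.toContinuousLinearEquiv : ℂ →L[ℝ] E2) x :=
    ee.toContinuousLinearEquiv.hasFDerivAt
  have h2 : HasFDerivAt (fun z => fderiv ℝ f (ee z))
      ((fderiv ℝ (fderiv ℝ f) (ee x)).comp (ee.toContinuousLinearEquiv : ℂ →L[ℝ] E2)) x :=
    hd.hasFDerivAt.comp x he
  have h3 := h2.clm_comp (hasFDerivAt_const (ee.toContinuousLinearEquiv : ℂ →L[ℝ] E2) x)
  have h4 := hd.hasFDerivAt.clm_apply (hasFDerivAt_const (ee u) (ee x))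
  rw [h1, h3.fderiv, h4.fderiv]
  simp

lemma lap_transport {f : E2 → ℝ} {Ω : Set E2} (ho : IsOpen Ω) (hf : ContDiffOn ℝ 2 f Ω) {x : ℂ}
    (hx : ee x ∈ Ω) :
    fderiv ℝ (fderiv ℝ (fun z => f (ee z))) x 1 1
      + fderiv ℝ (fderiv ℝ (fun z => f (ee z))) x Complex.I Complex.I = lap f (ee x) := by
  rw [second_transport ho hf hx, second_transport ho hf hx, ee_one, ee_I]
  unfold lap
  rw [Fin.sum_univ_two]

lemma int_transport (A : Set E2) (g : E2 → ℝ) :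
    ∫ x in ee ⁻¹' A, g (ee x) = ∫ y in A, g y :=
  ee.measurePreserving.setIntegral_preimage_emb ee.toHomeomorph.measurableEmbedding g A

lemma closure_pre (A : Set E2) : closure (ee ⁻¹' A) = ee ⁻¹' closure A :=
  (ee.toHomeomorph.preimage_closure A).symm

lemma frontier_pre (A : Set E2) : frontier (ee ⁻¹' A) = ee ⁻¹' frontier A :=
  (ee.toHomeomorph.preimage_frontier A).symm

lemma exists_D (S : Set E2) (h : IsBounded S) :
    ∃ D : ℝ, 1 ≤ D ∧ ∀ x ∈ closure S, ∀ y ∈ closure S, dist x y < D := by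
  refine ⟨Metric.diam (closure S) + 1, by linarith [Metric.diam_nonneg (s := closure S)], ?_⟩
  intro x hx y hy
  have := Metric.dist_le_diam_of_mem h.closure hx hy
  linarith

lemma norm_ee_sub (x y : ℂ) : ‖x - y‖ = dist (ee x) (ee y) := by
  rw [ee.dist_map, dist_eq_norm]

/-- transport of the setting to `ℂ` -/
def toSeq {m : ℕ} (T : Setting m) : Seq m where
  Ω := ee ⁻¹' T.Ω
  V := fun z => T.V (ee z)
  D := Classical.choose (exists_D T.Ω T.hbd)
  lam := T.lam
  v := fun k z => T.v k (ee z)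
  xs := fun j => ee.symm (T.xstar j)
  xp := fun j k => ee.symm (T.xpt j k)
  R := T.R
  hopen := T.hopen.preimage ee.continuous
  hbd := by
    exact ee.antilipschitz.isBounded_preimage T.hbd
  hD1 := (Classical.choose_spec (exists_D T.Ω T.hbd)).1
  hD := by
    intro x hx y hy
    rw [closure_pre] at hx hy
    rw [norm_ee_sub]
    exact (Classical.choose_spec (exists_D T.Ω T.hbd)).2 _ hx _ hy
  hVpos := by
    intro x hx
    rw [closure_pre] at hx
    exact T.hVpos _ hx
  hVc := by
    rw [closure_pre]
    exact T.hVreg.continuousOn.comp ee.continuous.continuousOn fun x hx => hx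
  hV1 := (T.hVreg.mono subset_closure).comp ee.contDiff.contDiffOn fun x hx => hx
  hlam := T.hlam_pos
  hv2 := fun k => (T.hv_reg k).comp ee.contDiff.contDiffOn fun x hx => hx
  hvc := by
    intro k
    rw [closure_pre]
    exact (T.hv_cont k).comp ee.continuous.continuousOn fun x hx => hx
  hPDE := by
    intro k x hx
    rw [lap_transport T.hopen (T.hv_reg k) hx, ← T.hPDE k _ hx, neg_neg]
  hBC := by
    intro k x hx
    rw [frontier_pre] at hx
    exact T.hBC k _ hx
  hR := T.hR
  hR2 := by
    intro j x hx
    refine T.hR2 j ?_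
    rw [mem_closedBall] at hx ⊢
    rwa [← ee.symm.dist_map, ee.symm_apply_apply]
  hsep := by
    intro i j hij
    have h := T.hRdisj i j hij
    rw [← map_sub, LinearIsometryEquiv.norm_map, ← dist_eq_norm]
    by_contra hcon
    push Not at hcon
    have hR := T.hR
    have hm : midpoint ℝ (T.xstar i) (T.xstar j) ∈ ball (T.xstar i) T.R ∩ ball (T.xstar j) T.R := by
      constructor
      · rw [mem_ball, dist_midpoint_left]
        simp only [Real.norm_ofNat]; linarith
      · rw [mem_ball, dist_midpoint_right]
        simp only [Real.norm_ofNat]; linarith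
    exact Set.disjoint_left.1 h hm.1 hm.2
  hlim := fun j => (ee.symm.continuous.tendsto _).comp (T.hxpt_lim j)
  hmem := by
    intro j k
    have := T.hxpt_mem j k
    rw [mem_ball] at this ⊢
    rwa [ee.symm.dist_map]
  hmax := by
    intro j k x hx
    rw [ee.apply_symm_apply]
    refine T.hxpt_max j k _ ?_
    rw [mem_ball] at hx ⊢
    rwa [← ee.symm.dist_map, ee.symm_apply_apply]
  hblow := by
    intro j
    simpa only [ee.apply_symm_apply] using T.hxpt_blow j
  hlam0 := T.hlam0
  hmass := by
    refine T.hmass.congr fun k => ?_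
    rw [← int_transport]

lemma sigma_transport {m : ℕ} (T : Setting m) (j : Fin m) (k : ℕ) :
    ((toSeq T).S k).ms (ball ((toSeq T).xp j k) (toSeq T).R) = T.sigmaLoc j k := by
  unfold Setting.sigmaLoc
  rw [← int_transport, ee.preimage_ball]
  unfold Sol.ms
  refine setIntegral_congr_fun measurableSet_ball fun x hx => ?_
  exact ((toSeq T).S k).F_eq ((toSeq T).ball_sub j k hx)

end LG

/-- refined local quantization under `V ∈ C¹(Ω̄)` only:
`σ_{j,k} = 8π + o(λ_k^{1/2−ε})` for every `0 < ε < 1/2`. -/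
theorem statement11 {m : ℕ} (S : Setting m) (j : Fin m)
    (ε : ℝ) (hε1 : 0 < ε) (hε2 : ε < 1 / 2) :
    ∃ err : ℕ → ℝ, Tendsto err atTop (𝓝 0) ∧ ∀ᶠ k in atTop,
      S.sigmaLoc j k = 8 * π + err k * S.lam k ^ ((1 : ℝ) / 2 - ε) := by
  obtain ⟨err, h1, h2⟩ := (LG.toSeq S).final_err j hε1 hε2
  refine ⟨err, h1, ?_⟩
  filter_upwards [h2] with k hk
  rw [← LG.sigma_transport]
  exact hk
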